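/- (Topological Noetherianity.) Let Q_M be a quasianalytic Denjoy–Carleman class and a ∈ ℝ^n. For each j ≥ 1 let X_j be a closed Q_M-subset of some open neighborhood U_j of a, and suppose the sequence of germs at a is decreasing: for each j there is an open neighborhood W of a with X_{j+1}∩W ⊆ X_j∩W. Then the sequence of germs stabilizes: there exists k such that for every j ≥ k there is an open neighborhood W of a with X_j∩W = X_k∩W. -/

import Mathlib

namespace QDC

/-- `M` is a sequence defining a quasianalytic Denjoy–Carleman class: positive,
logarithmically convex, with `sup_k (M_{k+1}/M_k)^{1/k} < ∞` and
`Σ_k M_k/((k+1) M_{k+1}) = ∞`. -/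
def IsDCSeq (M : ℕ → ℝ) : Prop :=
  (∀ k, 0 < M k) ∧
  (∀ k, M (k + 1) / M k ≤ M (k + 2) / M (k + 1)) ∧
  (∃ C : ℝ, ∀ k : ℕ, 1 ≤ k → (M (k + 1) / M k) ^ ((1 : ℝ) / k) ≤ C) ∧
  ¬ Summable (fun k => M k / ((k + 1) * M (k + 1)))

variable {σ : Type*} [Fintype σ] [DecidableEq σ]

/-- First-order partial derivative in the `i`-th coordinate direction. -/
noncomputable def pd (i : σ) (f : (σ → ℝ) → ℝ) : (σ → ℝ) → ℝ :=
  fun x => fderiv ℝ f x (Pi.single i 1)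

/-- Iterated partial derivative `∂^{|α|} f / ∂x^α` for a multi-index `α`. -/
noncomputable def mpd (α : σ → ℕ) (f : (σ → ℝ) → ℝ) : (σ → ℝ) → ℝ :=
  (Finset.univ : Finset σ).toList.foldr (fun i g => (pd i)^[α i] g) f

/-- `α! = α_1! ⋯ α_n!`. -/
def mfact (α : σ → ℕ) : ℕ := ∏ i, (α i).factorial

/-- `|α| = α_1 + ⋯ + α_n`. -/
def mdeg (α : σ → ℕ) : ℕ := ∑ i, α i

/-- `f` belongs to the Denjoy–Carleman class `Q_M(V)`. -/
def MemDC (M : ℕ → ℝ) (V : Set (σ → ℝ)) (f : (σ → ℝ) → ℝ) : Prop :=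
  ContDiffOn ℝ (⊤ : ℕ∞) f V ∧
  ∀ K ⊆ V, IsCompact K → ∃ A B : ℝ, 0 < A ∧ 0 < B ∧
    ∀ x ∈ K, ∀ α : σ → ℕ,
      |mpd α f x| ≤ A * B ^ mdeg α * (mfact α : ℝ) * M (mdeg α)

/-- `X` is a closed `Q_M`-subset of the open set `U`: it is closed in `U` and locally
the common zero set of finitely many functions of class `Q_M`. -/
def IsQMClosed (M : ℕ → ℝ) {n : ℕ} (U X : Set (Fin n → ℝ)) : Prop :=
  X ⊆ U ∧ closure X ∩ U ⊆ X ∧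
  ∀ b ∈ X, ∃ V : Set (Fin n → ℝ), IsOpen V ∧ b ∈ V ∧ V ⊆ U ∧
    ∃ (k : ℕ) (g : Fin k → ((Fin n → ℝ) → ℝ)),
      (∀ i, MemDC M V (g i)) ∧ X ∩ V = {x ∈ V | ∀ i, g i x = 0}

/-- `f : X∖Z → ℝ` belongs to `Q_M(X,Z)`: it is a quotient `g/h` of restrictions to `X` of
functions of class `Q_M` on a neighbourhood of `X`, where `h` vanishes nowhere on `X∖Z`. -/
def MemQXZ (M : ℕ → ℝ) {n : ℕ} (X Z : Set (Fin n → ℝ)) (f : (Fin n → ℝ) → ℝ) : Prop :=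
  ∃ (V : Set (Fin n → ℝ)) (g h : (Fin n → ℝ) → ℝ), IsOpen V ∧ X ⊆ V ∧
    MemDC M V g ∧ MemDC M V h ∧ (∀ x ∈ X \ Z, h x ≠ 0) ∧
    ∀ x ∈ X \ Z, f x = g x / h x

/-- `b` is a `Q_M`-smooth point of `X ⊆ ℝ^n`: near `b`, `X` is the graph of a
`Q_M`-map over some subset `I` of the coordinates. -/
def QMSmoothPt (M : ℕ → ℝ) {n : ℕ} (X : Set (Fin n → ℝ)) (b : Fin n → ℝ) : Prop :=
  ∃ W : Set (Fin n → ℝ), IsOpen W ∧ b ∈ W ∧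
    ∃ (I : Finset (Fin n)) (Ω : Set ({ i : Fin n // i ∈ I } → ℝ))
      (ψ : ({ i : Fin n // i ∈ I } → ℝ) → ({ i : Fin n // i ∉ I } → ℝ)),
      IsOpen Ω ∧ (∀ j : { i : Fin n // i ∉ I }, MemDC M Ω (fun u => ψ u j)) ∧
      X ∩ W = {y ∈ W | (fun i : { i : Fin n // i ∈ I } => y i) ∈ Ω ∧
        ∀ j : { i : Fin n // i ∉ I }, y j = ψ (fun i : { i : Fin n // i ∈ I } => y i) j}

/-- The formal Taylor expansion `T_a f` of `f` at `a`, as a multivariate formal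
power series. -/
noncomputable def taylorAt {n : ℕ} (f : (Fin n → ℝ) → ℝ) (a : Fin n → ℝ) :
    MvPowerSeries (Fin n) ℝ :=
  fun α : Fin n →₀ ℕ => mpd (fun i => α i) f a / (mfact fun i => α i : ℕ)

/-- `f` is flat at `x`: all iterated partial derivatives (including order `0`) vanish. -/
def FlatAt {n : ℕ} (f : (Fin n → ℝ) → ℝ) (x : Fin n → ℝ) : Prop :=
  ∀ α : Fin n → ℕ, mpd α f x = 0

end QDC

namespace QDCP
open Filter Topology Set
open scoped ContDiff Nat

/-- Normalized weight sequences. -/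
structure Wt (M : ℕ → ℝ) : Prop where
  z : M 0 = 1
  o : M 1 = 1
  pos : ∀ k, 0 < M k
  lc : ∀ k, M (k + 1) / M k ≤ M (k + 2) / M (k + 1)
  der : ∃ C : ℝ, 1 ≤ C ∧ ∀ k, M (k + 1) ≤ C ^ k * M k
  div : ¬ Summable (fun k : ℕ => M k / ((k + 1) * M (k + 1)))

namespace Wt
variable {M : ℕ → ℝ}

lemma ratio_mono (hM : Wt M) : Monotone (fun k => M (k + 1) / M k) := monotone_nat_of_le_succ hM.lc

lemma succ_mul_succ (hM : Wt M) (j n : ℕ) : M (j + 1) * M (n + 1) ≤ M (n + j + 1) := by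
  induction j with
  | zero => simp [hM.o]
  | succ j ih =>
    have h1 := hM.ratio_mono (show j + 1 ≤ n + j + 1 by omega)
    simp only at h1
    have p1 := hM.pos (j + 1)
    have p2 := hM.pos (n + j + 1)
    have p3 := hM.pos (n + 1)
    have p4 := hM.pos (j + 1 + 1)
    rw [div_le_div_iff₀ p1 p2] at h1
    have e : n + (j + 1) + 1 = n + j + 1 + 1 := by ring
    rw [e]
    have h2 : M (j + 1) * (M (j + 1 + 1) * M (n + 1)) ≤ M (j + 1) * M (n + j + 1 + 1) := by
      calc M (j + 1) * (M (j + 1 + 1) * M (n + 1)) = M (j + 1 + 1) * (M (j + 1) * M (n + 1)) := by ring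
        _ ≤ M (j + 1 + 1) * M (n + j + 1) := by gcongr
        _ ≤ _ := by linarith
    exact le_of_mul_le_mul_left h2 p1

lemma one_le (hM : Wt M) (k : ℕ) : 1 ≤ M k := by
  induction k with
  | zero => simp [hM.z]
  | succ k ih =>
    have h := hM.ratio_mono (Nat.zero_le k)
    simp only [hM.z, zero_add, hM.o, div_one] at h
    rw [le_div_iff₀ (hM.pos k)] at h
    linarith

lemma mono (hM : Wt M) : Monotone M := by
  refine monotone_nat_of_le_succ fun k => ?_
  have h := hM.ratio_mono (Nat.zero_le k)
  simp only [hM.z, zero_add, hM.o, div_one] at h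
  rw [le_div_iff₀ (hM.pos k)] at h
  linarith

lemma comp_le (hM : Wt M) : ∀ (k : ℕ) (j : Fin k → ℕ), (∀ i, 1 ≤ j i) →
    M k * ∏ i, M (j i) ≤ M (∑ i, j i) := by
  intro k
  induction k with
  | zero => intro j _; simp [hM.z]
  | succ k ih =>
    intro j hj
    rw [Fin.prod_univ_succ, Fin.sum_univ_succ]
    have h1 := ih (fun i => j i.succ) (fun i => hj _)
    set n := ∑ i : Fin k, j i.succ with hn
    set P := ∏ i : Fin k, M (j i.succ)
    have hkn : k ≤ n := by
      calc k = ∑ i : Fin k, 1 := by simp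
        _ ≤ n := Finset.sum_le_sum fun i _ => hj _
    obtain ⟨l, hl⟩ : ∃ l, j 0 = l + 1 := ⟨j 0 - 1, by have := hj 0; omega⟩
    rw [hl]
    have h2 := hM.succ_mul_succ l n
    have h3 := hM.ratio_mono hkn
    simp only at h3
    have pk := hM.pos k
    have pk1 := hM.pos (k + 1)
    have pn := hM.pos n
    rw [div_le_div_iff₀ pk pn] at h3
    have pl := hM.pos (l + 1)
    have e : l + 1 + n = n + l + 1 := by ring
    rw [e]
    refine le_trans ?_ h2
    have : M k * (M (k + 1) * (M (l + 1) * P)) ≤ M k * (M (l + 1) * M (n + 1)) := by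
      calc M k * (M (k + 1) * (M (l + 1) * P)) = M (k + 1) * M (l + 1) * (M k * P) := by ring
        _ ≤ M (k + 1) * M (l + 1) * M n := by gcongr
        _ = M (l + 1) * (M (k + 1) * M n) := by ring
        _ ≤ M (l + 1) * (M (n + 1) * M k) := by gcongr
        _ = _ := by ring
    exact le_of_mul_le_mul_left this pk
end Wt

/-! ### Faà di Bruno numbers -/

/-- the scalar Faà di Bruno sum -/
noncomputable def fdb (p q : ℕ → ℝ) (n : ℕ) : ℝ :=
  ∑ c : OrderedFinpartition n, p c.length * ∏ i, q (c.partSize i)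

lemma fdb_le_fdb {p p' q q' : ℕ → ℝ} {n : ℕ} (hp0 : ∀ k, 0 ≤ p k) (hp : ∀ k, p k ≤ p' k)
    (hq0 : ∀ k, 0 ≤ q k) (hq : ∀ k, 1 ≤ k → q k ≤ q' k) : fdb p q n ≤ fdb p' q' n := by
  refine Finset.sum_le_sum fun c _ => ?_
  refine mul_le_mul (hp _) ?_ (Finset.prod_nonneg fun i _ => hq0 _) ((hp0 _).trans (hp _))
  exact Finset.prod_le_prod (fun i _ => hq0 _) fun i _ => hq _ (c.partSize_pos i)

lemma sum_partSize {n : ℕ} (c : OrderedFinpartition n) : ∑ i, c.partSize i = n := by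
  have := Fintype.card_congr c.equivSigma
  simpa using this

lemma fdb_weight {M : ℕ → ℝ} (hM : Wt M) {p q : ℕ → ℝ} (n : ℕ) (hp : ∀ k, 0 ≤ p k)
    (hq : ∀ k, 0 ≤ q k) :
    fdb (fun k => p k * M k) (fun j => q j * M j) n ≤ M n * fdb p q n := by
  unfold fdb
  rw [Finset.mul_sum]
  refine Finset.sum_le_sum fun c _ => ?_
  have h := hM.comp_le c.length c.partSize (fun i => c.partSize_pos i)
  rw [sum_partSize] at h
  rw [Finset.prod_mul_distrib]
  have h2 : 0 ≤ p c.length * ∏ i, q (c.partSize i) :=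
    mul_nonneg (hp _) (Finset.prod_nonneg fun i _ => hq _)
  calc _ = (M c.length * ∏ i, M (c.partSize i)) * (p c.length * ∏ i, q (c.partSize i)) := by ring
    _ ≤ _ := by gcongr

lemma fdb_scale (p q : ℕ → ℝ) (B : ℝ) (n : ℕ) :
    fdb p (fun j => B ^ j * q j) n = B ^ n * fdb p q n := by
  unfold fdb
  rw [Finset.mul_sum]
  refine Finset.sum_congr rfl fun c _ => ?_
  rw [Finset.prod_mul_distrib, Finset.prod_pow_eq_pow_sum, sum_partSize]
  ring

lemma fdb_scale_left (p q : ℕ → ℝ) (A B : ℝ) (n : ℕ) :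
    fdb (fun k => A * (B ^ k * p k)) q n = A * fdb p (fun j => B * q j) n := by
  unfold fdb
  rw [Finset.mul_sum]
  refine Finset.sum_congr rfl fun c _ => ?_
  rw [Finset.prod_mul_distrib]
  simp
  ring

section
variable {E F G : Type*} [NormedAddCommGroup E] [NormedSpace ℝ E]
  [NormedAddCommGroup F] [NormedSpace ℝ F] [NormedAddCommGroup G] [NormedSpace ℝ G]

lemma norm_iteratedFDeriv_comp_le_fdb {f : F → G} {g : E → F} {x : E}
    (hf : ContDiffAt ℝ ∞ f (g x)) (hg : ContDiffAt ℝ ∞ g x) (n : ℕ) :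
    ‖iteratedFDeriv ℝ n (f ∘ g) x‖ ≤
      fdb (fun k => ‖iteratedFDeriv ℝ k f (g x)‖) (fun j => ‖iteratedFDeriv ℝ j g x‖) n := by
  rw [iteratedFDeriv_comp hf hg (by exact_mod_cast le_top)]
  unfold FormalMultilinearSeries.taylorComp fdb
  refine (norm_sum_le _ _).trans (Finset.sum_le_sum fun c _ => ?_)
  exact c.norm_compAlongOrderedFinpartition_le _ _

end

lemma iteratedDeriv_comp_eq_fdb {f g : ℝ → ℝ} {x : ℝ}
    (hf : ContDiffAt ℝ ∞ f (g x)) (hg : ContDiffAt ℝ ∞ g x) (n : ℕ) :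
    iteratedDeriv n (f ∘ g) x =
      fdb (fun k => iteratedDeriv k f (g x)) (fun j => iteratedDeriv j g x) n := by
  rw [iteratedDeriv_vcomp_eq_sum_orderedFinpartition hf hg (by exact_mod_cast le_top)]
  unfold fdb
  refine Finset.sum_congr rfl fun c _ => ?_
  rw [iteratedFDeriv_apply_eq_iteratedDeriv_mul_prod]
  simp [mul_comm]

lemma iteratedDeriv_geom (c : ℝ) (n : ℕ) :
    iteratedDeriv n (fun t : ℝ => (1 - c * t)⁻¹) 0 = c ^ n * n ! := by
  rw [iteratedDeriv_eq_iterate]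
  have h := iter_deriv_inv_linear (𝕜 := ℝ) n (-c) 1
  have e : (fun t : ℝ => (1 - c * t)⁻¹) = fun x => (-c * x + 1)⁻¹ := by
    funext t; congr 1; ring
  rw [e, h]
  simp
  have e3 : (-1 : ℝ) ^ n * (n ! : ℝ) * (-c) ^ n = ((-1) * (-c)) ^ n * (n ! : ℝ) := by
    rw [mul_pow]; ring
  rw [e3]
  simp

lemma contDiffAt_geom (c : ℝ) : ContDiffAt ℝ ∞ (fun t : ℝ => (1 - c * t)⁻¹) 0 := by
  refine ContDiffAt.inv (by fun_prop) (by simp)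

lemma fdb_geom {b : ℝ} (hb : 0 ≤ b) (n : ℕ) :
    fdb (fun k => (k ! : ℝ)) (fun j => b * j !) n ≤ (1 + b) ^ n * n ! := by
  set F : ℝ → ℝ := fun t => (1 - 1 * t)⁻¹
  set G : ℝ → ℝ := fun t => b * (1 - 1 * t)⁻¹ - b
  have hG0 : G 0 = 0 := by simp [G]
  have hGc : ContDiffAt ℝ ∞ G 0 := (contDiffAt_const.mul (contDiffAt_geom 1)).sub contDiffAt_const
  have hF : ContDiffAt ℝ ∞ F (G 0) := by rw [hG0]; exact contDiffAt_geom 1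
  have h1 := iteratedDeriv_comp_eq_fdb hF hGc n
  have hGd : ∀ j, 1 ≤ j → iteratedDeriv j G 0 = b * j ! := by
    intro j hj
    have := iteratedDeriv_geom 1 j
    rw [show G = (fun t => b * (1 - 1 * t)⁻¹) - (fun _ => b) from rfl, iteratedDeriv_sub]
    · rw [iteratedDeriv_const_mul_field, this, iteratedDeriv_const]
      simp
      omega
    · exact (contDiffAt_const.mul (contDiffAt_geom 1)).of_le (by exact_mod_cast le_top)
    · exact contDiffAt_const
  have h2 : fdb (fun k => (k ! : ℝ)) (fun j => b * j !) n = iteratedDeriv n (F ∘ G) 0 := by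
    rw [h1]
    unfold fdb
    refine Finset.sum_congr rfl fun c _ => ?_
    have hFd : ∀ k, iteratedDeriv k F 0 = (k ! : ℝ) := by
      intro k
      have := iteratedDeriv_geom 1 k
      rw [one_pow, one_mul] at this
      exact this
    simp only [hG0, hFd]
    congr 1
    refine Finset.prod_congr rfl fun i _ => ?_
    rw [hGd _ (c.partSize_pos i)]
  rw [h2]
  have e : (F ∘ G) =ᶠ[𝓝 0] fun t => (1 + b)⁻¹ + (b / (1 + b)) * (1 - (1 + b) * t)⁻¹ := by
    have c1 : ∀ᶠ t : ℝ in 𝓝 0, 1 - t ≠ 0 := by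
      have : ContinuousAt (fun t : ℝ => 1 - t) 0 := by fun_prop
      exact this.eventually_ne (by simp)
    have c2 : ∀ᶠ t : ℝ in 𝓝 0, 1 - (1 + b) * t ≠ 0 := by
      have : ContinuousAt (fun t : ℝ => 1 - (1 + b) * t) 0 := by fun_prop
      exact this.eventually_ne (by simp)
    filter_upwards [c1, c2] with t h1 h2
    simp only [Function.comp, F, G, one_mul]
    have e2 : (1 - (b * (1 - t)⁻¹ - b)) = (1 - (1 + b) * t) / (1 - t) := by field_simp; ring
    rw [e2, inv_div]
    have hb1 : 1 + b ≠ 0 := by positivity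
    set D := 1 - (1 + b) * t with hD
    have ht : t = (1 - D) / (1 + b) := by rw [hD]; field_simp; ring
    rw [ht]
    field_simp
    ring
  rw [e.iteratedDeriv_eq]
  rw [show (fun t => (1 + b)⁻¹ + (b / (1 + b)) * (1 - (1 + b) * t)⁻¹) =
    (fun _ : ℝ => (1 + b)⁻¹) + (fun t => (b / (1 + b)) * (1 - (1 + b) * t)⁻¹) from rfl, iteratedDeriv_add]
  · rw [iteratedDeriv_const_mul_field, iteratedDeriv_geom, iteratedDeriv_const]
    rcases Nat.eq_zero_or_pos n with h | h
    · subst h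
      simp
      apply le_of_eq; field_simp
    · rw [if_neg (by omega), zero_add]
      have : b / (1 + b) ≤ 1 := by rw [div_le_one (by linarith)]; linarith
      have h3 : 0 ≤ (1 + b) ^ n * (n ! : ℝ) := by positivity
      nlinarith
  · exact contDiffAt_const
  · exact (contDiffAt_const.mul (contDiffAt_geom _)).of_le (by exact_mod_cast le_top)

end QDCP

namespace QDCP
open Filter Topology Set
open scoped ContDiff Nat

section
variable {E F G : Type*} [NormedAddCommGroup E] [NormedSpace ℝ E]
  [NormedAddCommGroup F] [NormedSpace ℝ F] [NormedAddCommGroup G] [NormedSpace ℝ G]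

/-- `f` is of class `Q_M` near `a`. -/
def QAt (M : ℕ → ℝ) (f : E → F) (a : E) : Prop :=
  ∃ A B : ℝ, 0 < A ∧ 0 < B ∧ ∀ᶠ x in 𝓝 a, ContDiffAt ℝ ∞ f x ∧
    ∀ k : ℕ, ‖iteratedFDeriv ℝ k f x‖ ≤ A * B ^ k * k ! * M k

variable {M : ℕ → ℝ}

lemma QAt.contDiffAt {f : E → F} {a : E} (h : QAt M f a) : ContDiffAt ℝ ∞ f a := by
  obtain ⟨A, B, _, _, h⟩ := h
  exact h.self_of_nhds.1

lemma QAt.continuousAt {f : E → F} {a : E} (h : QAt M f a) : ContinuousAt f a :=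
  h.contDiffAt.continuousAt

lemma QAt.differentiableAt {f : E → F} {a : E} (h : QAt M f a) : DifferentiableAt ℝ f a :=
  h.contDiffAt.differentiableAt (by simp)

lemma QAt.eventually {f : E → F} {a : E} (h : QAt M f a) : ∀ᶠ x in 𝓝 a, QAt M f x := by
  obtain ⟨A, B, hA, hB, h⟩ := h
  filter_upwards [h.eventually_nhds] with x hx
  exact ⟨A, B, hA, hB, hx⟩

lemma QAt.congr {f g : E → F} {a : E} (h : QAt M f a) (e : g =ᶠ[𝓝 a] f) : QAt M g a := by
  obtain ⟨A, B, hA, hB, h⟩ := h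
  refine ⟨A, B, hA, hB, ?_⟩
  filter_upwards [h, e.eventually_nhds] with x hx ex
  have ex' : g =ᶠ[𝓝 x] f := ex
  refine ⟨hx.1.congr_of_eventuallyEq ex', fun k => ?_⟩
  rw [(Filter.EventuallyEq.iteratedFDeriv ℝ ex' k).eq_of_nhds]
  exact hx.2 k


lemma Wt.one_le_fact (hM : Wt M) (k : ℕ) : (1 : ℝ) ≤ k ! * M k := by
  have h1 : (1 : ℝ) ≤ k ! := by exact_mod_cast Nat.one_le_iff_ne_zero.2 (Nat.factorial_ne_zero k)
  nlinarith [hM.one_le k]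

/-- simple criterion -/
lemma QAt.of_bound (hM : Wt M) {f : E → F} {a : E} (hf : ∀ᶠ x in 𝓝 a, ContDiffAt ℝ ∞ f x) (A B : ℝ)
    (hA : 0 < A) (hB : 0 < B)
    (h : ∀ᶠ x in 𝓝 a, ∀ k : ℕ, ‖iteratedFDeriv ℝ k f x‖ ≤ A * B ^ k) : QAt M f a := by
  refine ⟨A, B, hA, hB, ?_⟩
  filter_upwards [hf, h] with x h1 h2
  refine ⟨h1, fun k => (h2 k).trans ?_⟩
  have := hM.one_le_fact k
  have h0 : 0 ≤ A * B ^ k := by positivity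
  nlinarith

protected lemma QAt.const (hM : Wt M) (c : F) (a : E) : QAt M (fun _ : E => c) a := by
  refine QAt.of_bound hM (Eventually.of_forall fun x => contDiffAt_const) (‖c‖ + 1) 1
    (by positivity) one_pos (Eventually.of_forall fun x k => ?_)
  rcases Nat.eq_zero_or_pos k with h | h
  · subst h; simp
  · rw [iteratedFDeriv_const_of_ne (by omega)]
    simp; positivity

lemma QAt.clm (hM : Wt M) (L : E →L[ℝ] F) (a : E) : QAt M L a := by
  have hc : ContinuousAt (fun x : E => ‖L x‖) a := by fun_prop
  refine QAt.of_bound hM (Eventually.of_forall fun x => L.contDiff.contDiffAt) (‖L a‖ + 1 + ‖L‖) 1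
    (by positivity) one_pos ?_
  filter_upwards [hc.eventually_lt_const (show ‖L a‖ < ‖L a‖ + 1 by linarith)] with x hx k
  rw [one_pow, mul_one]
  have h1 := norm_nonneg L
  have h2 := norm_nonneg (L a)
  match k with
  | 0 => simp; linarith
  | 1 =>
    rw [← norm_iteratedFDeriv_fderiv, norm_iteratedFDeriv_zero]
    simp; linarith
  | k + 2 =>
    rw [← norm_iteratedFDeriv_fderiv]
    have : fderiv ℝ (L : E → F) = fun _ => L := by funext x; simp
    rw [this, iteratedFDeriv_const_of_ne (by omega)]
    simp; positivity

protected lemma QAt.id (hM : Wt M) (a : E) : QAt M (fun x : E => x) a := QAt.clm hM (ContinuousLinearMap.id ℝ E) a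

protected lemma QAt.add (hM : Wt M) {f g : E → F} {a : E} (hf : QAt M f a) (hg : QAt M g a) :
    QAt M (fun x => f x + g x) a := by
  obtain ⟨A, B, hA, hB, h⟩ := hf
  obtain ⟨A', B', hA', hB', h'⟩ := hg
  refine ⟨A + A', max B B', by positivity, by positivity, ?_⟩
  filter_upwards [h, h'] with x h1 h2
  refine ⟨h1.1.add h2.1, fun k => ?_⟩
  have := iteratedFDeriv_add_apply (i := k) (h1.1.of_le (by exact_mod_cast le_top))
    (h2.1.of_le (by exact_mod_cast le_top))
  change ‖iteratedFDeriv ℝ k (f + g) x‖ ≤ _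
  rw [this]
  refine (norm_add_le _ _).trans ?_
  have p := hM.pos k
  calc _ ≤ A * B ^ k * k ! * M k + A' * B' ^ k * k ! * M k := add_le_add (h1.2 k) (h2.2 k)
    _ ≤ A * (max B B') ^ k * k ! * M k + A' * (max B B') ^ k * k ! * M k := by
      gcongr
      · exact le_max_left _ _
      · exact le_max_right _ _
    _ = _ := by ring

lemma QAt.clm_comp (hM : Wt M) {f : E → F} {a : E} (L : F →L[ℝ] G) (hf : QAt M f a) :
    QAt M (fun x => L (f x)) a := by
  obtain ⟨A, B, hA, hB, h⟩ := hf
  refine ⟨(‖L‖ + 1) * A, B, by positivity, by positivity, ?_⟩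
  filter_upwards [h] with x h1
  refine ⟨L.contDiff.contDiffAt.comp x h1.1, fun k => ?_⟩
  have := L.norm_iteratedFDeriv_comp_left (f := f) (N := ∞) (n := k) h1.1 (by exact_mod_cast le_top)
  refine this.trans ?_
  have p := hM.pos k
  calc _ ≤ (‖L‖ + 1) * (A * B ^ k * k ! * M k) := by
        refine mul_le_mul (by linarith) (h1.2 k) (norm_nonneg _) (by positivity)
    _ = _ := by ring

protected lemma QAt.comp (hM : Wt M) {f : F → G} {g : E → F} {a : E} (hf : QAt M f (g a)) (hg : QAt M g a) :
    QAt M (fun x => f (g x)) a := by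
  have hgc := hg.continuousAt
  obtain ⟨A, B, hA, hB, h⟩ := hf
  obtain ⟨A', B', hA', hB', h'⟩ := hg
  refine ⟨A, B' * (1 + B * A'), hA, by positivity, ?_⟩
  filter_upwards [hgc.eventually h, h'] with x h1 h2
  refine ⟨h1.1.comp x h2.1, fun n => ?_⟩
  have key := norm_iteratedFDeriv_comp_le_fdb h1.1 h2.1 n
  refine key.trans ?_
  have p := hM.pos n
  calc _ ≤ fdb (fun k => A * (B ^ k * k !) * M k) (fun j => B' ^ j * (A' * j !) * M j) n := by
        refine fdb_le_fdb (fun k => norm_nonneg _) (fun k => ?_) (fun k => norm_nonneg _) fun k _ => ?_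
        · refine (h1.2 k).trans (le_of_eq (by ring))
        · refine (h2.2 k).trans (le_of_eq (by ring))
    _ ≤ M n * fdb (fun k => A * (B ^ k * k !)) (fun j => B' ^ j * (A' * j !)) n :=
        fdb_weight hM n (fun k => by positivity) (fun k => by positivity)
    _ = M n * (B' ^ n * (A * fdb (fun k => (k ! : ℝ)) (fun j => (B * A') * j !) n)) := by
        rw [fdb_scale, fdb_scale_left]
        simp only [mul_assoc]
    _ ≤ M n * (B' ^ n * (A * ((1 + B * A') ^ n * n !))) := by
        have := fdb_geom (b := B * A') (by positivity) n
        gcongr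
    _ = _ := by rw [mul_pow]; ring

lemma QAt.prodMk (hM : Wt M) {f : E → F} {g : E → G} {a : E} (hf : QAt M f a) (hg : QAt M g a) :
    QAt M (fun x => (f x, g x)) a := by
  have := (hf.clm_comp hM (ContinuousLinearMap.inl ℝ F G)).add hM
    (hg.clm_comp hM (ContinuousLinearMap.inr ℝ F G))
  simpa using this

lemma QAt.finset_sum (hM : Wt M) {ι : Type*} (s : Finset ι) {f : ι → E → F} {a : E}
    (hf : ∀ i ∈ s, QAt M (f i) a) : QAt M (fun x => ∑ i ∈ s, f i x) a := by
  classical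
  induction s using Finset.induction_on with
  | empty => simpa using QAt.const hM (0 : F) a
  | insert i s hi ih =>
    simp only [Finset.sum_insert hi]
    exact (hf i (by simp)).add hM (ih fun j hj => hf j (by simp [hj]))

protected lemma QAt.pi (hM : Wt M) {ι : Type*} [Fintype ι] [DecidableEq ι] {f : E → ι → ℝ} {a : E}
    (hf : ∀ i, QAt M (fun x => f x i) a) : QAt M f a := by
  have := QAt.finset_sum hM Finset.univ (f := fun i x => (Pi.single i (f x i) : ι → ℝ)) (a := a)
    (fun i _ => (hf i).clm_comp hM (ContinuousLinearMap.single ℝ (fun _ : ι => ℝ) i))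
  refine this.congr (Eventually.of_forall fun x => ?_)
  simp [Finset.univ_sum_single]

protected lemma QAt.apply (hM : Wt M) {ι : Type*} [Fintype ι] {f : E → ι → ℝ} {a : E}
    (hf : QAt M f a) (i : ι) : QAt M (fun x => f x i) a :=
  hf.clm_comp hM (ContinuousLinearMap.proj i : (ι → ℝ) →L[ℝ] ℝ)

lemma QAt.coord (hM : Wt M) {ι : Type*} [Fintype ι] (i : ι) (a : ι → ℝ) : QAt M (fun x : ι → ℝ => x i) a :=
  (QAt.id hM a).apply hM i

lemma QAt.mul_aux (hM : Wt M) (a : ℝ × ℝ) : QAt M (fun x : ℝ × ℝ => x.1 * x.2) a := by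
  set R := ‖a‖ + 2 with hR
  have hR1 : 1 ≤ R := by have := norm_nonneg a; linarith
  have hc : ContinuousAt (fun x : ℝ × ℝ => ‖x‖) a := by fun_prop
  refine QAt.of_bound hM (Eventually.of_forall fun x => by fun_prop) (R * R) 2
    (by positivity) two_pos ?_
  filter_upwards [hc.eventually_lt_const (show ‖a‖ < R by linarith)] with x hx n
  have hL : ∀ (L : ℝ × ℝ →L[ℝ] ℝ), ‖L‖ ≤ 1 → ∀ k, ‖iteratedFDeriv ℝ k L x‖ ≤ R := by
    intro L hL k
    match k with
    | 0 =>
      rw [norm_iteratedFDeriv_zero]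
      refine (L.le_opNorm x).trans ?_
      nlinarith [norm_nonneg x]
    | 1 =>
      rw [← norm_iteratedFDeriv_fderiv, norm_iteratedFDeriv_zero]
      simp; linarith
    | k + 2 =>
      rw [← norm_iteratedFDeriv_fderiv]
      have : fderiv ℝ (L : ℝ × ℝ → ℝ) = fun _ => L := by funext x; simp
      rw [this, iteratedFDeriv_const_of_ne (by omega)]
      simp; positivity
  have h1 := hL (ContinuousLinearMap.fst ℝ ℝ ℝ) (ContinuousLinearMap.norm_fst_le ℝ ℝ ℝ)
  have h2 := hL (ContinuousLinearMap.snd ℝ ℝ ℝ) (ContinuousLinearMap.norm_snd_le ℝ ℝ ℝ)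
  have := norm_iteratedFDeriv_mul_le (𝕜 := ℝ) (N := ∞) (ContinuousLinearMap.fst ℝ ℝ ℝ).contDiff
    (ContinuousLinearMap.snd ℝ ℝ ℝ).contDiff x (n := n) (by exact_mod_cast le_top)
  refine le_trans this ?_
  calc _ ≤ ∑ i ∈ Finset.range (n + 1), (n.choose i : ℝ) * (R * R) := by
        refine Finset.sum_le_sum fun i _ => ?_
        rw [mul_assoc]
        gcongr
        · exact h1 _
        · exact h2 _
    _ = R * R * 2 ^ n := by
        rw [← Finset.sum_mul, mul_comm]
        congr 1
        exact_mod_cast Nat.sum_range_choose n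

protected lemma QAt.mul (hM : Wt M) {f g : E → ℝ} {a : E} (hf : QAt M f a) (hg : QAt M g a) :
    QAt M (fun x => f x * g x) a :=
  (QAt.mul_aux hM (f a, g a)).comp hM (g := fun x => (f x, g x)) (hf.prodMk hM hg)

lemma QAt.const_mul (hM : Wt M) {f : E → ℝ} {a : E} (c : ℝ) (hf : QAt M f a) :
    QAt M (fun x => c * f x) a := (QAt.const hM c a).mul hM hf

protected lemma QAt.neg (hM : Wt M) {f : E → F} {a : E} (hf : QAt M f a) : QAt M (fun x => - f x) a := by
  simpa using hf.clm_comp hM (-(ContinuousLinearMap.id ℝ F))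

protected lemma QAt.sub (hM : Wt M) {f g : E → F} {a : E} (hf : QAt M f a) (hg : QAt M g a) :
    QAt M (fun x => f x - g x) a := by
  simpa [sub_eq_add_neg] using hf.add hM (hg.neg hM)

protected lemma QAt.pow (hM : Wt M) {f : E → ℝ} {a : E} (hf : QAt M f a) (n : ℕ) : QAt M (fun x => f x ^ n) a := by
  induction n with
  | zero => simpa using QAt.const hM (1 : ℝ) a
  | succ n ih => simpa [pow_succ] using ih.mul hM hf

lemma QAt.finset_prod (hM : Wt M) {ι : Type*} (s : Finset ι) {f : ι → E → ℝ} {a : E}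
    (hf : ∀ i ∈ s, QAt M (f i) a) : QAt M (fun x => ∏ i ∈ s, f i x) a := by
  classical
  induction s using Finset.induction_on with
  | empty => simpa using QAt.const hM (1 : ℝ) a
  | insert i s hi ih =>
    simp only [Finset.prod_insert hi]
    exact (hf i (by simp)).mul hM (ih fun j hj => hf j (by simp [hj]))

protected lemma QAt.fderiv (hM : Wt M) {f : E → F} {a : E} (hf : QAt M f a) : QAt M (fun x => fderiv ℝ f x) a := by
  obtain ⟨A, B, hA, hB, h⟩ := hf
  obtain ⟨C, hC, hder⟩ := hM.der
  refine ⟨A * B, B * 2 * C, by positivity, by positivity, ?_⟩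
  filter_upwards [h] with x h1
  refine ⟨h1.1.fderiv_right (m := ∞) (by simp), fun k => ?_⟩
  rw [norm_iteratedFDeriv_fderiv]
  refine (h1.2 (k + 1)).trans ?_
  have p := hM.pos k
  have p1 := hM.pos (k + 1)
  have hk : ((k + 1 : ℕ) : ℝ) ≤ 2 ^ k := by
    exact_mod_cast Nat.succ_le_of_lt (Nat.lt_two_pow_self (n := k))
  rw [Nat.factorial_succ, Nat.cast_mul]
  calc A * B ^ (k + 1) * (((k + 1 : ℕ) : ℝ) * k !) * M (k + 1)
      ≤ A * B ^ (k + 1) * (2 ^ k * k !) * (C ^ k * M k) := by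
        have := hder k
        gcongr
    _ = _ := by rw [mul_pow, mul_pow]; ring

lemma QAt.fderiv_apply (hM : Wt M) {f : E → F} {a : E} (hf : QAt M f a) (v : E) :
    QAt M (fun x => (_root_.fderiv ℝ f x) v) a :=
  (hf.fderiv hM).clm_comp hM (ContinuousLinearMap.apply ℝ F v)

end
end QDCP

namespace QDCP
open Filter Topology Set
open scoped ContDiff Nat

lemma partSize_lt {n : ℕ} (c : OrderedFinpartition n) (hc : c.length ≠ 1) (i : Fin c.length) :
    c.partSize i < n := by
  have h := sum_partSize c
  have hl : 2 ≤ c.length := by have := i.2; omega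
  obtain ⟨j, hj⟩ : ∃ j : Fin c.length, j ≠ i := by
    have : Nontrivial (Fin c.length) := Fin.nontrivial_iff_two_le.2 hl
    exact exists_ne i
  have h1 : c.partSize i + c.partSize j ≤ ∑ k, c.partSize k := by
    rw [← Finset.sum_pair hj.symm]
    exact Finset.sum_le_sum_of_subset (Finset.subset_univ _)
  have := c.partSize_pos j
  omega

lemma fdb_le_fdb_lt {p p' q q' : ℕ → ℝ} {n : ℕ} (hp0 : ∀ k, 0 ≤ p k) (hp : ∀ k, p k ≤ p' k)
    (h1 : p' 1 = 0)
    (hq0 : ∀ k, 1 ≤ k → k < n → 0 ≤ q k) (hq : ∀ k, 1 ≤ k → k < n → q k ≤ q' k) :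
    fdb p q n ≤ fdb p' q' n := by
  refine Finset.sum_le_sum fun c _ => ?_
  by_cases hc : c.length = 1
  · have : p 1 = 0 := le_antisymm (by rw [← h1]; exact hp 1) (hp0 1)
    simp only [hc, h1, this]; simp
  have hs := fun i => partSize_lt c hc i
  have hs' := fun i => c.partSize_pos i
  refine mul_le_mul (hp _) ?_ (Finset.prod_nonneg fun i _ => hq0 _ (hs' i) (hs i)) ((hp0 _).trans (hp _))
  exact Finset.prod_le_prod (fun i _ => hq0 _ (hs' i) (hs i)) fun i _ => hq _ (hs' i) (hs i)

lemma fdb_congr_left {p p' q : ℕ → ℝ} {n : ℕ} (hn : 1 ≤ n) (h : ∀ k, 1 ≤ k → p k = p' k) :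
    fdb p q n = fdb p' q n := by
  refine Finset.sum_congr rfl fun c _ => ?_
  rw [h]
  by_contra hc
  have h0 : c.length = 0 := by omega
  have := sum_partSize c
  have hemp : IsEmpty (Fin c.length) := by rw [h0]; infer_instance
  simp at this
  omega

lemma analytic_bound {Y : ℝ → ℝ} (hY : AnalyticAt ℝ Y 0) :
    ∃ C D : ℝ, 0 < C ∧ 0 < D ∧ ∀ n, iteratedDeriv n Y 0 ≤ C * D ^ n * n ! := by
  obtain ⟨p, r0, hp⟩ := hY
  obtain ⟨C, r, hC, hr, h⟩ := p.le_mul_pow_of_radius_pos hp.radius_pos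
  refine ⟨C, r, hC, hr, fun n => ?_⟩
  have := hp.factorial_smul (1 : ℝ) n
  rw [iteratedDeriv_eq_iteratedFDeriv, ← this, nsmul_eq_mul]
  have h1 : p n (fun _ => 1) ≤ ‖p n‖ := by
    refine (le_abs_self _).trans ?_
    simpa using (p n).le_opNorm (fun _ => 1)
  have h2 := h1.trans (h n)
  have : (0 : ℝ) ≤ n ! := by positivity
  nlinarith

lemma majorant {κ A B : ℝ} (hκ : 0 < κ) (hA : 0 < A) (hB : 0 < B) :
    ∃ y : ℕ → ℝ, (∀ n, 0 ≤ y n) ∧ (∃ C D : ℝ, 0 < C ∧ 0 < D ∧ ∀ n, y n ≤ C * D ^ n * n !) ∧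
      ∀ n, 1 ≤ n → y n = (if n = 1 then κ else 0) +
        fdb (fun k => if k ≤ 1 then 0 else κ * (A * (B ^ k * k !))) y n := by
  set H : ℝ → ℝ := fun s => A * ((1 - B * s)⁻¹ - 1 - B * s) with hHdef
  set G : ℝ → ℝ := fun s => κ⁻¹ * s - H s with hGdef
  have hHa : AnalyticAt ℝ H 0 := by
    refine AnalyticAt.mul analyticAt_const (((AnalyticAt.inv (by fun_prop) (by simp)).sub analyticAt_const).sub (by fun_prop))
  have hGa : AnalyticAt ℝ G 0 := AnalyticAt.sub (by fun_prop) hHa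
  have hHc : ContDiffAt ℝ ∞ H 0 := hHa.contDiffAt
  have hH0 : H 0 = 0 := by simp [H]
  have hG0 : G 0 = 0 := by simp [G, hH0]
  have hHd : ∀ k, iteratedDeriv k H 0 = if k ≤ 1 then 0 else A * (B ^ k * k !) := by
    intro k
    have e : H = (fun s => A * (1 - B * s)⁻¹) - (fun s => A + (A * B) * s) := by
      funext s; simp [H]; ring
    rw [e, iteratedDeriv_sub]
    rotate_left
    · exact (contDiffAt_const.mul (contDiffAt_geom _)).of_le (by exact_mod_cast le_top)
    · fun_prop
    rw [iteratedDeriv_const_mul_field, iteratedDeriv_geom]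
    match k with
    | 0 => simp
    | 1 => simp [iteratedDeriv_one]
    | k + 2 =>
      rw [if_neg (by omega)]
      have : iteratedDeriv (k + 2) (fun s : ℝ => A + A * B * s) = fun _ => 0 := by
        rw [iteratedDeriv_succ', iteratedDeriv_succ']
        have : deriv (fun s : ℝ => A + A * B * s) = fun _ => A * B := by
          funext s; simp
        rw [this]
        funext s
        simp [iteratedDeriv_const]
      rw [this]; simp
  have hGd : deriv G 0 ≠ 0 := by
    have h1 : deriv H 0 = 0 := by
      have := hHd 1
      rwa [iteratedDeriv_one, if_pos le_rfl] at this
    have : deriv G 0 = κ⁻¹ := by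
      rw [hGdef, show (fun s => κ⁻¹ * s - H s) = (fun s => κ⁻¹ * s) - H from rfl, deriv_sub]
      · rw [h1]; simp
      · fun_prop
      · exact hHa.differentiableAt
    rw [this]; positivity
  set Y := hGa.hasStrictDerivAt.localInverse _ _ _ hGd with hYdef
  have hYa : AnalyticAt ℝ Y 0 := by
    have := hGa.analyticAt_localInverse hGd
    rwa [hG0] at this
  have hY0 : Y 0 = 0 := by
    have : Y (G 0) = 0 := HasStrictFDerivAt.localInverse_apply_image ..
    rwa [hG0] at this
  have hGY : ∀ᶠ t in 𝓝 0, G (Y t) = t := by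
    have : ∀ᶠ t in 𝓝 (G 0), G (Y t) = t := HasStrictDerivAt.eventually_right_inverse ..
    rwa [hG0] at this
  have hY1 : Y =ᶠ[𝓝 0] (fun t => κ * t) + (fun t => κ * (H ∘ Y) t) := by
    filter_upwards [hGY] with t ht
    simp only [G] at ht
    simp only [Pi.add_apply, Function.comp]
    field_simp at ht
    linarith
  have hYc : ContDiffAt ℝ ∞ Y 0 := hYa.contDiffAt
  have hHY : ContDiffAt ℝ ∞ (H ∘ Y) 0 := ContDiffAt.comp 0 (by rw [hY0]; exact hHc) hYc
  have hrec : ∀ n, 1 ≤ n → iteratedDeriv n Y 0 = (if n = 1 then κ else 0) +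
        fdb (fun k => if k ≤ 1 then 0 else κ * (A * (B ^ k * k !))) (fun j => iteratedDeriv j Y 0) n := by
    intro n hn
    rw [hY1.iteratedDeriv_eq, iteratedDeriv_add]
    rotate_left
    · fun_prop
    · exact (contDiffAt_const.mul hHY).of_le (by exact_mod_cast le_top)
    rw [iteratedDeriv_const_mul_field κ (H ∘ Y)]
    rw [iteratedDeriv_comp_eq_fdb (by rw [hY0]; exact hHc) hYc]
    congr 1
    · match n with
      | 1 => simp [iteratedDeriv_one]
      | n + 2 =>
        rw [if_neg (by omega), iteratedDeriv_succ', iteratedDeriv_succ']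
        have : deriv (fun s : ℝ => κ * s) = fun _ => κ := by
          funext s; simp
        rw [this]
        simp [iteratedDeriv_const]
    · unfold fdb
      rw [Finset.mul_sum]
      refine Finset.sum_congr rfl fun c _ => ?_
      simp only [hY0, hHd]
      split_ifs <;> ring
  refine ⟨fun n => iteratedDeriv n Y 0, ?_, analytic_bound hYa, hrec⟩
  intro n
  induction n using Nat.strong_induction_on with
  | _ n ih =>
    rcases Nat.eq_zero_or_pos n with h | h
    · subst h; simp [hY0]
    · simp only
      rw [hrec n h]
      refine add_nonneg (by split_ifs <;> positivity) ?_
      have := fdb_le_fdb_lt (p := fun _ => 0) (p' := fun k => if k ≤ 1 then 0 else κ * (A * (B ^ k * k !)))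
        (q := fun j => iteratedDeriv j Y 0) (q' := fun j => iteratedDeriv j Y 0) (n := n)
        (fun _ => le_rfl) (fun k => by split_ifs <;> positivity) (by simp)
        (fun k _ hk => ih k hk) (fun k _ hk => le_rfl)
      refine le_trans (le_of_eq ?_) this
      simp [fdb]

section
variable {E F : Type*} [NormedAddCommGroup E] [NormedSpace ℝ E]
  [NormedAddCommGroup F] [NormedSpace ℝ F]

lemma deriv_rec {Φ : E → F} {Ψ : F → E} {x : F} (L : E ≃L[ℝ] F) (hΦ : ContDiffAt ℝ ∞ Φ (Ψ x))
    (hΨ : ContDiffAt ℝ ∞ Ψ x) (hL : fderiv ℝ Φ (Ψ x) = L) (hinv : ∀ᶠ y in 𝓝 x, Φ (Ψ y) = y)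
    {κ : ℝ} (hκ : ‖(L.symm : F →L[ℝ] E)‖ ≤ κ) {n : ℕ} (hn : 1 ≤ n) :
    ‖iteratedFDeriv ℝ n Ψ x‖ ≤ (if n = 1 then κ else 0) +
      fdb (fun k => if k ≤ 1 then 0 else κ * ‖iteratedFDeriv ℝ k Φ (Ψ x)‖)
        (fun j => ‖iteratedFDeriv ℝ j Ψ x‖) n := by
  have hκ0 : 0 ≤ κ := (norm_nonneg _).trans hκ
  set h : E → F := Φ - (L : E →L[ℝ] F) with hh
  have hhc : ContDiffAt ℝ ∞ h (Ψ x) := hΦ.sub (L : E →L[ℝ] F).contDiff.contDiffAt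
  have hhd : ∀ k, 1 ≤ k → ‖iteratedFDeriv ℝ k h (Ψ x)‖ =
      if k ≤ 1 then 0 else ‖iteratedFDeriv ℝ k Φ (Ψ x)‖ := by
    intro k hk
    rw [hh, iteratedFDeriv_sub_apply (hΦ.of_le (by exact_mod_cast le_top))
      ((L : E →L[ℝ] F).contDiff.contDiffAt)]
    match k with
    | 1 =>
      rw [if_pos le_rfl]
      rw [← iteratedFDeriv_sub_apply (hΦ.of_le (by exact_mod_cast le_top))
      ((L : E →L[ℝ] F).contDiff.contDiffAt)]
      rw [← norm_iteratedFDeriv_fderiv, norm_iteratedFDeriv_zero]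
      rw [fderiv_sub (hΦ.differentiableAt (by simp)) (L : E →L[ℝ] F).differentiableAt, hL, ContinuousLinearMap.fderiv]
      simp
    | k + 2 =>
      rw [if_neg (by omega)]
      have : iteratedFDeriv ℝ (k + 2) (L : E →L[ℝ] F) (Ψ x) = 0 := by
        rw [← norm_eq_zero, ← norm_iteratedFDeriv_fderiv]
        have : fderiv ℝ ((L : E →L[ℝ] F) : E → F) = fun _ => (L : E →L[ℝ] F) := by
          funext x; exact ContinuousLinearMap.fderiv _
        rw [this, iteratedFDeriv_const_of_ne (by omega)]
        simp
      rw [this, sub_zero]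
  have e : Ψ =ᶠ[𝓝 x] fun y => (L.symm : F →L[ℝ] E) (((_root_.id : F → F) - h ∘ Ψ) y) := by
    filter_upwards [hinv] with y hy
    simp [h, hy]
  have hcomp : ContDiffAt ℝ ∞ (h ∘ Ψ) x := hhc.comp x hΨ
  have h1 : ‖iteratedFDeriv ℝ n Ψ x‖ ≤ κ * ‖iteratedFDeriv ℝ n ((_root_.id : F → F) - h ∘ Ψ) x‖ := by
    rw [(Filter.EventuallyEq.iteratedFDeriv ℝ e n).eq_of_nhds]
    refine ((L.symm : F →L[ℝ] E).norm_iteratedFDeriv_comp_left (N := ∞) (n := n)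
      (contDiffAt_id.sub hcomp) (by exact_mod_cast le_top)).trans ?_
    exact mul_le_mul_of_nonneg_right hκ (norm_nonneg _)
  refine h1.trans ?_
  rw [iteratedFDeriv_sub_apply contDiffAt_id (hcomp.of_le (by exact_mod_cast le_top))]
  have h2 : κ * ‖iteratedFDeriv ℝ n (_root_.id : F → F) x‖ ≤ if n = 1 then κ else 0 := by
    match n with
    | 1 =>
      rw [if_pos rfl, ← norm_iteratedFDeriv_fderiv, norm_iteratedFDeriv_zero, fderiv_id]
      have := ContinuousLinearMap.norm_id_le (𝕜 := ℝ) (E := F)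
      nlinarith
    | n + 2 =>
      rw [if_neg (by omega), ← norm_iteratedFDeriv_fderiv]
      have : fderiv ℝ (_root_.id : F → F) = fun _ => ContinuousLinearMap.id ℝ F := by funext x; simp
      rw [this, iteratedFDeriv_const_of_ne (by omega)]
      simp
  have h3 : κ * ‖iteratedFDeriv ℝ n (h ∘ Ψ) x‖ ≤
      fdb (fun k => if k ≤ 1 then 0 else κ * ‖iteratedFDeriv ℝ k Φ (Ψ x)‖)
        (fun j => ‖iteratedFDeriv ℝ j Ψ x‖) n := by
    have := norm_iteratedFDeriv_comp_le_fdb hhc hΨ n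
    calc _ ≤ κ * fdb (fun k => ‖iteratedFDeriv ℝ k h (Ψ x)‖) (fun j => ‖iteratedFDeriv ℝ j Ψ x‖) n := by gcongr
      _ = fdb (fun k => κ * ‖iteratedFDeriv ℝ k h (Ψ x)‖) (fun j => ‖iteratedFDeriv ℝ j Ψ x‖) n := by
        unfold fdb; rw [Finset.mul_sum]; simp only [mul_assoc]
      _ = _ := by
        refine fdb_congr_left hn fun k hk => ?_
        rw [hhd k hk]
        split_ifs <;> simp
  calc _ ≤ κ * (‖iteratedFDeriv ℝ n (_root_.id : F → F) x‖ + ‖iteratedFDeriv ℝ n (h ∘ Ψ) x‖) := by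
        gcongr; exact norm_sub_le _ _
    _ ≤ _ := by rw [mul_add]; exact add_le_add h2 h3

variable {M : ℕ → ℝ}

theorem QAt.inverse (hM : Wt M) [CompleteSpace E] {Φ : E → F} {c : E} (hΦ : QAt M Φ c) (L : E ≃L[ℝ] F)
    (hL : fderiv ℝ Φ c = L) :
    ∃ Ψ : F → E, QAt M Ψ (Φ c) ∧ Ψ (Φ c) = c ∧ (∀ᶠ y in 𝓝 (Φ c), Φ (Ψ y) = y) ∧
      ∀ᶠ x in 𝓝 c, Ψ (Φ x) = x := by
  have hst : HasStrictFDerivAt Φ (L : E →L[ℝ] F) c := by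
    have := hΦ.contDiffAt.hasStrictFDerivAt (by simp)
    rwa [hL] at this
  set e := hst.toOpenPartialHomeomorph Φ with he
  have hec : (e : E → F) = Φ := hst.toOpenPartialHomeomorph_coe
  have hsrc : c ∈ e.source := hst.mem_toOpenPartialHomeomorph_source
  have htgt : Φ c ∈ e.target := hst.image_mem_toOpenPartialHomeomorph_target
  have hΨ0 : e.symm (Φ c) = c := by rw [← hec]; exact e.left_inv hsrc
  have hr : ∀ᶠ y in 𝓝 (Φ c), Φ (e.symm y) = y := by
    filter_upwards [e.open_target.mem_nhds htgt] with y hy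
    rw [← hec]; exact e.right_inv hy
  have hl : ∀ᶠ x in 𝓝 c, e.symm (Φ x) = x := by
    filter_upwards [e.open_source.mem_nhds hsrc] with y hy
    rw [← hec]; exact e.left_inv hy
  refine ⟨e.symm, ?_, hΨ0, hr, hl⟩
  have hΨc : ContinuousAt e.symm (Φ c) := e.continuousAt_symm htgt
  have hDc : ContinuousAt (fun z => fderiv ℝ Φ z) c :=
    (hΦ.contDiffAt.fderiv_right (m := 0) (by simp)).continuousAt
  set κ := ‖(L.symm : F →L[ℝ] E)‖ + 1 with hκ
  have hev1 : ∀ᶠ z in 𝓝 c, fderiv ℝ Φ z ∈ range ((↑) : (E ≃L[ℝ] F) → E →L[ℝ] F) := by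
    refine hDc.eventually ?_
    beta_reduce
    rw [hL]
    exact L.nhds
  have hev2 : ∀ᶠ z in 𝓝 c, ‖(fderiv ℝ Φ z).inverse‖ < κ := by
    have h1 : ContinuousAt (ContinuousLinearMap.inverse : (E →L[ℝ] F) → (F →L[ℝ] E)) (fderiv ℝ Φ c) := by
      rw [hL]; exact (contDiffAt_map_inverse (n := 0) L).continuousAt
    have h2 : ContinuousAt (fun z => ‖(fderiv ℝ Φ z).inverse‖) c :=
      (ContinuousAt.comp (f := fun z => fderiv ℝ Φ z) h1 hDc).norm
    refine h2.eventually_lt_const ?_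
    beta_reduce
    rw [hL, ContinuousLinearMap.inverse_equiv]
    linarith
  obtain ⟨A, B, hA, hB, hbd⟩ := hΦ
  obtain ⟨y, hy0, ⟨C, D, hC, hD, hyb⟩, hyr⟩ := majorant (κ := κ) (by positivity) hA hB
  refine ⟨C + ‖c‖ + 1, D, by positivity, hD, ?_⟩
  have hΨt : Tendsto e.symm (𝓝 (Φ c)) (𝓝 c) := by
    have := hΨc.tendsto; rwa [hΨ0] at this
  have hnb : ∀ᶠ x in 𝓝 (Φ c), ‖e.symm x‖ < ‖c‖ + 1 := by
    have : ContinuousAt (fun x => ‖e.symm x‖) (Φ c) := hΨc.norm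
    refine this.eventually_lt_const ?_
    beta_reduce
    rw [hΨ0]; linarith
  filter_upwards [hΨt.eventually hev1, hΨt.eventually hev2, hΨt.eventually hbd,
    e.open_target.mem_nhds htgt, hr.eventually_nhds, hnb] with x ⟨L', hL'⟩ hn ⟨hc1, hb⟩ hxt hrx hxn
  have hsm : ContDiffAt ℝ ∞ e.symm x := by
    refine e.contDiffAt_symm (f₀' := L') hxt ?_ ?_
    · rw [hec, hL']; exact (hc1.differentiableAt (by simp)).hasFDerivAt
    · rw [hec]; exact hc1
  refine ⟨hsm, ?_⟩
  have hnL : ‖(L'.symm : F →L[ℝ] E)‖ ≤ κ := by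
    rw [← hL', ContinuousLinearMap.inverse_equiv] at hn; exact hn.le
  have key : ∀ n, 1 ≤ n → ‖iteratedFDeriv ℝ n e.symm x‖ ≤ y n * M n := by
    intro n
    induction n using Nat.strong_induction_on with
    | _ n ih =>
      intro hn1
      refine (deriv_rec L' hc1 hsm hL'.symm hrx hnL hn1).trans ?_
      rw [hyr n hn1, add_mul]
      refine add_le_add ?_ ?_
      · have := hM.one_le n
        have hκ0 : 0 ≤ κ := by positivity
        split_ifs
        · nlinarith
        · simp
      · calc _ ≤ fdb (fun k => (if k ≤ 1 then 0 else κ * (A * (B ^ k * k !))) * M k) (fun j => y j * M j) n := by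
              refine fdb_le_fdb_lt (fun k => ?_) (fun k => ?_) (by simp) (fun k _ _ => norm_nonneg _)
                (fun k h1 h2 => ih k h2 h1)
              · split_ifs <;> positivity
              · split_ifs
                · simp
                · rw [mul_assoc]
                  gcongr
                  refine (hb k).trans (le_of_eq (by ring))
          _ ≤ M n * _ := by
              refine fdb_weight hM n (fun k => ?_) hy0
              split_ifs <;> positivity
          _ = _ := by ring
  intro n
  have hMp := hM.pos n
  rcases Nat.eq_zero_or_pos n with h | h
  · subst h
    simp [hM.z]
    linarith
  · refine (key n h).trans ?_
    have := hyb n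
    calc y n * M n ≤ C * D ^ n * n ! * M n := by gcongr
      _ ≤ _ := by
        gcongr
        have := norm_nonneg c
        linarith

end
end QDCP

namespace QDCP
open Filter Topology Set
open scoped ContDiff Nat

/-- chain of derivatives: Taylor estimate -/
lemma chain_taylor {T : ℝ} (k : ℕ) : ∀ (g : ℕ → ℝ → ℝ)
    (_ : ∀ k, ∀ t ∈ Icc 0 T, HasDerivAt (g k) (g (k + 1) t) t) (C : ℝ)
    (_ : ∀ t ∈ Icc 0 T, |g k t| ≤ C), ∀ t ∈ Icc 0 T,
    |g 0 t - ∑ j ∈ Finset.range k, g j 0 * (t ^ j / j !)| ≤ C * (t ^ k / k !) := by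
  induction k with
  | zero => intro g hg C hC t ht; simpa using hC t ht
  | succ k ih =>
    intro g hg C hC
    have h1 := ih (fun j => g (j + 1)) (fun j => hg (j + 1)) C hC
    have hpow : ∀ (j : ℕ) (t : ℝ), HasDerivAt (fun t : ℝ => t ^ (j + 1) / ((j + 1)! : ℝ)) (t ^ j / j !) t := by
      intro j t
      have := (hasDerivAt_pow (j + 1) t).div_const ((j + 1)! : ℝ)
      refine this.congr_deriv ?_
      rw [Nat.factorial_succ]
      push_cast
      have : (j ! : ℝ) ≠ 0 := by positivity
      field_simp
    have hF : ∀ t ∈ Icc 0 T, HasDerivAt (fun t => g 0 t - ∑ j ∈ Finset.range (k + 1), g j 0 * (t ^ j / j !))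
        (g 1 t - ∑ j ∈ Finset.range k, g (j + 1) 0 * (t ^ j / j !)) t := by
      intro t ht
      refine (hg 0 t ht).sub ?_
      have : (fun t : ℝ => ∑ j ∈ Finset.range (k + 1), g j 0 * (t ^ j / j !)) =
        fun t => (∑ j ∈ Finset.range k, g (j + 1) 0 * (t ^ (j + 1) / ((j + 1)! : ℝ))) + g 0 0 := by
        funext t; rw [Finset.sum_range_succ']; simp
      rw [this]
      refine HasDerivAt.add_const _ ?_
      refine HasDerivAt.fun_sum fun j _ => ?_
      exact (hpow j t).const_mul _
    have := image_norm_le_of_norm_deriv_right_le_deriv_boundary (a := 0) (b := T)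
      (fun t ht => (hF t ht).continuousAt.continuousWithinAt)
      (fun t ht => (hF t ⟨ht.1, ht.2.le⟩).hasDerivWithinAt)
      (B := fun t => C * (t ^ (k + 1) / ((k + 1)! : ℝ))) (B' := fun t => C * (t ^ k / k !))
      (by
        rw [Finset.sum_range_succ']; simp)
      (fun t => (hpow k t).const_mul C)
      (fun t ht => h1 t ⟨ht.1, ht.2.le⟩)
    intro t ht
    exact this ht

lemma chain_flat {T : ℝ} (hT : 0 < T) (g : ℕ → ℝ → ℝ)
    (hg : ∀ k, ∀ t ∈ Icc 0 T, HasDerivAt (g k) (g (k + 1) t) t)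
    (hO : ∀ k : ℕ, (g 0) =O[𝓝[>] 0] fun t => t ^ k) : ∀ k, g k 0 = 0 := by
  intro k
  induction k using Nat.strong_induction_on with
  | _ k ih =>
    have hc : ContinuousOn (g (k + 1)) (Icc 0 T) := fun t ht => (hg _ t ht).continuousAt.continuousWithinAt
    obtain ⟨C, hC⟩ := isCompact_Icc.exists_bound_of_continuousOn hc
    have h1 := chain_taylor (k + 1) g hg C hC
    obtain ⟨D, hD⟩ := (hO (k + 1)).bound
    have hev : ∀ᶠ t in 𝓝[>] (0 : ℝ), |g k 0| ≤ (k ! : ℝ) * (|C| + D) * t := by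
      filter_upwards [hD, Ioo_mem_nhdsGT hT] with t ht1 ht2
      have ht0 : 0 < t := ht2.1
      have h2 := h1 t ⟨ht0.le, ht2.2.le⟩
      have h3 : ∑ j ∈ Finset.range (k + 1), g j 0 * (t ^ j / j !) = g k 0 * (t ^ k / k !) := by
        rw [Finset.sum_range_succ, Finset.sum_eq_zero, zero_add]
        intro j hj
        rw [ih j (Finset.mem_range.1 hj), zero_mul]
      rw [h3] at h2
      have h4 : C * (t ^ (k + 1) / ((k + 1)! : ℝ)) ≤ |C| * t ^ (k + 1) := by
        have h5 : t ^ (k + 1) / ((k + 1)! : ℝ) ≤ t ^ (k + 1) := by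
          refine div_le_self (by positivity) ?_
          exact_mod_cast Nat.one_le_iff_ne_zero.2 (Nat.factorial_ne_zero _)
        have h6 : 0 ≤ t ^ (k + 1) / ((k + 1)! : ℝ) := by positivity
        calc _ ≤ |C| * (t ^ (k + 1) / ((k + 1)! : ℝ)) := by gcongr; exact le_abs_self C
          _ ≤ _ := by gcongr
      rw [Real.norm_eq_abs, Real.norm_eq_abs, abs_of_pos (by positivity : 0 < t ^ (k + 1))] at ht1
      have h7 : |g k 0 * (t ^ k / k !)| ≤ (|C| + D) * t ^ (k + 1) := by
        have := abs_sub_abs_le_abs_sub (g k 0 * (t ^ k / k !)) (g 0 t)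
        rw [abs_sub_comm] at this
        linarith
      rw [abs_mul, abs_of_pos (by positivity : 0 < t ^ k / (k ! : ℝ))] at h7
      have h8 : |g k 0| * (t ^ k / (k ! : ℝ)) ≤ ((k ! : ℝ) * (|C| + D) * t) * (t ^ k / (k ! : ℝ)) := by
        refine h7.trans (le_of_eq ?_)
        have : (k ! : ℝ) ≠ 0 := by positivity
        field_simp
        ring
      exact le_of_mul_le_mul_right h8 (by positivity)
    have hlim : Tendsto (fun t : ℝ => (k ! : ℝ) * (|C| + D) * t) (𝓝[>] 0) (𝓝 0) := by
      have : Tendsto (fun t : ℝ => (k ! : ℝ) * (|C| + D) * t) (𝓝 0) (𝓝 ((k ! : ℝ) * (|C| + D) * 0)) := by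
        apply Continuous.tendsto; fun_prop
      rw [mul_zero] at this
      exact this.mono_left nhdsWithin_le_nhds
    have := ge_of_tendsto hlim hev
    exact abs_nonpos_iff.1 this

lemma bang_step {g : ℕ → ℝ → ℝ} {m : ℕ → ℝ} {L : ℝ} (hm : ∀ k, 0 < m k)
    (hg : ∀ k, ∀ t ∈ Icc 0 L, HasDerivAt (g k) (g (k + 1) t) t)
    (hb : ∀ k, ∀ t ∈ Icc 0 L, |g k t| ≤ m k) {N : ℕ} {μ : ℝ} (hμ : 0 < μ)
    (hmμ : ∀ k, k ≤ N → m (k + 1) ≤ μ * m k) {x h : ℝ} (hx : 0 ≤ x) (hh : 0 ≤ h) (hxh : x + h ≤ L)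
    (hh1 : Real.exp 1 * μ * h ≤ 1)
    (hyp : ∀ k : ℕ, |g k x| ≤ Real.exp ((k : ℝ) - (N + 1)) * m k) :
    ∀ k : ℕ, |g k (x + h)| ≤ Real.exp ((k : ℝ) - N) * m k := by
  have hsub : ∀ t ∈ Icc x (x + h), t ∈ Icc 0 L := fun t ht => ⟨hx.trans ht.1, ht.2.trans hxh⟩
  have claim : ∀ i k : ℕ, k + i = N + 1 → ∀ t ∈ Icc x (x + h),
      |g k t| ≤ Real.exp ((k : ℝ) - (N + 1)) * m k * Real.exp (Real.exp 1 * μ * (t - x)) := by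
    intro i
    induction i with
    | zero =>
      intro k hk t ht
      refine (hb k t (hsub t ht)).trans ?_
      have : (k : ℝ) - (N + 1) = 0 := by
        have : (k : ℝ) = N + 1 := by exact_mod_cast hk
        linarith
      rw [this, Real.exp_zero, one_mul]
      have h1 : 1 ≤ Real.exp (Real.exp 1 * μ * (t - x)) := by
        refine Real.one_le_exp ?_
        have := ht.1
        have : 0 ≤ t - x := by linarith
        positivity
      have := hm k
      nlinarith
    | succ i ih =>
      intro k hk
      have h1 := ih (k + 1) (by omega)
      have hB : ∀ t, HasDerivAt (fun t => Real.exp ((k : ℝ) - (N + 1)) * m k * Real.exp (Real.exp 1 * μ * (t - x)))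
          (Real.exp ((k : ℝ) - (N + 1)) * m k * (Real.exp (Real.exp 1 * μ * (t - x)) * (Real.exp 1 * μ))) t := by
        intro t
        refine HasDerivAt.const_mul _ ?_
        refine HasDerivAt.exp ?_
        simpa using ((hasDerivAt_id t).sub_const x).const_mul (Real.exp 1 * μ)
      have := image_norm_le_of_norm_deriv_right_le_deriv_boundary (a := x) (b := x + h)
        (fun t ht => (hg k t (hsub t ht)).continuousAt.continuousWithinAt)
        (fun t ht => (hg k t (hsub t ⟨ht.1, ht.2.le⟩)).hasDerivWithinAt)
        (B := fun t => Real.exp ((k : ℝ) - (N + 1)) * m k * Real.exp (Real.exp 1 * μ * (t - x)))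
        (by simpa using hyp k) hB
        (fun t ht => by
          refine (h1 t ⟨ht.1, ht.2.le⟩).trans ?_
          have h2 := hmμ k (by omega)
          have e : Real.exp (((k + 1 : ℕ) : ℝ) - (N + 1)) = Real.exp ((k : ℝ) - (N + 1)) * Real.exp 1 := by
            rw [← Real.exp_add]; congr 1; push_cast; ring
          rw [e]
          calc Real.exp ((k : ℝ) - (N + 1)) * Real.exp 1 * m (k + 1) * Real.exp (Real.exp 1 * μ * (t - x))
              ≤ Real.exp ((k : ℝ) - (N + 1)) * Real.exp 1 * (μ * m k) * Real.exp (Real.exp 1 * μ * (t - x)) := by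
                gcongr
            _ = _ := by ring)
      intro t ht
      exact this ht
  intro k
  by_cases hk : k ≤ N + 1
  · refine (claim (N + 1 - k) k (by omega) (x + h) ⟨by linarith, le_rfl⟩).trans ?_
    have e : Real.exp ((k : ℝ) - N) = Real.exp ((k : ℝ) - (N + 1)) * Real.exp 1 := by
      rw [← Real.exp_add]; congr 1; ring
    rw [e, mul_right_comm]
    have := hm k
    gcongr
    simpa using hh1
  · refine (hb k _ ⟨by linarith, hxh⟩).trans ?_
    have : 1 ≤ Real.exp ((k : ℝ) - N) := by
      refine Real.one_le_exp ?_
      have : (N : ℝ) ≤ k := by exact_mod_cast (by omega)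
      linarith
    have := hm k
    nlinarith

lemma bang {g : ℕ → ℝ → ℝ} {m : ℕ → ℝ} {L : ℝ} (hm : ∀ k, 0 < m k)
    (hmm : Monotone fun k => m (k + 1) / m k) (hms : ¬ Summable fun k => m k / m (k + 1))
    (hg : ∀ k, ∀ t ∈ Icc 0 L, HasDerivAt (g k) (g (k + 1) t) t)
    (hb : ∀ k, ∀ t ∈ Icc 0 L, |g k t| ≤ m k) (h0 : ∀ k, g k 0 = 0) :
    ∀ t ∈ Icc 0 L, g 0 t = 0 := by
  set s : ℕ → ℝ := fun k => (Real.exp 1)⁻¹ * (m k / m (k + 1)) with hs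
  have hs0 : ∀ k, 0 < s k := fun k => by have := hm k; have := hm (k + 1); positivity
  have claim : ∀ i n : ℕ, ∀ t ∈ Icc 0 L, t ≤ ∑ j ∈ Finset.range i, s (n + j) →
      ∀ k : ℕ, |g k t| ≤ Real.exp ((k : ℝ) - n) * m k := by
    intro i
    induction i with
    | zero =>
      intro n t ht h k
      simp at h
      have : t = 0 := le_antisymm h ht.1
      rw [this, h0]
      have := hm k
      simp; positivity
    | succ i ih =>
      intro n t ht h
      rw [Finset.sum_range_succ'] at h
      set S := ∑ j ∈ Finset.range i, s (n + 1 + j) with hS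
      have hS' : ∑ k ∈ Finset.range i, s (n + (k + 1)) = S := by
        refine Finset.sum_congr rfl fun j _ => ?_
        congr 1; ring
      rw [hS', add_zero] at h
      have hS0 : 0 ≤ S := Finset.sum_nonneg fun j _ => (hs0 _).le
      set x := min t S with hx
      have hx0 : 0 ≤ x := le_min ht.1 hS0
      have hxt : x ≤ t := min_le_left _ _
      have h1 := ih (n + 1) x ⟨hx0, hxt.trans ht.2⟩ (min_le_right _ _)
      have hmn := hm n
      have hmn1 := hm (n + 1)
      have := bang_step hm hg hb (N := n) (μ := m (n + 1) / m n) (by positivity) (fun k hk => by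
        have := hmm hk
        simp only at this
        have p := hm k
        rw [div_le_iff₀ p] at this
        exact this) (x := x) (h := t - x) hx0 (by linarith) (by linarith [ht.2])
        (by
          have hle : t - x ≤ s n := by
            rcases le_total t S with h2 | h2
            · rw [hx, min_eq_left h2]; simpa using (hs0 n).le
            · rw [hx, min_eq_right h2]; linarith
          calc Real.exp 1 * (m (n + 1) / m n) * (t - x) ≤ Real.exp 1 * (m (n + 1) / m n) * s n := by gcongr
            _ = 1 := by simp only [s]; field_simp) (by simpa using h1)
      simpa using this
  intro t ht
  have hns : ¬ Summable s := by
    intro h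
    apply hms
    have := h.mul_left (Real.exp 1)
    refine this.congr fun k => ?_
    simp only [s]; field_simp
  have key : ∀ n : ℕ, |g 0 t| ≤ Real.exp (-(n : ℝ)) * m 0 := by
    intro n
    have hns' : ¬ Summable fun j => s (n + j) := by
      intro h
      apply hns
      rw [← summable_nat_add_iff n]
      refine h.congr fun j => by rw [add_comm]
    have ht1 := (not_summable_iff_tendsto_nat_atTop_of_nonneg (fun j => (hs0 (n + j)).le)).1 hns'
    obtain ⟨i, hi⟩ := (ht1.eventually_ge_atTop t).exists
    simpa using claim i n t ht hi 0
  have hlim : Tendsto (fun n : ℕ => Real.exp (-(n : ℝ)) * m 0) atTop (𝓝 (0 * m 0)) := by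
    refine Tendsto.mul_const _ ?_
    exact Real.tendsto_exp_neg_atTop_nhds_zero.comp tendsto_natCast_atTop_atTop
  rw [zero_mul] at hlim
  have := ge_of_tendsto' hlim key
  exact abs_nonpos_iff.1 this

section
variable {E : Type*} [NormedAddCommGroup E] [NormedSpace ℝ E] {M : ℕ → ℝ}

lemma hasDerivAt_line {f : E → ℝ} {p v : E} {t : ℝ} (h : ContDiffAt ℝ ∞ f (p + t • v)) (k : ℕ) :
    HasDerivAt (fun t : ℝ => iteratedFDeriv ℝ k f (p + t • v) (fun _ => v))
      (iteratedFDeriv ℝ (k + 1) f (p + t • v) (fun _ => v)) t := by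
  have h1 : HasFDerivAt (iteratedFDeriv ℝ k f) (fderiv ℝ (iteratedFDeriv ℝ k f) (p + t • v)) (p + t • v) :=
    (h.differentiableAt_iteratedFDeriv (by exact_mod_cast WithTop.coe_lt_top k)).hasFDerivAt
  have h2 : HasDerivAt (fun t : ℝ => p + t • v) v t := by
    simpa using ((hasDerivAt_id t).smul_const v).const_add p
  have h3 := h1.comp_hasDerivAt t h2
  have h4 := (ContinuousMultilinearMap.apply ℝ (fun _ : Fin k => E) ℝ (fun _ => v)).hasFDerivAt.comp_hasDerivAt t h3
  exact h4

/-- flat along a direction implies zero along that direction -/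
lemma zero_of_flat_dir (hM : Wt M) {f : E → ℝ} {U : Set E} (hU : Convex ℝ U) {A B : ℝ} (hA : 0 < A) (hB : 0 < B)
    (hf : ∀ x ∈ U, ContDiffAt ℝ ∞ f x ∧ ∀ k : ℕ, ‖iteratedFDeriv ℝ k f x‖ ≤ A * B ^ k * k ! * M k)
    {p x : E} (hp : p ∈ U) (hx : x ∈ U) (hflat : ∀ k, iteratedFDeriv ℝ k f p (fun _ => x - p) = 0) :
    f x = 0 := by
  have hseg : ∀ t ∈ Icc (0 : ℝ) 1, p + t • (x - p) ∈ U := by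
    intro t ht
    exact hU.add_smul_sub_mem hp hx ht
  set b := B * (‖x - p‖ + 1) with hb
  have hb0 : 0 < b := by positivity
  have hr : ∀ k : ℕ, A * b ^ (k + 1) * (k + 1)! * M (k + 1) / (A * b ^ k * k ! * M k) =
      b * ((k + 1 : ℝ) * (M (k + 1) / M k)) := by
    intro k
    rw [Nat.factorial_succ]; push_cast
    have := hM.pos k
    have : (k ! : ℝ) ≠ 0 := by positivity
    field_simp
    ring
  have hr' : ∀ k : ℕ, A * b ^ k * k ! * M k / (A * b ^ (k + 1) * (k + 1)! * M (k + 1)) =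
      b⁻¹ * (M k / ((k + 1) * M (k + 1))) := by
    intro k
    rw [Nat.factorial_succ]; push_cast
    have := hM.pos k
    have := hM.pos (k + 1)
    have : (k ! : ℝ) ≠ 0 := by positivity
    field_simp
    ring
  have := bang (g := fun k t => iteratedFDeriv ℝ k f (p + t • (x - p)) (fun _ => x - p))
    (m := fun k => A * b ^ k * k ! * M k) (L := 1) (fun k => by have := hM.pos k; positivity)
    (by
      intro i j hij
      simp only [hr]
      have h1 := hM.ratio_mono hij
      simp only at h1
      have h2 : (i : ℝ) ≤ j := by exact_mod_cast hij
      have := hM.pos i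
      have := hM.pos (i + 1)
      gcongr)
    (by
      simp only [hr']
      rw [summable_mul_left_iff (by positivity)]
      exact hM.div)
    (fun k t ht => hasDerivAt_line (hf _ (hseg t ht)).1 k)
    (fun k t ht => by
      rw [← Real.norm_eq_abs]
      refine (ContinuousMultilinearMap.le_opNorm _ _).trans ?_
      simp only [Finset.prod_const, Finset.card_univ, Fintype.card_fin]
      have h1 := (hf _ (hseg t ht)).2 k
      have := hM.pos k
      have h2 := norm_nonneg (x - p)
      calc _ ≤ (A * B ^ k * k ! * M k) * (‖x - p‖ + 1) ^ k := by
            gcongr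
            linarith
        _ = _ := by rw [hb, mul_pow]; ring)
    (fun k => by simpa using hflat k) 1 (by simp)
  simpa using this

lemma QAt.exists_ball {F : Type*} [NormedAddCommGroup F] [NormedSpace ℝ F] {f : E → F} {a : E} (h : QAt M f a) :
    ∃ A B r : ℝ, 0 < A ∧ 0 < B ∧ 0 < r ∧ ∀ x ∈ Metric.ball a r, ContDiffAt ℝ ∞ f x ∧
    ∀ k : ℕ, ‖iteratedFDeriv ℝ k f x‖ ≤ A * B ^ k * k ! * M k := by
  obtain ⟨A, B, hA, hB, h⟩ := h
  obtain ⟨r, hr, h⟩ := Metric.eventually_nhds_iff_ball.1 h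
  exact ⟨A, B, r, hA, hB, hr, h⟩

/-- quasianalyticity on a small ball -/
lemma QAt.zero_ball (hM : Wt M) {f : E → ℝ} {a : E} (h : QAt M f a) :
    ∃ r > 0, ∀ p ∈ Metric.ball a r, f =ᶠ[𝓝 p] 0 → ∀ x ∈ Metric.ball a r, f x = 0 := by
  obtain ⟨A, B, r, hA, hB, hr, h⟩ := h.exists_ball
  refine ⟨r, hr, fun p hp hfp x hx => ?_⟩
  refine zero_of_flat_dir hM (convex_ball a r) hA hB h hp hx fun k => ?_
  rw [(Filter.EventuallyEq.iteratedFDeriv ℝ hfp k).eq_of_nhds]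
  simp

lemma QAt.exists_dir (hM : Wt M) {f : E → ℝ} {a : E} (h : QAt M f a) (hne : ¬ f =ᶠ[𝓝 a] 0) :
    ∃ (v : E) (k : ℕ), iteratedFDeriv ℝ k f a (fun _ => v) ≠ 0 := by
  by_contra hcon
  push Not at hcon
  obtain ⟨A, B, r, hA, hB, hr, h⟩ := h.exists_ball
  apply hne
  filter_upwards [Metric.ball_mem_nhds a hr] with x hx
  exact zero_of_flat_dir hM (convex_ball a r) hA hB h (Metric.mem_ball_self hr) hx fun k => hcon _ k

lemma QAt.zero_of_flat (hM : Wt M) {f : E → ℝ} {a : E} (h : QAt M f a)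
    (hO : ∀ k : ℕ, f =O[𝓝 a] fun x => ‖x - a‖ ^ k) : f =ᶠ[𝓝 a] 0 := by
  by_contra hne
  obtain ⟨v, k, hk⟩ := h.exists_dir hM hne
  apply hk
  obtain ⟨A, B, r, hA, hB, hr, h⟩ := h.exists_ball
  set T := r / (2 * (‖v‖ + 1)) with hT
  have hT0 : 0 < T := by positivity
  have hmem : ∀ t ∈ Icc 0 T, a + t • v ∈ Metric.ball a r := by
    intro t ht
    rw [Metric.mem_ball, dist_eq_norm, add_sub_cancel_left, norm_smul, Real.norm_eq_abs, abs_of_nonneg ht.1]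
    have h1 := norm_nonneg v
    calc t * ‖v‖ ≤ T * (‖v‖ + 1) := by
          have := ht.1; have := ht.2
          gcongr; linarith
      _ = r / 2 := by rw [hT]; field_simp
      _ < r := by linarith
  have := chain_flat hT0 (fun k t => iteratedFDeriv ℝ k f (a + t • v) (fun _ => v))
    (fun k t ht => hasDerivAt_line (h _ (hmem t ht)).1 k) (fun k => by
      have hc : Tendsto (fun t : ℝ => a + t • v) (𝓝[>] 0) (𝓝 a) := by
        have : Tendsto (fun t : ℝ => a + t • v) (𝓝 0) (𝓝 (a + (0 : ℝ) • v)) := by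
          apply Continuous.tendsto; fun_prop
        rw [zero_smul, add_zero] at this
        exact this.mono_left nhdsWithin_le_nhds
      have h1 := (hO k).comp_tendsto hc
      have e : (fun t : ℝ => iteratedFDeriv ℝ 0 f (a + t • v) (fun _ => v)) = f ∘ fun t : ℝ => a + t • v := by
        funext t; simp
      rw [e]
      refine h1.trans ?_
      refine Asymptotics.IsBigO.of_bound (‖v‖ ^ k) (Eventually.of_forall fun t => ?_)
      simp [norm_smul, mul_pow, mul_comm]) k
  simpa using this

end
end QDCP

namespace QDCP
open Filter Topology Set
open scoped ContDiff Nat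

section integral
variable {M : ℕ → ℝ} {E : Type*} [NormedAddCommGroup E] [NormedSpace ℝ E]

lemma QAt.integral (hM : Wt M) {H : E → ℝ} (h : QAt M H 0) (S : ℝ → E →L[ℝ] E) (hS : Continuous S)
    {c : ℝ} (hc : 1 ≤ c) (hSc : ∀ t ∈ Icc (0:ℝ) 1, ‖S t‖ ≤ c) :
    QAt M (fun x => ∫ t in (0:ℝ)..1, H (S t x)) 0 := by
  obtain ⟨A, B, r, hA, hB, hr, hb⟩ := h.exists_ball
  set V := Metric.ball (0:E) r with hV
  set U := Metric.ball (0:E) (r / c) with hU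
  have hc0 : 0 < c := by linarith
  have hVo : IsOpen V := Metric.isOpen_ball
  have hUo : IsOpen U := Metric.isOpen_ball
  have hSU : ∀ t ∈ Icc (0:ℝ) 1, ∀ x ∈ U, S t x ∈ V := by
    intro t ht x hx
    simp only [hU, hV, Metric.mem_ball, dist_zero_right] at hx ⊢
    calc ‖S t x‖ ≤ ‖S t‖ * ‖x‖ := (S t).le_opNorm x
      _ ≤ c * ‖x‖ := by gcongr; exact hSc t ht
      _ < c * (r / c) := by gcongr
      _ = r := by field_simp
  let q : ℝ → E → FormalMultilinearSeries ℝ E ℝ := fun t x k =>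
    (iteratedFDeriv ℝ k H (S t x)).compContinuousLinearMap (fun _ => S t)
  have hHV : ContDiffOn ℝ ∞ H V := fun x hx => (hb x hx).1.contDiffWithinAt
  have hT : HasFTaylorSeriesUpToOn ∞ H (ftaylorSeries ℝ H) V := by
    have := hHV.ftaylorSeriesWithin hVo.uniqueDiffOn
    refine this.congr_series ?_
    intro k _ x hx
    exact iteratedFDerivWithin_of_isOpen k hVo hx
  have hq : ∀ t ∈ Icc (0:ℝ) 1, HasFTaylorSeriesUpToOn ∞ (H ∘ S t) (q t) U := by
    intro t ht
    exact (hT.compContinuousLinearMap (S t)).mono (fun x hx => hSU t ht x hx)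
  have hqb : ∀ k, ∀ t ∈ Icc (0:ℝ) 1, ∀ x ∈ U, ‖q t x k‖ ≤ A * (B * c) ^ k * k ! * M k := by
    intro k t ht x hx
    have h1 := (iteratedFDeriv ℝ k H (S t x)).norm_compContinuousLinearMap_le (fun _ => S t)
    refine h1.trans ?_
    have h2 := (hb _ (hSU t ht x hx)).2 k
    have h3 : ∏ i : Fin k, ‖S t‖ ≤ c ^ k := by
      simp only [Finset.prod_const, Finset.card_univ, Fintype.card_fin]
      exact pow_le_pow_left₀ (norm_nonneg _) (hSc t ht) k
    calc _ ≤ (A * B ^ k * k ! * M k) * c ^ k := by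
          gcongr
          exact (norm_nonneg _).trans h2
      _ = _ := by rw [mul_pow]; ring
  have hqc : ∀ k, ∀ x ∈ U, ContinuousOn (fun t => q t x k) (Icc 0 1) := by
    intro k x hx
    have h1 : ContinuousOn (fun t => iteratedFDeriv ℝ k H (S t x)) (Icc 0 1) := by
      have h2 : ContinuousOn (iteratedFDeriv ℝ k H) V := hT.cont k (by exact_mod_cast le_top)
      exact h2.comp (hS.clm_apply continuous_const).continuousOn (fun t ht => hSU t ht x hx)
    have h3 : Continuous (fun t => ContinuousMultilinearMap.compContinuousLinearMapContinuousMultilinear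
        ℝ (fun _ : Fin k => E) (fun _ : Fin k => E) ℝ (fun _ => S t)) :=
      (ContinuousMultilinearMap.cont _).comp (continuous_pi fun _ => hS)
    exact h3.continuousOn.clm_apply h1
  have hqi : ∀ k, ∀ x ∈ U, IntervalIntegrable (fun t => q t x k) MeasureTheory.volume 0 1 := by
    intro k x hx
    apply ContinuousOn.intervalIntegrable
    rw [uIcc_of_le zero_le_one]
    exact hqc k x hx
  have hI : Set.uIoc (0:ℝ) 1 ⊆ Icc 0 1 := by
    rw [uIoc_of_le zero_le_one]; exact Ioc_subset_Icc_self
  let p : E → FormalMultilinearSeries ℝ E ℝ := fun x k => ∫ t in (0:ℝ)..1, q t x k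
  have hd : ∀ k, ∀ x ∈ U, HasFDerivAt (fun x => p x k) (p x (k+1)).curryLeft x := by
    intro k x hx
    let e := (continuousMultilinearCurryLeftEquiv ℝ (fun _ : Fin (k+1) => E) ℝ)
    let L : (E [×(k+1)]→L[ℝ] ℝ) →L[ℝ] (E →L[ℝ] E [×k]→L[ℝ] ℝ) := e.toContinuousLinearEquiv
    have key := intervalIntegral.hasFDerivAt_integral_of_dominated_of_fderiv_le (𝕜 := ℝ)
      (μ := MeasureTheory.volume) (a := 0) (b := 1) (s := U) (x₀ := x)
      (F := fun x t => q t x k) (F' := fun x t => e (q t x (k+1)))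
      (bound := fun _ => A * (B * c) ^ (k+1) * (k+1)! * M (k+1)) (hUo.mem_nhds hx)
      ?_ (hqi k x hx) ?_ ?_ intervalIntegrable_const ?_
    · have h5 := ContinuousLinearMap.intervalIntegral_comp_comm (𝕜 := ℝ) (F := E →L[ℝ] E [×k]→L[ℝ] ℝ) L (hqi (k+1) x hx)
      have h6 : HasFDerivAt (fun x => p x k) (∫ t in (0:ℝ)..1, L (q t x (k+1))) x := key
      rw [h5] at h6
      exact h6
    · filter_upwards [hUo.mem_nhds hx] with y hy
      exact (intervalIntegrable_iff.1 (hqi k y hy)).aestronglyMeasurable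
    · exact e.continuous.comp_aestronglyMeasurable (intervalIntegrable_iff.1 (hqi (k+1) x hx)).aestronglyMeasurable
    · refine Eventually.of_forall fun t ht y hy => ?_
      rw [LinearIsometryEquiv.norm_map]
      exact hqb (k+1) t (hI ht) y hy
    · refine Eventually.of_forall fun t ht y hy => ?_
      exact ((hq t (hI ht)).fderivWithin k (by exact_mod_cast WithTop.coe_lt_top _) y hy).hasFDerivAt (hUo.mem_nhds hy)
  have hp : HasFTaylorSeriesUpToOn ∞ (fun x => ∫ t in (0:ℝ)..1, H (S t x)) p U := by
    refine ⟨?_, ?_, ?_⟩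
    · intro x hx
      let e := (continuousMultilinearCurryFin0 ℝ E ℝ)
      let L : (E [×0]→L[ℝ] ℝ) →L[ℝ] ℝ := e.toContinuousLinearEquiv
      have h5 : ∫ t in (0:ℝ)..1, e (q t x 0) = e (∫ t in (0:ℝ)..1, q t x 0) :=
        (ContinuousLinearMap.intervalIntegral_comp_comm L (hqi 0 x hx))
      change e (∫ t in (0:ℝ)..1, q t x 0) = _
      rw [← h5]
      rfl
    · intro k _ x hx
      exact (hd k x hx).hasFDerivWithinAt
    · intro k _ x hx
      exact (hd k x hx).continuousAt.continuousWithinAt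
  have hrc : 0 < r / c := by positivity
  refine ⟨A, B * c, hA, by positivity, ?_⟩
  filter_upwards [Metric.ball_mem_nhds (0:E) hrc] with x hx
  refine ⟨hp.contDiffOn.contDiffAt (hUo.mem_nhds hx), fun k => ?_⟩
  have h6 := hp.eq_iteratedFDerivWithin_of_uniqueDiffOn (m := k) (by exact_mod_cast le_top) hUo.uniqueDiffOn hx
  rw [iteratedFDerivWithin_of_isOpen k hUo hx] at h6
  rw [← h6]
  have := intervalIntegral.norm_integral_le_of_norm_le_const (a := 0) (b := 1) (f := fun t => q t x k)
    (C := A * (B * c) ^ k * k ! * M k) (fun t ht => hqb k t (hI ht) x hx)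
  simpa using this

/-- division by a linear form -/
lemma QAt.div_lin (hM : Wt M) {f : E → ℝ} (h : QAt M f 0) (l : E →L[ℝ] ℝ) (e : E) (he : l e = 1)
    (hz : ∀ᶠ x in 𝓝 (0:E), l x = 0 → f x = 0) :
    ∃ g : E → ℝ, QAt M g 0 ∧ f =ᶠ[𝓝 0] fun x => l x * g x := by
  let S : ℝ → E →L[ℝ] E := fun t => ContinuousLinearMap.id ℝ E + (t - 1) • l.smulRight e
  have hS : Continuous S := by fun_prop
  set c := 1 + ‖l.smulRight e‖
  have hc : 1 ≤ c := by
    have := norm_nonneg (l.smulRight e)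
    simp only [c]; linarith
  have hSc : ∀ t ∈ Icc (0:ℝ) 1, ‖S t‖ ≤ c := by
    intro t ht
    refine (norm_add_le _ _).trans ?_
    apply add_le_add ContinuousLinearMap.norm_id_le
    rw [norm_smul]
    have : ‖t - 1‖ ≤ 1 := by
      rw [Real.norm_eq_abs, abs_le]; constructor <;> linarith [ht.1, ht.2]
    nlinarith [norm_nonneg (l.smulRight e)]
  have hc0 : 0 < c := by linarith
  refine ⟨_, (h.fderiv_apply hM e).integral hM S hS hc hSc, ?_⟩
  obtain ⟨A, B, r, hA, hB, hr, hb⟩ := h.exists_ball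
  obtain ⟨r2, hr2, hz⟩ := Metric.eventually_nhds_iff_ball.1 hz
  have hrc : 0 < min r r2 / c := by positivity
  filter_upwards [Metric.ball_mem_nhds (0:E) hrc] with x hx
  have hSU : ∀ t ∈ Icc (0:ℝ) 1, S t x ∈ Metric.ball (0:E) (min r r2) := by
    intro t ht
    simp only [Metric.mem_ball, dist_zero_right] at hx ⊢
    calc ‖S t x‖ ≤ ‖S t‖ * ‖x‖ := (S t).le_opNorm x
      _ ≤ c * ‖x‖ := by gcongr; exact hSc t ht
      _ < c * (min r r2 / c) := by gcongr
      _ = min r r2 := by field_simp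
  have hSx : ∀ t, S t x = x + (t - 1) • (l x • e) := by intro t; simp [S]
  have hder : ∀ t ∈ uIcc (0:ℝ) 1, HasDerivAt (fun t => f (S t x)) (l x * fderiv ℝ f (S t x) e) t := by
    intro t ht
    rw [uIcc_of_le zero_le_one] at ht
    have h1 : HasDerivAt (fun t => S t x) (l x • e) t := by
      simp only [hSx]
      have := (((hasDerivAt_id t).sub_const 1).smul_const (l x • e)).const_add x
      simpa using this
    have h2 : HasFDerivAt f (fderiv ℝ f (S t x)) (S t x) :=
      ((hb _ (Metric.ball_subset_ball (min_le_left _ _) (hSU t ht))).1.differentiableAt (by simp)).hasFDerivAt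
    have h3 := h2.comp_hasDerivAt t h1
    rw [map_smul] at h3
    exact h3
  have hcont : ContinuousOn (fun t => fderiv ℝ f (S t x) e) (uIcc (0:ℝ) 1) := by
    rw [uIcc_of_le zero_le_one]
    intro t ht
    have h2 : ContinuousAt (fderiv ℝ f) (S t x) :=
      ((hb _ (Metric.ball_subset_ball (min_le_left _ _) (hSU t ht))).1.fderiv_right (m := 0) (by simp)).continuousAt
    have h4 : ContinuousAt (fun t => S t x) t := (hS.clm_apply continuous_const).continuousAt
    have h3 : ContinuousAt (fun t => fderiv ℝ f (S t x)) t := ContinuousAt.comp (f := fun t => S t x) h2 h4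
    exact (h3.clm_apply continuousAt_const).continuousWithinAt
  have h_int := intervalIntegral.integral_eq_sub_of_hasDerivAt hder
    ((continuousOn_const.mul hcont).intervalIntegrable)
  rw [intervalIntegral.integral_const_mul] at h_int
  have h0 : f (S 0 x) = 0 := by
    apply hz _ (Metric.ball_subset_ball (min_le_right _ _) (hSU 0 (by simp)))
    rw [hSx]; simp [he]
  have h1 : S 1 x = x := by rw [hSx]; simp
  rw [h0, h1] at h_int
  rw [h_int]; simp
end integral
end QDCP

namespace QDCP
open Filter Topology Set
open scoped ContDiff Nat

section mono
variable {M : ℕ → ℝ}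

/-- germs of class `Q_M` form a domain -/
lemma QAt.domain {E : Type*} [NormedAddCommGroup E] [NormedSpace ℝ E] (hM : Wt M) {f g : E → ℝ} {a : E}
    (hf : QAt M f a) (hg : QAt M g a) (h : (fun x => f x * g x) =ᶠ[𝓝 a] 0) :
    f =ᶠ[𝓝 a] 0 ∨ g =ᶠ[𝓝 a] 0 := by
  obtain ⟨r, hr, hz⟩ := hg.zero_ball hM
  obtain ⟨r2, hr2, hz2⟩ := Metric.eventually_nhds_iff_ball.1 (h.and hf.eventually)
  by_cases hc : ∃ p ∈ Metric.ball a (min r r2), f p ≠ 0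
  · right
    obtain ⟨p, hp, hfp⟩ := hc
    have hp1 := Metric.ball_subset_ball (min_le_left r r2) hp
    have hp2 := Metric.ball_subset_ball (min_le_right r r2) hp
    have : g =ᶠ[𝓝 p] 0 := by
      filter_upwards [(hz2 p hp2).2.continuousAt.eventually_ne hfp, Metric.isOpen_ball.mem_nhds hp2] with x hx hx2
      have := (hz2 x hx2).1
      simp only [Pi.zero_apply, mul_eq_zero] at this
      exact this.resolve_left hx
    filter_upwards [Metric.ball_mem_nhds a hr] with x hx
    exact hz p hp1 this x hx
  · left
    push Not at hc
    filter_upwards [Metric.ball_mem_nhds a (lt_min hr hr2)] with x hx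
    exact hc x hx

/-- monomials -/
def mon {m : ℕ} (α : Fin m → ℕ) (x : Fin m → ℝ) : ℝ := ∏ i, x i ^ α i

lemma mon_zero {m : ℕ} (x : Fin m → ℝ) : mon 0 x = 1 := by simp [mon]
lemma mon_add {m : ℕ} (α β : Fin m → ℕ) (x : Fin m → ℝ) : mon (α + β) x = mon α x * mon β x := by
  simp [mon, pow_add, Finset.prod_mul_distrib]
lemma mon_smul {m : ℕ} (n : ℕ) (α : Fin m → ℕ) (x : Fin m → ℝ) : mon (n • α) x = mon α x ^ n := by
  simp [mon, ← Finset.prod_pow, ← pow_mul, mul_comm]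
lemma mon_single {m : ℕ} (i : Fin m) (x : Fin m → ℝ) : mon (Pi.single i 1) x = x i := by
  unfold mon
  rw [Finset.prod_eq_single i]
  · simp
  · intro j _ hj; simp [hj]
  · simp

lemma mon_ne {m : ℕ} (α : Fin m → ℕ) (x : Fin m → ℝ) (h : ∀ i, x i ≠ 0) : mon α x ≠ 0 :=
  Finset.prod_ne_zero_iff.2 fun i _ => pow_ne_zero _ (h i)

lemma mon_at_zero {m : ℕ} (α : Fin m → ℕ) (h : α ≠ 0) : mon α 0 = 0 := by
  obtain ⟨i, hi⟩ := Function.ne_iff.1 h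
  exact Finset.prod_eq_zero (Finset.mem_univ i) (by simpa using hi)

lemma QAt.mon (hM : Wt M) {m : ℕ} (α : Fin m → ℕ) (a) : QAt M (mon α) a := by
  unfold QDCP.mon
  exact QAt.finset_prod hM _ (fun i _ => (QAt.coord hM i a).pow hM _)

def MonoExp (M : ℕ → ℝ) {m : ℕ} (g : (Fin m → ℝ) → ℝ) (α : Fin m → ℕ) : Prop :=
  ∃ u : (Fin m → ℝ) → ℝ, QAt M u 0 ∧ u 0 ≠ 0 ∧ g =ᶠ[𝓝 0] fun x => mon α x * u x

variable {m : ℕ} {f g : (Fin m → ℝ) → ℝ} {α β : Fin m → ℕ}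

lemma MonoExp.congr (h : MonoExp M g α) (e : f =ᶠ[𝓝 0] g) : MonoExp M f α := by
  obtain ⟨u, hu, hu0, hg⟩ := h
  exact ⟨u, hu, hu0, e.trans hg⟩

lemma MonoExp.qat (hM : Wt M) (h : MonoExp M g α) : QAt M g 0 := by
  obtain ⟨u, hu, hu0, hg⟩ := h
  exact ((QAt.mon hM α 0).mul hM hu).congr hg

lemma MonoExp.mul (hM : Wt M) (hf : MonoExp M f α) (hg : MonoExp M g β) :
    MonoExp M (fun x => f x * g x) (α + β) := by
  obtain ⟨u, hu, hu0, hf⟩ := hf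
  obtain ⟨v, hv, hv0, hg⟩ := hg
  refine ⟨fun x => u x * v x, hu.mul hM hv, mul_ne_zero hu0 hv0, ?_⟩
  filter_upwards [hf, hg] with x h1 h2
  rw [h1, h2, mon_add]; ring

lemma MonoExp.of_unit (hg : QAt M g 0) (h0 : g 0 ≠ 0) : MonoExp M g 0 :=
  ⟨g, hg, h0, Eventually.of_forall fun x => by simp [mon_zero]⟩

lemma MonoExp.of_mon (hM : Wt M) : MonoExp M (mon α) α :=
  ⟨fun _ => 1, QAt.const hM 1 0, one_ne_zero, Eventually.of_forall fun x => by simp⟩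

lemma MonoExp.coord (hM : Wt M) (i : Fin m) : MonoExp M (fun x => x i) (Pi.single i 1) :=
  (MonoExp.of_mon hM).congr (Eventually.of_forall fun x => (mon_single i x).symm)

lemma MonoExp.pow (hM : Wt M) (hf : MonoExp M f α) (n : ℕ) : MonoExp M (fun x => f x ^ n) (n • α) := by
  obtain ⟨u, hu, hu0, hf⟩ := hf
  refine ⟨fun x => u x ^ n, hu.pow hM n, pow_ne_zero _ hu0, ?_⟩
  filter_upwards [hf] with x h1
  rw [h1, mon_smul]; ring

lemma MonoExp.finset_prod (hM : Wt M) {ι : Type*} (s : Finset ι) (F : ι → (Fin m → ℝ) → ℝ)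
    (A : ι → Fin m → ℕ) (h : ∀ i ∈ s, MonoExp M (F i) (A i)) :
    MonoExp M (fun x => ∏ i ∈ s, F i x) (∑ i ∈ s, A i) := by
  classical
  induction s using Finset.induction_on with
  | empty => simpa using MonoExp.of_unit (QAt.const hM (1:ℝ) (0 : Fin m → ℝ)) one_ne_zero
  | insert a s ha ih =>
    simp only [Finset.prod_insert ha, Finset.sum_insert ha]
    exact (h a (by simp)).mul hM (ih fun i hi => h i (by simp [hi]))

/-- maps with monomial components -/
def MonoMap (M : ℕ → ℝ) {m' m : ℕ} (ψ : (Fin m' → ℝ) → (Fin m → ℝ)) (A : Fin m → Fin m' → ℕ) : Prop :=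
  ∀ k, MonoExp M (fun x => ψ x k) (A k)

lemma MonoMap.qat (hM : Wt M) {m' : ℕ} {ψ : (Fin m' → ℝ) → (Fin m → ℝ)} {A} (h : MonoMap M ψ A) :
    QAt M ψ 0 := QAt.pi hM fun i => (h i).qat hM

lemma MonoExp.comp (hM : Wt M) {m' : ℕ} {ψ : (Fin m' → ℝ) → (Fin m → ℝ)} {A}
    (hg : MonoExp M g α) (h : MonoMap M ψ A) (h0 : ψ 0 = 0) :
    MonoExp M (fun x => g (ψ x)) (∑ k, α k • A k) := by
  obtain ⟨u, hu, hu0, hg⟩ := hg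
  have hq := h.qat hM
  have h1 := MonoExp.finset_prod hM Finset.univ (fun k x => ψ x k ^ α k) (fun k => α k • A k)
    (fun k _ => (h k).pow hM _)
  have hu' : QAt M u (ψ 0) := by rwa [h0]
  have h2 : MonoExp M (fun x => u (ψ x)) 0 := MonoExp.of_unit (hu'.comp hM hq) (by simpa [h0] using hu0)
  have h3 := h1.mul hM h2
  rw [add_zero] at h3
  refine h3.congr ?_
  have ht : Tendsto ψ (𝓝 0) (𝓝 0) := by
    have := hq.continuousAt.tendsto; rwa [h0] at this
  exact ht.eventually hg

lemma MonoExp.factor (hM : Wt M) (n : ℕ) : ∀ (α : Fin m → ℕ) (_ : ∑ i, α i = n) (f g : (Fin m → ℝ) → ℝ)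
    (_ : QAt M f 0) (_ : QAt M g 0) (_ : MonoExp M (fun x => f x * g x) α), ∃ β, MonoExp M f β := by
  induction n with
  | zero =>
    intro α hα f g hf hg ⟨u, hu, hu0, h⟩
    have hα0 : α = 0 := by
      ext i
      have := (Finset.sum_eq_zero_iff.1 hα) i (Finset.mem_univ i)
      simpa using this
    subst hα0
    have h1 := h.eq_of_nhds
    simp only [mon_zero, one_mul] at h1
    refine ⟨0, MonoExp.of_unit hf ?_⟩
    intro h2
    rw [h2, zero_mul] at h1
    exact hu0 h1.symm
  | succ n ih =>
    intro α hα f g hf hg ⟨u, hu, hu0, h⟩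
    have : ∃ i, α i ≠ 0 := by
      by_contra hc
      push Not at hc
      simp [hc] at hα
    obtain ⟨i, hi⟩ := this
    set α' : Fin m → ℕ := Function.update α i (α i - 1) with hα'
    have hαe : α = Pi.single i 1 + α' := by
      ext k
      by_cases hk : k = i
      · subst hk; simp [hα']; omega
      · simp [hα', hk]
    have hsum : ∑ i, α' i = n := by
      have : ∑ k, α k = ∑ k, (Pi.single i 1 : Fin m → ℕ) k + ∑ k, α' k := by
        rw [← Finset.sum_add_distrib]
        exact Finset.sum_congr rfl fun k _ => congrFun hαe k
      rw [hα, Finset.sum_pi_single'] at this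
      simp at this
      omega
    let l : (Fin m → ℝ) →L[ℝ] ℝ := ContinuousLinearMap.proj i
    let e : Fin m → ℝ := Pi.single i 1
    have he : l e = 1 := by simp [l, e]
    let P : (Fin m → ℝ) →L[ℝ] (Fin m → ℝ) := ContinuousLinearMap.id ℝ _ - l.smulRight e
    have hP0 : ∀ x, l (P x) = 0 := by intro x; simp [P, he]
    have hPx : ∀ x, l x = 0 → P x = x := by intro x hx; simp [P, hx]
    have hlx : ∀ x, l x = x i := fun x => rfl
    have hPq : QAt M P 0 := QAt.clm hM P 0
    have hPt : Tendsto P (𝓝 0) (𝓝 0) := by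
      have := P.continuous.tendsto 0; rwa [map_zero] at this
    have hcompq : ∀ {f : (Fin m → ℝ) → ℝ}, QAt M f 0 → QAt M (fun x => f (P x)) 0 := by
      intro f hf
      have hf' : QAt M f (P 0) := by rwa [map_zero]
      exact hf'.comp hM hPq
    have hprod : (fun x => f (P x) * g (P x)) =ᶠ[𝓝 0] 0 := by
      filter_upwards [hPt.eventually h] with x hx
      rw [hx, hαe, mon_add, mon_single, ← hlx (P x), hP0]; simp
    have hvan : ∀ {f : (Fin m → ℝ) → ℝ}, (fun x => f (P x)) =ᶠ[𝓝 0] 0 → ∀ᶠ x in 𝓝 0, l x = 0 → f x = 0 := by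
      intro f hf
      filter_upwards [hf] with x hx h0
      rw [hPx x h0] at hx
      exact hx
    have hlne : ¬ (fun x => l x) =ᶠ[𝓝 0] 0 := by
      intro hl
      have h1 : Tendsto (fun t : ℝ => t • e) (𝓝 0) (𝓝 0) := by
        have : Continuous (fun t : ℝ => t • e) := by fun_prop
        simpa using this.tendsto 0
      have h2 := h1.eventually hl
      obtain ⟨r, hr, h3⟩ := Metric.eventually_nhds_iff_ball.1 h2
      have := h3 (r/2) (by simp [abs_of_pos hr, hr])
      simp [he] at this
      exact hr.ne' this
    have hcancel : ∀ {a b : (Fin m → ℝ) → ℝ}, QAt M a 0 → QAt M b 0 →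
        (fun x => l x * a x) =ᶠ[𝓝 0] (fun x => l x * b x) → a =ᶠ[𝓝 0] b := by
      intro a b ha hb hab
      have h4 : (fun x => l x * (a x - b x)) =ᶠ[𝓝 0] 0 := by
        filter_upwards [hab] with x hx
        simp only [Pi.zero_apply, mul_sub, hx, sub_self]
      rcases (QAt.clm hM l 0).domain hM (ha.sub hM hb) h4 with h5 | h5
      · exact absurd h5 hlne
      · filter_upwards [h5] with x hx
        exact sub_eq_zero.1 hx
    rcases (hcompq hf).domain hM (hcompq hg) hprod with h1 | h1
    · obtain ⟨f', hf', hff⟩ := hf.div_lin hM l e he (hvan h1)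
      obtain ⟨β, hβ⟩ := ih α' hsum f' g hf' hg ⟨u, hu, hu0, by
        apply hcancel (hf'.mul hM hg) ((QAt.mon hM _ _).mul hM hu)
        filter_upwards [h, hff] with x hx1 hx2
        rw [hx2, hαe, mon_add, mon_single] at hx1
        rw [← mul_assoc, hx1, hlx]; ring⟩
      exact ⟨_, ((MonoExp.coord hM i).mul hM hβ).congr hff⟩
    · obtain ⟨g', hg', hgg⟩ := hg.div_lin hM l e he (hvan h1)
      refine ih α' hsum f g' hf hg' ⟨u, hu, hu0, ?_⟩
      apply hcancel (hf.mul hM hg') ((QAt.mon hM _ _).mul hM hu)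
      filter_upwards [h, hgg] with x hx1 hx2
      rw [hx2, hαe, mon_add, mon_single] at hx1
      rw [show l x * (f x * g' x) = f x * (l x * g' x) by ring, hx1, hlx]; ring

lemma MonoExp.of_mul (hM : Wt M) (hf : QAt M f 0) (hg : QAt M g 0) (h : MonoExp M (fun x => f x * g x) α) :
    ∃ β, MonoExp M f β := MonoExp.factor hM _ α rfl f g hf hg h
end mono
end QDCP

namespace QDCP
open Filter Topology Set
open scoped ContDiff Nat

section lifts
variable {M : ℕ → ℝ}

structure Lift (M : ℕ → ℝ) {m' m : ℕ} (V : Ultrafilter (Fin m' → ℝ)) (U : Ultrafilter (Fin m → ℝ))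
    (ψ : (Fin m' → ℝ) → (Fin m → ℝ)) : Prop where
  q : QAt M ψ 0
  z : ψ 0 = 0
  n : (V : Filter (Fin m' → ℝ)) ≤ 𝓝 0
  map : V.map ψ = U

def Reduced (M : ℕ → ℝ) {m : ℕ} (U : Ultrafilter (Fin m → ℝ)) : Prop :=
  (U : Filter (Fin m → ℝ)) ≤ 𝓝 0 ∧
  ∀ m' < m, ∀ (V : Ultrafilter (Fin m' → ℝ)) (ψ : (Fin m' → ℝ) → (Fin m → ℝ)), ¬ Lift M V U ψ

variable {m : ℕ} {U : Ultrafilter (Fin m → ℝ)}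

lemma Lift.tendsto {m' : ℕ} {V : Ultrafilter (Fin m' → ℝ)} {ψ : (Fin m' → ℝ) → (Fin m → ℝ)}
    (h : Lift M V U ψ) : Tendsto ψ (𝓝 0) (𝓝 0) := by
  have := h.q.continuousAt.tendsto
  rwa [h.z] at this

lemma Lift.ev {m' : ℕ} {V : Ultrafilter (Fin m' → ℝ)} {ψ : (Fin m' → ℝ) → (Fin m → ℝ)}
    (h : Lift M V U ψ) {P : (Fin m → ℝ) → Prop} : (∀ᶠ x in V, P (ψ x)) ↔ ∀ᶠ x in U, P x := by
  rw [← h.map]; rfl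

lemma Lift.comp (hM : Wt M) {m' m'' : ℕ} {V : Ultrafilter (Fin m' → ℝ)} {W : Ultrafilter (Fin m'' → ℝ)}
    {ψ : (Fin m' → ℝ) → (Fin m → ℝ)} {χ : (Fin m'' → ℝ) → (Fin m' → ℝ)}
    (h2 : Lift M W V χ) (h : Lift M V U ψ) : Lift M W U (fun x => ψ (χ x)) := by
  refine ⟨?_, by rw [h2.z, h.z], h2.n, ?_⟩
  · have : QAt M ψ (χ 0) := by rw [h2.z]; exact h.q
    exact this.comp hM h2.q
  · rw [← h.map, ← h2.map, Ultrafilter.map_map]; rfl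

lemma Lift.of_section {m' : ℕ} {ψ : (Fin m' → ℝ) → (Fin m → ℝ)} (χ : (Fin m → ℝ) → (Fin m' → ℝ))
    (hq : QAt M ψ 0) (hz : ψ 0 = 0) (ht : Tendsto χ U (𝓝 0)) (hs : ∀ᶠ x in U, ψ (χ x) = x) :
    Lift M (U.map χ) U ψ := by
  refine ⟨hq, hz, ht, ?_⟩
  rw [Ultrafilter.map_map]
  apply Ultrafilter.coe_injective
  rw [Ultrafilter.coe_map]
  have : Filter.map (ψ ∘ χ) (U : Filter _) = Filter.map id (U : Filter _) := Filter.map_congr hs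
  rw [this, Filter.map_id]

lemma Lift.refl (hM : Wt M) (hU : (U : Filter (Fin m → ℝ)) ≤ 𝓝 0) : Lift M U U (fun x => x) :=
  ⟨QAt.id hM 0, rfl, hU, Ultrafilter.map_id U⟩

lemma Reduced.lift (hM : Wt M) (hU : Reduced M U) {V : Ultrafilter (Fin m → ℝ)} {ψ : (Fin m → ℝ) → (Fin m → ℝ)}
    (h : Lift M V U ψ) : Reduced M V :=
  ⟨h.n, fun m' hm W χ hW => hU.2 m' hm W _ (hW.comp hM h)⟩

lemma Reduced.coord_ne (hM : Wt M) (hU : Reduced M U) (i : Fin m) : ∀ᶠ x : Fin m → ℝ in U, x i ≠ 0 := by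
  rw [Ultrafilter.eventually_not]
  intro h
  cases m with
  | zero => exact i.elim0
  | succ m =>
    refine hU.2 m (Nat.lt_succ_self m) _ (fun z => Fin.insertNth i 0 z)
      (Lift.of_section (fun x => Fin.removeNth i x) ?_ ?_ ?_ ?_)
    · apply QAt.pi hM
      intro k
      rcases Fin.eq_self_or_eq_succAbove i k with rfl | ⟨k, rfl⟩
      · simpa using QAt.const hM (0:ℝ) (0 : Fin m → ℝ)
      · simpa using QAt.coord hM k (0 : Fin m → ℝ)
    · ext k
      rcases Fin.eq_self_or_eq_succAbove i k with rfl | ⟨k, rfl⟩ <;> simp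
    · refine Tendsto.mono_left ?_ hU.1
      have : Continuous (fun x : Fin (m+1) → ℝ => Fin.removeNth i x) :=
        continuous_pi fun k => continuous_apply _
      exact this.tendsto 0
    · filter_upwards [h] with x hx
      rw [← hx]
      exact Fin.insertNth_self_removeNth i x

lemma Reduced.mon_ne (hM : Wt M) (hU : Reduced M U) (α : Fin m → ℕ) : ∀ᶠ x in U, mon α x ≠ 0 := by
  have := Filter.eventually_all.2 (fun i => hU.coord_ne hM i)
  filter_upwards [this] with x hx
  exact QDCP.mon_ne α x hx

lemma MonoExp.ne (hM : Wt M) (hU : Reduced M U) {g : (Fin m → ℝ) → ℝ} {α} (h : MonoExp M g α) : ∀ᶠ x in U, g x ≠ 0 := by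
  obtain ⟨u, hu, hu0, h⟩ := h
  filter_upwards [hU.mon_ne hM α, hU.1 h, hU.1 (hu.continuousAt.eventually_ne hu0)] with x h1 h2 h3
  rw [h2]
  exact mul_ne_zero h1 h3

lemma dichotomy {X : Type*} (U : Ultrafilter X) (a b : X → ℝ) :
    (∃ c, Tendsto (fun x => a x / b x) U (𝓝 c)) ∨
    ((∀ᶠ x in U, a x ≠ 0) ∧ Tendsto (fun x => b x / a x) U (𝓝 0)) := by
  by_cases h : ∃ C, ∀ᶠ x in U, |a x / b x| ≤ C
  · left
    obtain ⟨C, hC⟩ := h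
    obtain ⟨c, _, hc⟩ := (isCompact_Icc (a := -C) (b := C)).ultrafilter_le_nhds (U.map fun x => a x / b x)
      (by
        rw [le_principal_iff]
        change ∀ᶠ x in U, a x / b x ∈ Icc (-C) C
        filter_upwards [hC] with x hx
        exact abs_le.1 hx)
    exact ⟨c, hc⟩
  · right
    push Not at h
    have h' : ∀ C, ∀ᶠ x in U, C < |a x / b x| := by
      intro C
      exact h C
    constructor
    · filter_upwards [h' 0] with x hx h0
      simp [h0] at hx
    · have h1 : Tendsto (fun x => |a x / b x|) U atTop :=
        tendsto_atTop.2 fun C => (h' C).mono fun x hx => hx.le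
      have h2 := tendsto_inv_atTop_zero.comp h1
      rw [tendsto_zero_iff_abs_tendsto_zero]
      refine h2.congr fun x => ?_
      simp [abs_div]

/-- pull back of exponents -/
def pull {m' m : ℕ} (A : Fin m → Fin m' → ℕ) (α : Fin m → ℕ) : Fin m' → ℕ := ∑ k, α k • A k

lemma pull_apply {m' m : ℕ} (A : Fin m → Fin m' → ℕ) (α : Fin m → ℕ) (l) :
    pull A α l = ∑ k, α k * A k l := by simp [pull]

lemma pull_mono {m' m : ℕ} (A : Fin m → Fin m' → ℕ) {α β : Fin m → ℕ} (h : α ≤ β) : pull A α ≤ pull A β := by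
  intro l
  rw [pull_apply, pull_apply]
  exact Finset.sum_le_sum fun k _ => Nat.mul_le_mul_right _ (h k)

lemma pull_pull {m'' m' m : ℕ} (A : Fin m → Fin m' → ℕ) (B : Fin m' → Fin m'' → ℕ) (α : Fin m → ℕ) :
    pull B (pull A α) = pull (fun k => pull B (A k)) α := by
  ext l
  simp only [pull_apply, Finset.sum_mul, Finset.mul_sum]
  rw [Finset.sum_comm]
  simp [mul_assoc]

lemma pull_smul {m' m : ℕ} (A : Fin m → Fin m' → ℕ) (n : ℕ) (α : Fin m → ℕ) : pull A (n • α) = n • pull A α := by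
  ext l
  simp [pull_apply, Finset.mul_sum, mul_assoc]

/-- a lift by a monomial map -/
structure MLift (M : ℕ → ℝ) {m : ℕ} (V U : Ultrafilter (Fin m → ℝ))
    (ψ : (Fin m → ℝ) → (Fin m → ℝ)) (A : Fin m → Fin m → ℕ) : Prop extends Lift M V U ψ where
  mono : MonoMap M ψ A

lemma MLift.comp (hM : Wt M) {U V W : Ultrafilter (Fin m → ℝ)} {ψ χ A B} (h2 : MLift M W V χ B)
    (h : MLift M V U ψ A) : MLift M W U (fun x => ψ (χ x)) (fun k => pull B (A k)) :=
  ⟨h2.toLift.comp hM h.toLift, fun k => (h.mono k).comp hM h2.mono h2.z⟩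

def idA (m : ℕ) : Fin m → Fin m → ℕ := fun k => Pi.single k 1

lemma MLift.refl (hM : Wt M) (hU : (U : Filter (Fin m → ℝ)) ≤ 𝓝 0) : MLift M U U (fun x => x) (idA m) :=
  ⟨Lift.refl hM hU, fun k => MonoExp.coord hM k⟩

lemma pull_idA (α : Fin m → ℕ) : pull (idA m) α = α := by
  ext l
  rw [pull_apply, Finset.sum_eq_single l]
  · simp [idA]
  · intro k _ hk; simp [idA, hk.symm]
  · simp

lemma ramify (hM : Wt M) (hU : Reduced M U) (N : Fin m → ℕ) (hN : ∀ k, N k ≠ 0) :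
    ∃ V ψ, MLift M V U ψ (fun k => N k • Pi.single k 1) := by
  have hs : ∀ k, ∃ ε : ℝ, ε ≠ 0 ∧ ∀ᶠ x : Fin m → ℝ in U, ε * |x k| = x k := by
    intro k
    by_cases h : ∀ᶠ x : Fin m → ℝ in U, 0 ≤ x k
    · exact ⟨1, one_ne_zero, h.mono fun x hx => by rw [abs_of_nonneg hx, one_mul]⟩
    · rw [← Ultrafilter.eventually_not] at h
      exact ⟨-1, by norm_num, h.mono fun x hx => by rw [abs_of_neg (not_le.1 hx)]; ring⟩
  choose ε hε0 hε using hs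
  set ψ : (Fin m → ℝ) → (Fin m → ℝ) := fun t k => ε k * t k ^ N k with hψ
  have hmono : MonoMap M ψ (fun k => N k • Pi.single k 1) := by
    intro k
    have h1 := ((MonoExp.of_unit (QAt.const hM (ε k) (0 : Fin m → ℝ)) (hε0 k))).mul hM
      ((MonoExp.coord hM k).pow hM (N k))
    rwa [zero_add] at h1
  have hl : Lift M (U.map fun x k => |x k| ^ ((1:ℝ) / N k)) U ψ := by
    refine Lift.of_section _ (hmono.qat hM) ?_ ?_ ?_
    · ext k; simp [hψ, hN k]
    · rw [tendsto_pi_nhds]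
      intro k
      refine Tendsto.mono_left ?_ hU.1
      have h1 : ContinuousAt (fun x : Fin m → ℝ => |x k| ^ ((1:ℝ) / N k)) 0 := by
        apply ContinuousAt.rpow_const
        · exact (continuous_apply k).abs.continuousAt
        · right; positivity
      have h2 := h1.tendsto
      have : (0:ℝ) ^ ((1:ℝ) / N k) = 0 := Real.zero_rpow (by have := hN k; positivity)
      simp only [Pi.zero_apply, abs_zero, this] at h2
      exact h2
    · filter_upwards [Filter.eventually_all.2 hε] with x hx
      ext k
      simp only [hψ]
      rw [one_div, Real.rpow_inv_natCast_pow (abs_nonneg _) (hN k), hx k]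
  exact ⟨_, ψ, hl, hmono⟩

lemma pull_ramify (N : Fin m → ℕ) (α : Fin m → ℕ) (l) :
    pull (fun k => N k • Pi.single k 1) α l = α l * N l := by
  rw [pull_apply, Finset.sum_eq_single l]
  · simp
  · intro k _ hk; simp [hk.symm]
  · simp

lemma blowup (hM : Wt M) (hU : Reduced M U) {i j : Fin m} (hij : i ≠ j) {c : ℝ}
    (hc : Tendsto (fun x : Fin m → ℝ => x i / x j) U (𝓝 c)) : ∃ V ψ A, MLift M V U ψ A ∧
    ∀ α, pull A α j = α i + α j ∧ (pull A α i = α i ∨ pull A α i = 0) ∧ ∀ l, l ≠ i → l ≠ j → pull A α l = α l := by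
  classical
  set ψ : (Fin m → ℝ) → (Fin m → ℝ) := fun t => Function.update t i (t j * (t i + c)) with hψ
  set A : Fin m → Fin m → ℕ := Function.update (idA m) i (Pi.single j 1 + if c = 0 then Pi.single i 1 else 0) with hA
  have hmono : MonoMap M ψ A := by
    intro k
    by_cases hk : k = i
    · subst hk
      simp only [hA, hψ, Function.update_self]
      refine (MonoExp.coord hM j).mul hM ?_
      split_ifs with h0
      · simpa [h0] using MonoExp.coord hM k
      · exact MonoExp.of_unit ((QAt.coord hM k 0).add hM (QAt.const hM c 0)) (by simpa using h0)
    · simp only [hA, hψ, Function.update_of_ne hk]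
      exact MonoExp.coord hM k
  have hl : Lift M (U.map fun x => Function.update x i (x i / x j - c)) U ψ := by
    refine Lift.of_section _ (hmono.qat hM) ?_ ?_ ?_
    · simp [hψ]
    · rw [tendsto_pi_nhds]
      intro k
      by_cases hk : k = i
      · subst hk
        simpa using hc.sub_const c
      · simp only [Function.update_of_ne hk]
        exact ((continuous_apply k).tendsto 0).mono_left hU.1
    · filter_upwards [hU.coord_ne hM j] with x hx
      ext k
      by_cases hk : k = i
      · subst hk
        simp only [hψ, Function.update_self, Function.update_of_ne hij.symm]
        field_simp
        ring
      · simp only [hψ, Function.update_of_ne hk]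
  refine ⟨_, ψ, A, ⟨hl, hmono⟩, fun α => ?_⟩
  have key : ∀ l, pull A α l = (if l = i then 0 else α l) + α i * A i l := by
    intro l
    rw [pull_apply, ← Finset.add_sum_erase _ _ (Finset.mem_univ i), add_comm]
    congr 1
    have : ∀ k ∈ Finset.univ.erase i, α k * A k l = if k = l then α l else 0 := by
      intro k hk
      rw [hA, Function.update_of_ne (Finset.ne_of_mem_erase hk)]
      by_cases hkl : k = l
      · subst hkl; simp [idA]
      · simp [idA, hkl, Ne.symm hkl]
    rw [Finset.sum_congr rfl this, Finset.sum_ite_eq']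
    by_cases hl : l = i <;> simp [hl]
  refine ⟨?_, ?_, ?_⟩
  · rw [key]
    simp only [hA, Function.update_self, hij.symm, if_false, Pi.add_apply, Pi.single_eq_same]
    split_ifs <;> simp [hij.symm, add_comm]
  · rw [key]
    simp only [hA, Function.update_self, if_true, Pi.add_apply, Pi.single_eq_of_ne hij]
    split_ifs <;> simp
  · intro l h1 h2
    rw [key]
    simp only [hA, Function.update_self, h1, if_false, Pi.add_apply, Pi.single_eq_of_ne h2]
    split_ifs <;> simp [h1]

lemma toric (hM : Wt M) (n : ℕ) : ∀ (U : Ultrafilter (Fin m → ℝ)) (_ : Reduced M U) (α β : Fin m → ℕ)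
    (_ : (Finset.univ.filter fun k => α k ≠ β k).card ≤ n), ∃ V ψ A, MLift M V U ψ A ∧
      (pull A α ≤ pull A β ∨ pull A β ≤ pull A α) := by
  induction n with
  | zero =>
    intro U hU α β h
    have : α = β := by
      ext k
      by_contra hk
      have : k ∈ (Finset.univ.filter fun k => α k ≠ β k) := by simp [hk]
      rw [Finset.card_eq_zero.1 (Nat.le_zero.1 h)] at this
      simp at this
    exact ⟨U, _, _, MLift.refl hM hU.1, Or.inl (by rw [this])⟩
  | succ n ih =>
    intro U hU α β h
    by_cases hab : α ≤ β
    · exact ⟨U, _, _, MLift.refl hM hU.1, Or.inl (pull_mono _ hab)⟩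
    by_cases hba : β ≤ α
    · exact ⟨U, _, _, MLift.refl hM hU.1, Or.inr (pull_mono _ hba)⟩
    rw [Pi.le_def] at hab hba
    push Not at hab hba
    obtain ⟨i, hi⟩ := hab
    obtain ⟨j, hj⟩ := hba
    have hij : i ≠ j := by rintro rfl; omega
    set N : Fin m → ℕ := fun k => if k = i then β j - α j else if k = j then α i - β i else 1 with hN
    have hN0 : ∀ k, N k ≠ 0 := by
      intro k; simp only [hN]; split_ifs <;> omega
    obtain ⟨V, ψ, hV⟩ := ramify hM hU N hN0
    have hVr : Reduced M V := hU.lift hM hV.toLift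
    set A : Fin m → Fin m → ℕ := (fun k => N k • Pi.single k 1) with hA
    have hsum : pull A α i + pull A α j = pull A β i + pull A β j := by
      simp only [hA, pull_ramify, hN, if_true, hij.symm, if_false]
      obtain ⟨a, ha⟩ := Nat.exists_eq_add_of_lt hi
      obtain ⟨b, hb⟩ := Nat.exists_eq_add_of_lt hj
      rw [ha, hb]
      have h1 : α j + b + 1 - α j = b + 1 := by omega
      have h2 : β i + a + 1 - β i = a + 1 := by omega
      rw [h1, h2]; ring
    have hsub : ∀ k, pull A α k ≠ pull A β k → α k ≠ β k := by
      intro k hk h0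
      simp only [hA, pull_ramify, h0, ne_eq, not_true] at hk
    -- reduction step
    have step : ∀ i' j', i' ≠ j' → α i' ≠ β i' → α j' ≠ β j' → pull A α i' + pull A α j' = pull A β i' + pull A β j' →
        (∃ c, Tendsto (fun x : Fin m → ℝ => x i' / x j') V (𝓝 c)) → ∃ V ψ A, MLift M V U ψ A ∧
      (pull A α ≤ pull A β ∨ pull A β ≤ pull A α) := by
      intro i' j' hij' hi' hj' hs ⟨c, hc⟩
      obtain ⟨W, χ, B, hW, hB⟩ := blowup hM hVr hij' hc
      have hlt : (Finset.univ.filter fun k => pull B (pull A α) k ≠ pull B (pull A β) k).card ≤ n := by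
        have hss : (Finset.univ.filter fun k => pull B (pull A α) k ≠ pull B (pull A β) k) ⊆
            (Finset.univ.filter fun k => α k ≠ β k).erase j' := by
          intro k hk
          simp only [Finset.mem_filter, Finset.mem_univ, true_and, Finset.mem_erase] at hk ⊢
          have hkj : k ≠ j' := by
            rintro rfl
            rw [(hB _).1, (hB _).1] at hk
            exact hk hs
          refine ⟨hkj, ?_⟩
          by_cases hki : k = i'
          · rw [hki]; exact hi'
          · rw [(hB _).2.2 k hki hkj, (hB _).2.2 k hki hkj] at hk
            exact hsub k hk
        have := Finset.card_le_card hss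
        rw [Finset.card_erase_of_mem (by simp [hj'])] at this
        omega
      obtain ⟨W', χ', C, hW', hC⟩ := ih W (hVr.lift hM hW.toLift) _ _ hlt
      refine ⟨W', _, _, (hW'.comp hM hW).comp hM hV, ?_⟩
      rw [← pull_pull, ← pull_pull, ← pull_pull, ← pull_pull]
      exact hC
    rcases dichotomy V (fun x => x i) (fun x => x j) with h1 | ⟨_, h1⟩
    · exact step i j hij (by omega) (by omega) hsum h1
    · exact step j i hij.symm (by omega) (by omega) (by omega) ⟨0, h1⟩

lemma toric_min (hM : Wt M) {ι : Type*} (s : Finset ι) (hs : s.Nonempty) (γ : ι → Fin m → ℕ) (hU : Reduced M U) :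
    ∃ V ψ A, MLift M V U ψ A ∧ ∃ i0 ∈ s, ∀ i ∈ s, pull A (γ i0) ≤ pull A (γ i) := by
  classical
  induction hs using Finset.Nonempty.cons_induction with
  | singleton a => exact ⟨U, _, _, MLift.refl hM hU.1, a, by simp, by simp⟩
  | cons a s ha hs ih =>
    obtain ⟨V, ψ, A, hV, i0, hi0, hmin⟩ := ih
    obtain ⟨W, χ, B, hW, hB⟩ := toric hM _ V (hU.lift hM hV.toLift) (pull A (γ i0)) (pull A (γ a)) le_rfl
    refine ⟨W, _, _, hW.comp hM hV, ?_⟩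
    simp only [← pull_pull]
    rcases hB with hB | hB
    · refine ⟨i0, by simp [hi0], ?_⟩
      intro i hi
      rcases Finset.mem_cons.1 hi with rfl | hi
      · exact hB
      · exact pull_mono _ (hmin i hi)
    · refine ⟨a, by simp, ?_⟩
      intro i hi
      rcases Finset.mem_cons.1 hi with rfl | hi
      · exact le_rfl
      · exact hB.trans (pull_mono _ (hmin i hi))
end lifts
end QDCP

namespace QDCP
open Filter Topology Set
open scoped ContDiff Nat

section prep
variable {M : ℕ → ℝ}
variable {E : Type*} [NormedAddCommGroup E] [NormedSpace ℝ E]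

/-- directional derivative -/
noncomputable def dv (v : E) (f : E → ℝ) : E → ℝ := fun x => fderiv ℝ f x v

lemma dv_congr (v : E) {f g : E → ℝ} {a : E} (h : f =ᶠ[𝓝 a] g) : dv v f =ᶠ[𝓝 a] dv v g := by
  filter_upwards [h.fderiv (𝕜 := ℝ)] with x hx
  rw [dv, dv, hx]

lemma QAt.dv (hM : Wt M) (v : E) {f : E → ℝ} {a : E} (h : QAt M f a) : QAt M (dv v f) a :=
  h.fderiv_apply hM v

lemma QAt.dv_iter (hM : Wt M) (v : E) {f : E → ℝ} {a : E} (h : QAt M f a) (k : ℕ) :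
    QAt M ((QDCP.dv v)^[k] f) a := by
  induction k with
  | zero => exact h
  | succ k ih => rw [Function.iterate_succ_apply']; exact ih.dv hM v

lemma dv_iter_congr (v : E) {f g : E → ℝ} {a : E} (h : f =ᶠ[𝓝 a] g) (k : ℕ) :
    (dv v)^[k] f =ᶠ[𝓝 a] (dv v)^[k] g := by
  induction k with
  | zero => exact h
  | succ k ih => rw [Function.iterate_succ_apply', Function.iterate_succ_apply']; exact dv_congr v ih

lemma dv_iter_eq (v : E) {f : E → ℝ} {a : E} (h : ∀ᶠ x in 𝓝 a, ContDiffAt ℝ ∞ f x) (k : ℕ) :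
    (dv v)^[k] f =ᶠ[𝓝 a] fun x => iteratedFDeriv ℝ k f x (fun _ => v) := by
  induction k with
  | zero => exact Eventually.of_forall fun x => by simp
  | succ k ih =>
    rw [Function.iterate_succ_apply']
    refine (dv_congr v ih).trans ?_
    filter_upwards [h] with x hx
    have h1 : DifferentiableAt ℝ (iteratedFDeriv ℝ k f) x :=
      hx.differentiableAt_iteratedFDeriv (by exact_mod_cast WithTop.coe_lt_top _)
    have h2 : HasFDerivAt (fun x => iteratedFDeriv ℝ k f x (fun _ => v))
      ((ContinuousMultilinearMap.apply ℝ (fun _ : Fin k => E) ℝ (fun _ => v)).comp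
        (fderiv ℝ (iteratedFDeriv ℝ k f) x)) x :=
      (ContinuousMultilinearMap.apply ℝ (fun _ : Fin k => E) ℝ (fun _ => v)).hasFDerivAt.comp x h1.hasFDerivAt
    rw [dv, h2.fderiv, iteratedFDeriv_succ_apply_left]
    rfl

lemma QAt.comp0 (hM : Wt M) {E' F : Type*} [NormedAddCommGroup E'] [NormedSpace ℝ E']
    [NormedAddCommGroup F] [NormedSpace ℝ F] {f : E' → F}
    {ψ : E → E'} (hf : QAt M f 0) (hψ : QAt M ψ 0) (h0 : ψ 0 = 0) : QAt M (fun x => f (ψ x)) 0 := by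
  have : QAt M f (ψ 0) := by rwa [h0]
  exact this.comp hM hψ

variable {m : ℕ}

def cn (y : ℝ) (z : Fin m → ℝ) : Fin (m+1) → ℝ := Fin.cons y z
def tl (x : Fin (m+1) → ℝ) : Fin m → ℝ := fun i => x i.succ
def e0 (m : ℕ) : Fin (m+1) → ℝ := cn 1 0

@[simp] lemma cn_zero (y : ℝ) (z : Fin m → ℝ) : cn y z 0 = y := rfl
@[simp] lemma cn_succ (y : ℝ) (z : Fin m → ℝ) (i : Fin m) : cn y z i.succ = z i := rfl
@[simp] lemma tl_cn (y : ℝ) (z : Fin m → ℝ) : tl (cn y z) = z := rfl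
@[simp] lemma cn_tl (x : Fin (m+1) → ℝ) : cn (x 0) (tl x) = x := by
  ext i; refine Fin.cases ?_ (fun i => ?_) i <;> rfl
@[simp] lemma tl_zero : tl (0 : Fin (m+1) → ℝ) = 0 := rfl
@[simp] lemma cn_zero_zero : cn 0 (0 : Fin m → ℝ) = 0 := by
  ext i; refine Fin.cases ?_ (fun i => ?_) i <;> rfl
lemma cn_add_smul (y t : ℝ) (z : Fin m → ℝ) : cn y z + t • e0 m = cn (y + t) z := by
  ext i; refine Fin.cases ?_ (fun i => ?_) i <;> simp [e0]
lemma tl_add_smul (x : Fin (m+1) → ℝ) (t : ℝ) : tl (x + t • e0 m) = tl x := by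
  ext i; simp [tl, e0]
lemma zero_add_smul (x : Fin (m+1) → ℝ) (t : ℝ) : (x + t • e0 m) 0 = x 0 + t := by
  simp [e0]

lemma QAt.cn (hM : Wt M) {a : E → ℝ} {b : E → Fin m → ℝ} {p : E} (ha : QAt M a p) (hb : QAt M b p) :
    QAt M (fun x => cn (a x) (b x)) p := by
  apply QAt.pi hM
  intro i
  refine Fin.cases ?_ (fun i => ?_) i
  · exact ha
  · exact hb.apply hM i

lemma QAt.tl (hM : Wt M) (p : Fin (m+1) → ℝ) : QAt M (tl : (Fin (m+1) → ℝ) → _) p :=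
  QAt.pi hM fun i => QAt.coord hM i.succ p

/-- projection killing the first coordinate -/
lemma QAt.prj (hM : Wt M) (p : Fin (m+1) → ℝ) : QAt M (fun x : Fin (m+1) → ℝ => QDCP.cn 0 (QDCP.tl x)) p :=
  QAt.cn hM (QAt.const hM 0 p) (QAt.tl hM p)

lemma tendsto_tl : Tendsto (tl : (Fin (m+1) → ℝ) → _) (𝓝 0) (𝓝 0) := by
  have : Continuous (tl : (Fin (m+1) → ℝ) → Fin m → ℝ) := continuous_pi fun i => continuous_apply _
  exact this.tendsto 0

lemma tendsto_inc : Tendsto (fun z : Fin m → ℝ => cn 0 z) (𝓝 0) (𝓝 0) := by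
  have : Continuous (fun z : Fin m → ℝ => cn 0 z) := by
    apply continuous_pi
    intro i
    refine Fin.cases ?_ (fun i => ?_) i
    · exact continuous_const
    · exact continuous_apply i
  simpa using this.tendsto 0

lemma dv_comp_of (S : (Fin (m+1) → ℝ) → (Fin (m+1) → ℝ)) (f : (Fin (m+1) → ℝ) → ℝ) {x : Fin (m+1) → ℝ}
    (hS : ∀ t : ℝ, S (x + t • e0 m) = S x + t • e0 m) (h1 : DifferentiableAt ℝ f (S x))
    (h2 : DifferentiableAt ℝ (fun x => f (S x)) x) : dv (e0 m) (fun x => f (S x)) x = dv (e0 m) f (S x) := by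
  rw [dv, dv, ← h1.lineDeriv_eq_fderiv, ← h2.lineDeriv_eq_fderiv, lineDeriv, lineDeriv]
  simp only [hS]

lemma dv_comp_const (f : (Fin (m+1) → ℝ) → ℝ) {x : Fin (m+1) → ℝ}
    (hS : ∀ t : ℝ, f (x + t • e0 m) = f x)
    (h2 : DifferentiableAt ℝ f x) : dv (e0 m) f x = 0 := by
  rw [dv, ← h2.lineDeriv_eq_fderiv, lineDeriv]
  simp [hS]

lemma dv_coord (x : Fin (m+1) → ℝ) : dv (e0 m) (fun x => x 0) x = 1 := by
  let l : (Fin (m+1) → ℝ) →L[ℝ] ℝ := ContinuousLinearMap.proj 0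
  have : HasFDerivAt (fun x : Fin (m+1) → ℝ => x 0) l x := l.hasFDerivAt
  rw [dv, this.fderiv]; simp [e0, l]

/-- Hadamard's lemma in the first variable -/
lemma hadamard_step (hM : Wt M) {f : (Fin (m+1) → ℝ) → ℝ} (hf : QAt M f 0) :
    ∃ g, QAt M g 0 ∧ f =ᶠ[𝓝 0] fun x => f (cn 0 (tl x)) + x 0 * g x := by
  let l : (Fin (m+1) → ℝ) →L[ℝ] ℝ := ContinuousLinearMap.proj 0
  have hfP := hf.comp0 hM (QAt.prj hM 0) (by simp)
  obtain ⟨g, hg, h⟩ := (hf.sub hM hfP).div_lin hM l (e0 m) (by simp [l, e0])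
    (Eventually.of_forall fun x hx => by
      have h0 : x 0 = 0 := hx
      have : cn 0 (tl x) = x := by conv_rhs => rw [← cn_tl x, h0]
      rw [this, sub_self])
  refine ⟨g, hg, ?_⟩
  filter_upwards [h] with x hx
  have : l x = x 0 := rfl
  rw [← this]
  linarith

lemma hadamard_seq (hM : Wt M) {h : (Fin (m+1) → ℝ) → ℝ} (hh : QAt M h 0) :
    ∃ k : ℕ → (Fin (m+1) → ℝ) → ℝ, k 0 = h ∧ (∀ i, QAt M (k i) 0) ∧
      ∀ i, k i =ᶠ[𝓝 0] fun x => k i (cn 0 (tl x)) + x 0 * k (i+1) x := by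
  have step : ∀ f : {f : (Fin (m+1) → ℝ) → ℝ // QAt M f 0}, ∃ g : {g : (Fin (m+1) → ℝ) → ℝ // QAt M g 0},
      f.1 =ᶠ[𝓝 0] fun x => f.1 (cn 0 (tl x)) + x 0 * g.1 x := by
    intro f
    obtain ⟨g, hg, h⟩ := hadamard_step hM f.2
    exact ⟨⟨g, hg⟩, h⟩
  choose s hs using step
  refine ⟨fun i => (s^[i] ⟨h, hh⟩).1, rfl, fun i => (s^[i] ⟨h, hh⟩).2, fun i => ?_⟩
  simp only [Function.iterate_succ_apply']
  exact hs _

lemma hadamard_sum {h : (Fin (m+1) → ℝ) → ℝ} {k : ℕ → (Fin (m+1) → ℝ) → ℝ} (h0 : k 0 = h)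
    (hk : ∀ i, k i =ᶠ[𝓝 0] fun x => k i (cn 0 (tl x)) + x 0 * k (i+1) x) (D : ℕ) :
    h =ᶠ[𝓝 0] fun x => ∑ i ∈ Finset.range D, k i (cn 0 (tl x)) * x 0 ^ i + x 0 ^ D * k D x := by
  induction D with
  | zero => rw [h0]; exact Eventually.of_forall fun x => by simp
  | succ D ih =>
    filter_upwards [ih, hk D] with x h1 h2
    rw [h1, Finset.sum_range_succ]
    conv_lhs => rw [h2]
    ring

lemma leibniz (hM : Wt M) {f k : (Fin (m+1) → ℝ) → ℝ} (hf : QAt M f 0) (hk : QAt M k 0)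
    (h : f =ᶠ[𝓝 0] fun x => f (cn 0 (tl x)) + x 0 * k x) (j : ℕ) :
    (dv (e0 m))^[j+1] f =ᶠ[𝓝 0] fun x => x 0 * (dv (e0 m))^[j+1] k x + (j+1) * (dv (e0 m))^[j] k x := by
  have hmul : ∀ {a : (Fin (m+1) → ℝ) → ℝ} {x : Fin (m+1) → ℝ}, DifferentiableAt ℝ a x →
      fderiv ℝ (fun x => x 0 * a x) x (e0 m) = a x + x 0 * dv (e0 m) a x := by
    intro a x ha
    have h1 : DifferentiableAt ℝ (fun x : Fin (m+1) → ℝ => x 0) x := by fun_prop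
    rw [fderiv_fun_mul h1 ha]
    have := dv_coord x
    rw [dv] at this
    simp [this, dv]
    ring
  induction j with
  | zero =>
    have hfP := hf.comp0 hM (QAt.prj hM 0) (by simp)
    refine (dv_congr _ h).trans ?_
    filter_upwards [hfP.eventually, hk.eventually] with x h1 h2
    have h3 : DifferentiableAt ℝ (fun x : Fin (m+1) → ℝ => x 0) x := by fun_prop
    rw [dv, fderiv_fun_add h1.differentiableAt (h3.fun_mul h2.differentiableAt), ContinuousLinearMap.add_apply,
      hmul h2.differentiableAt]
    have h4 := dv_comp_const (fun x => f (cn 0 (tl x))) (x := x) (fun t => by rw [tl_add_smul]) h1.differentiableAt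
    rw [dv] at h4
    rw [h4]; simp; ring
  | succ j ih =>
    rw [Function.iterate_succ_apply']
    refine (dv_congr _ ih).trans ?_
    filter_upwards [(hk.dv_iter hM (e0 m) (j+1)).eventually, (hk.dv_iter hM (e0 m) j).eventually] with x h1 h2
    have h3 : DifferentiableAt ℝ (fun x : Fin (m+1) → ℝ => x 0) x := by fun_prop
    rw [dv, fderiv_fun_add (h3.fun_mul h1.differentiableAt) (h2.differentiableAt.const_mul _),
      ContinuousLinearMap.add_apply, hmul h1.differentiableAt, fderiv_const_mul h2.differentiableAt,
      ContinuousLinearMap.smul_apply]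
    have h5 : ((fderiv ℝ ((dv (e0 m))^[j] k) x) (e0 m)) = (dv (e0 m))^[j+1] k x := by
      rw [Function.iterate_succ_apply']; rfl
    rw [h5, Function.iterate_succ_apply' _ (j+1)]
    push_cast
    simp only [smul_eq_mul]
    ring

lemma hadamard_deriv (hM : Wt M) {k : ℕ → (Fin (m+1) → ℝ) → ℝ} (hq : ∀ i, QAt M (k i) 0)
    (hk : ∀ i, k i =ᶠ[𝓝 0] fun x => k i (cn 0 (tl x)) + x 0 * k (i+1) x) (j : ℕ) :
    ∀ i, ∀ᶠ z in 𝓝 (0 : Fin m → ℝ), (dv (e0 m))^[j] (k i) (cn 0 z) = j ! * k (i + j) (cn 0 z) := by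
  induction j with
  | zero => intro i; exact Eventually.of_forall fun z => by simp
  | succ j ih =>
    intro i
    filter_upwards [ih (i+1), tendsto_inc.eventually (leibniz hM (hq i) (hq (i+1)) (hk i) j)] with z h1 h2
    rw [h2, h1, Nat.factorial_succ]
    simp only [cn_zero, zero_mul, zero_add]
    rw [show i + 1 + j = i + (j + 1) by ring]
    push_cast; ring

/-- shear -/
def sh (θ : (Fin m → ℝ) → ℝ) (x : Fin (m+1) → ℝ) : Fin (m+1) → ℝ := cn (x 0 + θ (tl x)) (tl x)

lemma QAt.sh (hM : Wt M) {θ : (Fin m → ℝ) → ℝ} (h : QAt M θ 0) : QAt M (sh θ) 0 := by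
  have h' : QAt M θ (QDCP.tl (0 : Fin (m+1) → ℝ)) := by simpa using h
  exact QAt.cn hM ((QAt.coord hM 0 0).add hM (h'.comp hM (QAt.tl hM 0))) (QAt.tl hM 0)

lemma sh_at_zero {θ : (Fin m → ℝ) → ℝ} (h : θ 0 = 0) : sh θ 0 = 0 := by simp [sh, h]

lemma dv_sh (hM : Wt M) {θ : (Fin m → ℝ) → ℝ} (h : QAt M θ 0) (h0 : θ 0 = 0) {f : (Fin (m+1) → ℝ) → ℝ}
    (hf : QAt M f 0) (k : ℕ) :
    (dv (e0 m))^[k] (fun x => f (sh θ x)) =ᶠ[𝓝 0] fun x => (dv (e0 m))^[k] f (sh θ x) := by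
  have ht : Tendsto (sh θ) (𝓝 0) (𝓝 0) := by
    have := (QAt.sh hM h).continuousAt.tendsto; rwa [sh_at_zero h0] at this
  induction k with
  | zero => exact EventuallyEq.rfl
  | succ k ih =>
    rw [Function.iterate_succ_apply', Function.iterate_succ_apply']
    refine (dv_congr _ ih).trans ?_
    have hfk := hf.dv_iter hM (e0 m) k
    have hfk' : QAt M ((dv (e0 m))^[k] f) (sh θ 0) := by rwa [sh_at_zero h0]
    filter_upwards [ht.eventually hfk.eventually, (hfk'.comp hM (QAt.sh hM h)).eventually] with x h1 h2
    refine dv_comp_of (sh θ) _ (fun t => ?_) h1.differentiableAt h2.differentiableAt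
    rw [sh, sh, tl_add_smul, zero_add_smul, cn_add_smul]
    congr 1; ring

lemma implicit (hM : Wt M) {g : (Fin (m+1) → ℝ) → ℝ} (hg : QAt M g 0) (h0 : g 0 = 0)
    (hd : dv (e0 m) g 0 ≠ 0) : ∃ θ : (Fin m → ℝ) → ℝ, QAt M θ 0 ∧ θ 0 = 0 ∧
      ∀ᶠ z in 𝓝 (0 : Fin m → ℝ), g (cn (θ z) z) = 0 := by
  set F : (Fin (m+1) → ℝ) → (Fin (m+1) → ℝ) := fun x => cn (g x) (tl x) with hF
  have hFq : QAt M F 0 := QAt.cn hM hg (QAt.tl hM 0)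
  have hF0 : F 0 = 0 := by simp [hF, h0]
  have hFd := hFq.differentiableAt.hasFDerivAt
  have hcomp : ∀ v i, fderiv ℝ F 0 v i = fderiv ℝ (fun x => F x i) 0 v := by
    intro v i
    have h1 := (hasFDerivAt_pi'.1 hFd) i
    rw [h1.fderiv]; rfl
  have hinj : Function.Injective (fderiv ℝ F 0 : (Fin (m+1) → ℝ) →ₗ[ℝ] (Fin (m+1) → ℝ)) := by
    rw [← LinearMap.ker_eq_bot, LinearMap.ker_eq_bot']
    intro v hv
    have hv' : ∀ i, fderiv ℝ (fun x => F x i) 0 v = 0 := by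
      intro i
      rw [← hcomp]; exact congrFun hv i
    have hs : ∀ i : Fin m, v i.succ = 0 := by
      intro i
      have h1 := hv' i.succ
      let l : (Fin (m+1) → ℝ) →L[ℝ] ℝ := ContinuousLinearMap.proj i.succ
      have : HasFDerivAt (fun x : Fin (m+1) → ℝ => F x i.succ) l 0 := l.hasFDerivAt
      rw [this.fderiv] at h1
      exact h1
    have hve : v = v 0 • e0 m := by
      ext i; refine Fin.cases ?_ (fun i => ?_) i
      · simp [e0]
      · simp [e0, hs i]
    have h1 := hv' 0
    have h2 : (fun x => F x 0) = g := rfl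
    rw [h2, hve, map_smul, smul_eq_mul, mul_eq_zero] at h1
    rw [hve, h1.resolve_right hd, zero_smul]
  let L : (Fin (m+1) → ℝ) ≃L[ℝ] (Fin (m+1) → ℝ) := (LinearEquiv.ofInjectiveEndo _ hinj).toContinuousLinearEquiv
  have hL : fderiv ℝ F 0 = L := by
    ext v i; rfl
  obtain ⟨G, hG, hG0, h1, h2⟩ := hFq.inverse hM L hL
  rw [hF0] at hG hG0 h1
  have hG' : QAt M G (cn 0 (0 : Fin m → ℝ)) := by simpa using hG
  have hinc : QAt M (fun z : Fin m → ℝ => cn 0 z) 0 := QAt.cn hM (QAt.const hM 0 0) (QAt.id hM 0)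
  refine ⟨fun z => G (cn 0 z) 0, (hG'.comp hM hinc).apply hM 0, by simp [hG0], ?_⟩
  filter_upwards [tendsto_inc.eventually h1] with z hz
  have hz0 := congrFun hz 0
  have hzt : tl (F (G (cn 0 z))) = tl (cn 0 z) := by rw [hz]
  simp only [hF, cn_zero, tl_cn] at hz0 hzt
  have : cn (G (cn 0 z) 0) z = G (cn 0 z) := by
    conv_rhs => rw [← cn_tl (G (cn 0 z)), hzt]
  rw [this, hz0]
end prep
end QDCP

namespace QDCP
open Filter Topology Set
open scoped ContDiff Nat

section ml
variable {M : ℕ → ℝ} {m : ℕ}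

def ext {m' : ℕ} (ψ : (Fin m' → ℝ) → (Fin m → ℝ)) (x : Fin (m'+1) → ℝ) : Fin (m+1) → ℝ :=
  cn (x 0) (ψ (tl x))

lemma Lift.ext (hM : Wt M) {m' : ℕ} {ψ : (Fin m' → ℝ) → (Fin m → ℝ)} {U : Ultrafilter (Fin (m+1) → ℝ)}
    {V : Ultrafilter (Fin m' → ℝ)} (hU : (U : Filter (Fin (m+1) → ℝ)) ≤ 𝓝 0) (h : Lift M V (U.map tl) ψ) :
    ∃ W, Lift M W U (ext ψ) ∧ W.map tl = V := by
  let F : Filter (Fin (m'+1) → ℝ) := comap (QDCP.ext ψ) U ⊓ comap tl V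
  have hF : F.NeBot := by
    rw [Filter.neBot_iff, Ne, ← Filter.empty_mem_iff_bot, Filter.mem_inf_iff_superset]
    rintro ⟨a, ⟨S, hS, hSa⟩, b, ⟨T, hT, hTb⟩, hab⟩
    have h1 : ψ '' T ∈ U.map tl := by
      rw [← h.map]
      exact Filter.image_mem_map hT
    have h2 : tl ⁻¹' (ψ '' T) ∈ U := h1
    obtain ⟨x, hx1, z, hz, hx2⟩ := U.nonempty_of_mem (inter_mem hS h2)
    have hx : QDCP.ext ψ (cn (x 0) z) = x := by
      simp only [QDCP.ext, cn_zero, tl_cn, hx2, cn_tl]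
    have h3 : cn (x 0) z ∈ a := hSa (by simpa [hx] using hx1)
    have h4 : cn (x 0) z ∈ b := hTb (by simpa using hz)
    exact hab ⟨h3, h4⟩
  let W := Ultrafilter.of F
  have hW : (W : Filter _) ≤ F := Ultrafilter.of_le F
  have hW1 : W.map (QDCP.ext ψ) = U := by
    apply Ultrafilter.eq_of_le
    rw [Ultrafilter.coe_map]
    exact (Filter.map_mono (hW.trans inf_le_left)).trans Filter.map_comap_le
  have hW2 : W.map tl = V := by
    apply Ultrafilter.eq_of_le
    rw [Ultrafilter.coe_map]
    exact (Filter.map_mono (hW.trans inf_le_right)).trans Filter.map_comap_le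
  refine ⟨W, ⟨?_, ?_, ?_, hW1⟩, hW2⟩
  · exact QAt.cn hM (QAt.coord hM 0 0) (h.q.comp0 hM (QAt.tl hM 0) rfl)
  · simp [QDCP.ext, h.z]
  · have h5 : Tendsto (fun x : Fin (m'+1) → ℝ => x) W (𝓝 0) := by
      rw [tendsto_pi_nhds]
      intro i
      refine Fin.cases ?_ (fun i => ?_) i
      · have h6 : Tendsto (fun x : Fin (m+1) → ℝ => x 0) U (𝓝 0) :=
          ((continuous_apply 0).tendsto 0).mono_left hU
        rw [← hW1] at h6
        exact h6
      · have h6 : Tendsto (fun x : Fin m' → ℝ => x i) V (𝓝 0) :=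
          ((continuous_apply i).tendsto 0).mono_left h.n
        rw [← hW2] at h6
        exact h6
    exact h5

lemma Reduced.proj (hM : Wt M) {U : Ultrafilter (Fin (m+1) → ℝ)} (hU : Reduced M U) : Reduced M (U.map tl) := by
  refine ⟨tendsto_tl.mono_left hU.1, fun m' hm V ψ h => ?_⟩
  obtain ⟨W, hW, _⟩ := h.ext hM hU.1
  exact hU.2 (m'+1) (by omega) W _ hW

def ML (M : ℕ → ℝ) (m : ℕ) : Prop := ∀ U : Ultrafilter (Fin m → ℝ), Reduced M U → ∀ f : (Fin m → ℝ) → ℝ,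
  QAt M f 0 → ¬ f =ᶠ[𝓝 0] 0 → ∃ (V : Ultrafilter (Fin m → ℝ)) (ψ : (Fin m → ℝ) → (Fin m → ℝ)) (α : Fin m → ℕ),
    Lift M V U ψ ∧ MonoExp M (fun x => f (ψ x)) α

lemma ML.ne (hM : Wt M) (ml : ML M m) {U : Ultrafilter (Fin m → ℝ)} (hU : Reduced M U) {f : (Fin m → ℝ) → ℝ}
    (hf : QAt M f 0) (h : ¬ f =ᶠ[𝓝 0] 0) : ∀ᶠ x in U, f x ≠ 0 := by
  obtain ⟨V, ψ, α, hV, hm⟩ := ml U hU f hf h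
  exact hV.ev.1 (hm.ne hM (hU.lift hM hV))

lemma not_germ_zero {U : Ultrafilter (Fin m → ℝ)} (hU : (U : Filter (Fin m → ℝ)) ≤ 𝓝 0) {f : (Fin m → ℝ) → ℝ}
    (h : ∀ᶠ x in U, f x ≠ 0) : ¬ f =ᶠ[𝓝 0] 0 := by
  intro h0
  obtain ⟨x, h1, h2⟩ := (h.and (hU h0)).exists
  exact h1 h2

lemma base (hM : Wt M) (ml : ML M m) {V : Ultrafilter (Fin m → ℝ)} (hV : Reduced M V)
    {p : (Fin m → ℝ) → ℝ} (hp : QAt M p 0) (hp0 : ¬ p =ᶠ[𝓝 0] 0) (D : ℕ) (s : Finset ℕ) (hs : s.Nonempty)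
    (hsD : ∀ i ∈ s, i < D) (c : ℕ → (Fin m → ℝ) → ℝ) (hc : ∀ i, QAt M (c i) 0)
    (hc0 : ∀ i ∈ s, ¬ c i =ᶠ[𝓝 0] 0) :
    ∃ (V' : Ultrafilter (Fin m → ℝ)) (ψ : (Fin m → ℝ) → (Fin m → ℝ)), Lift M V' V ψ ∧ (∃ β, MonoExp M (fun x => p (ψ x)) β) ∧
      ∃ (α : Fin m → ℕ) (e : ℕ → (Fin m → ℝ) → ℝ), (∀ i ∈ s, QAt M (e i) 0 ∧
        (fun x => c i (ψ x)) =ᶠ[𝓝 0] fun x => mon α x ^ (D - i) * e i x) ∧ ∃ i0 ∈ s, e i0 0 ≠ 0 := by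
  classical
  have hf : QAt M (fun x => p x * ∏ i ∈ s, c i x) 0 := hp.mul hM (QAt.finset_prod hM _ fun i _ => hc i)
  have hf0 : ¬ (fun x => p x * ∏ i ∈ s, c i x) =ᶠ[𝓝 0] 0 := by
    apply not_germ_zero hV.1
    have h1 : ∀ᶠ x in V, ∀ i ∈ s, c i x ≠ 0 := by
      rw [Filter.eventually_all_finset]
      intro i hi
      exact ml.ne hM hV (hc i) (hc0 i hi)
    filter_upwards [h1, ml.ne hM hV hp hp0] with x h1 h2
    exact mul_ne_zero h2 (Finset.prod_ne_zero_iff.2 h1)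
  obtain ⟨V1, ψ1, α1, hV1, hm1⟩ := ml V hV _ hf hf0
  have hp1 := hp.comp0 hM hV1.q hV1.z
  have hc1 : ∀ i, QAt M (fun x => c i (ψ1 x)) 0 := fun i => (hc i).comp0 hM hV1.q hV1.z
  obtain ⟨β, hβ⟩ := MonoExp.of_mul hM hp1 (QAt.finset_prod hM s fun i _ => hc1 i) hm1
  have hγ : ∀ i, ∃ γ, i ∈ s → MonoExp M (fun x => c i (ψ1 x)) γ := by
    intro i
    by_cases hi : i ∈ s
    · have h2 : MonoExp M (fun x => c i (ψ1 x) * (p (ψ1 x) * ∏ i ∈ s.erase i, c i (ψ1 x))) α1 := by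
        refine hm1.congr (Eventually.of_forall fun x => ?_)
        simp only
        rw [← Finset.mul_prod_erase s _ hi]; ring
      obtain ⟨γ, hγ⟩ := MonoExp.of_mul hM (hc1 i) (hp1.mul hM (QAt.finset_prod hM _ fun i _ => hc1 i)) h2
      exact ⟨γ, fun _ => hγ⟩
    · exact ⟨0, fun h => absurd h hi⟩
  choose γ hγ using hγ
  have hV1r := hV.lift hM hV1
  set w : ℕ → ℕ := fun i => D ! / (D - i) with hw
  have hwD : ∀ i ∈ s, (D - i) * w i = D ! := by
    intro i hi
    have := hsD i hi
    exact Nat.mul_div_cancel' (Nat.dvd_factorial (by omega) (by omega))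
  obtain ⟨V2, ψ2, A, hV2, i0, hi0, hmin⟩ := toric_min hM s hs (fun i => w i • γ i) hV1r
  have hV2r := hV1r.lift hM hV2.toLift
  obtain ⟨V3, ψ3, hV3⟩ := ramify hM hV2r (fun _ => D !) (fun _ => Nat.factorial_ne_zero D)
  have hV32 := hV3.comp hM hV2
  set B : Fin m → Fin m → ℕ := (fun k => pull (fun k => D ! • Pi.single k 1) (A k)) with hB
  set al : Fin m → ℕ := w i0 • pull A (γ i0) with hal
  have hpullB : ∀ g, pull B g = D ! • pull A g := by
    intro g
    rw [hB, ← pull_pull]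
    ext l
    rw [pull_ramify]; simp [mul_comm]
  have hge : ∀ i ∈ s, (D - i) • al ≤ pull B (γ i) := by
    intro i hi
    have h1 := hmin i hi
    simp only [pull_smul] at h1
    rw [hpullB, ← hwD i hi, mul_smul]
    intro l
    exact Nat.mul_le_mul_left _ (h1 l)
  have hmono : ∀ i ∈ s, MonoExp M (fun x => c i (ψ1 (ψ2 (ψ3 x)))) (pull B (γ i)) := by
    intro i hi
    exact (hγ i hi).comp hM hV32.mono hV32.z
  have hu : ∀ i, ∃ u : (Fin m → ℝ) → ℝ, i ∈ s → QAt M u 0 ∧ u 0 ≠ 0 ∧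
      (fun x => c i (ψ1 (ψ2 (ψ3 x)))) =ᶠ[𝓝 0] fun x => mon (pull B (γ i)) x * u x := by
    intro i
    by_cases hi : i ∈ s
    · obtain ⟨u, hu⟩ := hmono i hi
      exact ⟨u, fun _ => hu⟩
    · exact ⟨0, fun h => absurd h hi⟩
  choose u hu using hu
  refine ⟨V3, _, hV32.toLift.comp hM hV1, ⟨_, hβ.comp hM hV32.mono hV32.z⟩, al,
    fun i x => mon (pull B (γ i) - (D - i) • al) x * u i x, ?_, i0, hi0, ?_⟩
  · intro i hi
    refine ⟨(QAt.mon hM _ _).mul hM (hu i hi).1, ?_⟩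
    filter_upwards [(hu i hi).2.2] with x hx
    rw [hx, ← mul_assoc, ← mon_smul, ← mon_add]
    congr 2
    rw [add_tsub_cancel_of_le (hge i hi)]
  · have h1 : pull B (γ i0) - (D - i0) • al = 0 := by
      rw [hpullB, hal, ← hwD i0 hi0, mul_smul, tsub_self]
    simp only [h1, mon_zero, one_mul]
    exact (hu i0 hi0).2.1

lemma poly_dvd (D : ℕ) : ∀ (Q : Polynomial ℝ) (κ : ℝ → ℝ) (_ : ContinuousAt κ 0)
    (_ : ∀ᶠ y in 𝓝 0, Q.eval y = y ^ D * κ y), Polynomial.X ^ D ∣ Q := by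
  induction D with
  | zero => intro Q κ _ _; simp
  | succ D ih =>
    intro Q κ hκ hQ
    obtain ⟨R, hR⟩ := ih Q (fun y => y * κ y) (continuousAt_id.mul hκ) (hQ.mono fun y hy => by rw [hy]; ring)
    have h1 : ∀ᶠ y in 𝓝[≠] (0:ℝ), y * κ y = R.eval y := by
      filter_upwards [hQ.filter_mono nhdsWithin_le_nhds, self_mem_nhdsWithin] with y hy hy0
      have hy0 : y ≠ 0 := hy0
      rw [hR, Polynomial.eval_mul, Polynomial.eval_pow, Polynomial.eval_X, pow_succ, mul_assoc] at hy
      exact (mul_left_cancel₀ (pow_ne_zero D hy0) hy).symm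
    have h2 : Tendsto (fun y => y * κ y) (𝓝[≠] (0:ℝ)) (𝓝 0) := by
      have : ContinuousAt (fun y => y * κ y) 0 := continuousAt_id.mul hκ
      have := this.tendsto
      rw [zero_mul] at this
      exact this.mono_left nhdsWithin_le_nhds
    have h3 : Tendsto (fun y => R.eval y) (𝓝[≠] (0:ℝ)) (𝓝 (R.eval 0)) :=
      (R.continuous.tendsto 0).mono_left nhdsWithin_le_nhds
    have h4 := tendsto_nhds_unique (h2.congr' h1) h3
    have h5 : Polynomial.X ∣ R := by
      rw [Polynomial.X_dvd_iff, Polynomial.coeff_zero_eq_eval_zero, ← h4]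
    rw [hR, pow_succ]
    exact mul_dvd_mul_left _ h5

open Polynomial in
lemma poly_shift {D : ℕ} (s : Finset ℕ) (hs : ∀ i ∈ s, i + 1 < D) (a : ℕ → ℝ) (u c : ℝ) (hu : u ≠ 0) (κ : ℝ → ℝ)
    (hκ : ContinuousAt κ 0)
    (h : ∀ᶠ y in 𝓝 (0:ℝ), ∑ i ∈ s, a i * (y + c) ^ i + (y + c) ^ D * u = y ^ D * κ y) : ∀ i ∈ s, a i = 0 := by
  intro i hi
  have hD : 0 < D := by have := hs i hi; omega
  set P : ℝ[X] := ∑ i ∈ s, C (a i) * X ^ i + C u * X ^ D with hP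
  have hPc : ∀ n, P.coeff n = (if n ∈ s then a n else 0) + if n = D then u else 0 := by
    intro n
    simp [hP, Polynomial.finsetSum_coeff, Polynomial.coeff_X_pow]
  have hPd : P.natDegree ≤ D := by
    rw [Polynomial.natDegree_le_iff_coeff_eq_zero]
    intro n hn
    rw [hPc, if_neg, if_neg (by omega), add_zero]
    intro hns
    have := hs n hns; omega
  set Q : ℝ[X] := P.comp (X + C c) with hQ
  have hdvd : X ^ D ∣ Q := by
    refine poly_dvd D Q κ hκ (h.mono fun y hy => ?_)
    rw [← hy]
    simp [hQ, hP, Polynomial.eval_comp, Polynomial.eval_finsetSum, mul_comm u]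
  obtain ⟨R, hR⟩ := hdvd
  have hQd : Q.natDegree ≤ D := by
    refine (Polynomial.natDegree_comp_le).trans ?_
    simpa using hPd
  have hRc : ∃ k, R = C k := by
    by_cases hR0 : R = 0
    · exact ⟨0, by simp [hR0]⟩
    · refine ⟨_, Polynomial.eq_C_of_natDegree_eq_zero ?_⟩
      rw [hR, Polynomial.natDegree_mul (pow_ne_zero _ X_ne_zero) hR0, Polynomial.natDegree_X_pow] at hQd
      omega
  obtain ⟨k, rfl⟩ := hRc
  have hPk : P = C k * (X + C (-c)) ^ D := by
    have h1 : Q.comp (X + C (-c)) = P := by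
      rw [hQ, Polynomial.comp_assoc]; simp
    rw [← h1, hR, Polynomial.mul_comp, Polynomial.pow_comp, Polynomial.X_comp, Polynomial.C_comp, mul_comm]
  have hcoef : ∀ n, P.coeff n = k * ((-c) ^ (D - n) * (D.choose n : ℝ)) := by
    intro n
    rw [hPk, Polynomial.coeff_C_mul, Polynomial.coeff_X_add_C_pow]
  have hk : k = u := by
    have h1 := hcoef D
    rw [hPc, if_neg (fun hn => by have := hs D hn; omega)] at h1
    simpa using h1.symm
  have hc : c = 0 := by
    have h1 := hcoef (D-1)
    rw [hPc, if_neg (fun hn => by have := hs (D-1) hn; omega), if_neg (by omega)] at h1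
    rw [show D - (D - 1) = 1 by omega, hk] at h1
    have h2 : (D.choose (D-1) : ℝ) ≠ 0 := by
      have := Nat.choose_pos (show D - 1 ≤ D by omega)
      positivity
    have h3 : u * ((-c) ^ 1 * (D.choose (D-1) : ℝ)) = 0 := by rw [← h1]; simp
    simpa [hu, h2] using h3
  have h1 := hcoef i
  have := hs i hi
  rw [hPc, if_pos hi, if_neg (by omega), hc] at h1
  rw [neg_zero, zero_pow (by omega)] at h1
  simpa using h1
end ml
end QDCP

namespace QDCP
open Filter Topology Set
open scoped ContDiff Nat

section ml2
variable {M : ℕ → ℝ} {m : ℕ}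

lemma monoMap_tl (hM : Wt M) : MonoMap M (tl : (Fin (m+1) → ℝ) → (Fin m → ℝ)) (fun k => Pi.single k.succ 1) :=
  fun k => MonoExp.coord hM k.succ

lemma MonoExp.tl (hM : Wt M) {g : (Fin m → ℝ) → ℝ} {α} (h : MonoExp M g α) :
    ∃ β, MonoExp M (fun x : Fin (m+1) → ℝ => g (QDCP.tl x)) β :=
  ⟨_, h.comp hM (monoMap_tl hM) tl_zero⟩

def RD (M : ℕ → ℝ) (m d : ℕ) : Prop := ∀ U : Ultrafilter (Fin (m+1) → ℝ), Reduced M U →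
  ∀ (p : (Fin m → ℝ) → ℝ) (h : (Fin (m+1) → ℝ) → ℝ), QAt M p 0 → ¬ p =ᶠ[𝓝 0] 0 → QAt M h 0 →
  (∃ j ≤ d, (dv (e0 m))^[j] h 0 ≠ 0) →
  ∃ (V : Ultrafilter (Fin (m+1) → ℝ)) (ψ : (Fin (m+1) → ℝ) → (Fin (m+1) → ℝ)) (α : Fin (m+1) → ℕ),
    Lift M V U ψ ∧ MonoExp M (fun x => p (tl (ψ x)) * h (ψ x)) α

lemma Rmon (hM : Wt M) (ml : ML M m) {U : Ultrafilter (Fin (m+1) → ℝ)} (hU : Reduced M U)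
    {p : (Fin m → ℝ) → ℝ} {h u : (Fin (m+1) → ℝ) → ℝ} (hp : QAt M p 0) (hp0 : ¬ p =ᶠ[𝓝 0] 0) (n : ℕ)
    (hu : QAt M u 0) (hu0 : u 0 ≠ 0) (hh : h =ᶠ[𝓝 0] fun x => x 0 ^ n * u x) :
    ∃ (V : Ultrafilter (Fin (m+1) → ℝ)) (ψ : (Fin (m+1) → ℝ) → (Fin (m+1) → ℝ)) (α : Fin (m+1) → ℕ),
    Lift M V U ψ ∧ MonoExp M (fun x => p (tl (ψ x)) * h (ψ x)) α := by
  obtain ⟨V, ψ, α, hV, hm⟩ := ml _ (hU.proj hM) p hp hp0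
  obtain ⟨W, hW, -⟩ := hV.ext hM hU.1
  obtain ⟨β, hβ⟩ := hm.tl hM
  have hu1 : MonoExp M (fun x => u (QDCP.ext ψ x)) 0 :=
    MonoExp.of_unit (hu.comp0 hM hW.q hW.z) (by simpa [hW.z] using hu0)
  refine ⟨W, _, _, hW, (hβ.mul hM (((MonoExp.coord hM 0).pow hM n).mul hM hu1)).congr ?_⟩
  filter_upwards [hW.tendsto.eventually hh] with x hx
  rw [hx]
  simp [QDCP.ext]

lemma case1 (hM : Wt M) {d : ℕ} (ih : RD M m d) {U : Ultrafilter (Fin (m+1) → ℝ)} (hU : Reduced M U)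
    {p : (Fin m → ℝ) → ℝ} {h u : (Fin (m+1) → ℝ) → ℝ} (hp : QAt M p 0) (hp0 : ¬ p =ᶠ[𝓝 0] 0)
    (hu : QAt M u 0) (hu0 : u 0 ≠ 0) (s : Finset ℕ) (hs : ∀ i ∈ s, i + 1 < d + 1)
    (α : Fin m → ℕ) (hα : α ≠ 0) (e : ℕ → (Fin m → ℝ) → ℝ) (he : ∀ i ∈ s, QAt M (e i) 0)
    (i0 : ℕ) (hi0 : i0 ∈ s) (hei : e i0 0 ≠ 0)
    (hh : h =ᶠ[𝓝 0] fun x => ∑ i ∈ s, mon α (tl x) ^ (d + 1 - i) * e i (tl x) * x 0 ^ i + x 0 ^ (d+1) * u x)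
    (c : ℝ) (hc : Tendsto (fun x : Fin (m+1) → ℝ => x 0 / mon α (tl x)) U (𝓝 c)) :
    ∃ (V : Ultrafilter (Fin (m+1) → ℝ)) (ψ : (Fin (m+1) → ℝ) → (Fin (m+1) → ℝ)) (α : Fin (m+1) → ℕ),
    Lift M V U ψ ∧ MonoExp M (fun x => p (tl (ψ x)) * h (ψ x)) α := by
  set ψ : (Fin (m+1) → ℝ) → (Fin (m+1) → ℝ) := fun x => cn (mon α (tl x) * (x 0 + c)) (tl x) with hψ
  have hmq : QAt M (fun x : Fin (m+1) → ℝ => mon α (tl x)) 0 := (QAt.mon hM α 0).comp0 hM (QAt.tl hM 0) tl_zero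
  have hyc : QAt M (fun x : Fin (m+1) → ℝ => x 0 + c) 0 := (QAt.coord hM 0 0).add hM (QAt.const hM c 0)
  have hq : QAt M ψ 0 := QAt.cn hM (hmq.mul hM hyc) (QAt.tl hM 0)
  have hz : ψ 0 = 0 := by simp [hψ, mon_at_zero α hα]
  have hUp := hU.proj hM
  have hmne : ∀ᶠ x in U, mon α (tl x) ≠ 0 := hUp.mon_ne hM α
  have hL : Lift M (U.map fun x => cn (x 0 / mon α (tl x) - c) (tl x)) U ψ := by
    refine Lift.of_section _ hq hz ?_ ?_
    · rw [tendsto_pi_nhds]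
      intro i
      refine Fin.cases ?_ (fun i => ?_) i
      · simpa using hc.sub_const c
      · simp only [cn_succ]
        exact ((continuous_apply i.succ).tendsto (0 : Fin (m+1) → ℝ)).mono_left hU.1
    · filter_upwards [hmne] with x hx
      simp only [hψ, tl_cn, cn_zero, sub_add_cancel]
      rw [mul_div_cancel₀ _ hx, cn_tl]
  set g : (Fin (m+1) → ℝ) → ℝ := fun x => ∑ i ∈ s, e i (tl x) * (x 0 + c) ^ i + (x 0 + c) ^ (d+1) * u (ψ x) with hg
  have hgq : QAt M g 0 := by
    refine QAt.add hM (QAt.finset_sum hM s fun i hi => ?_) ?_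
    · exact ((he i hi).comp0 hM (QAt.tl hM 0) tl_zero).mul hM (hyc.pow hM i)
    · exact (hyc.pow hM _).mul hM (hu.comp0 hM hq hz)
  have hgh : (fun x => h (ψ x)) =ᶠ[𝓝 0] fun x => mon α (tl x) ^ (d+1) * g x := by
    filter_upwards [hL.tendsto.eventually hh] with x hx
    rw [hx, hg]
    simp only [hψ, tl_cn, cn_zero, mul_add, Finset.mul_sum]
    congr 1
    · refine Finset.sum_congr rfl fun i hi => ?_
      have := hs i hi
      rw [← mul_add, mul_pow]
      have h3 : mon α (tl x) ^ (d+1) = mon α (tl x) ^ (d+1-i) * mon α (tl x) ^ i := by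
        rw [← pow_add]; congr 1; omega
      rw [h3]; ring
    · rw [← mul_add, mul_pow]; ring
  have hj : ∃ j ≤ d, (dv (e0 m))^[j] g 0 ≠ 0 := by
    by_contra! hcon
    obtain ⟨k, hk0, hkq, hk⟩ := hadamard_seq hM hgq
    have hkz : ∀ j ≤ d, k j 0 = 0 := by
      intro j hj
      have h1 := (hadamard_deriv hM hkq hk j 0).self_of_nhds
      rw [cn_zero_zero, hk0, hcon j hj, zero_add] at h1
      have h2 : (j ! : ℝ) ≠ 0 := by positivity
      simpa [h2] using h1.symm
    have h1 := hadamard_sum hk0 hk (d+1)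
    have hline : Tendsto (fun y : ℝ => cn y (0 : Fin m → ℝ)) (𝓝 0) (𝓝 0) := by
      rw [tendsto_pi_nhds]
      intro i
      refine Fin.cases ?_ (fun i => ?_) i
      · exact tendsto_id
      · simp
    refine hei (poly_shift (D := d+1) s hs (fun i => e i 0) (u 0) c hu0 (fun y => k (d+1) (cn y 0)) ?_ ?_ i0 hi0)
    · have h2 : ContinuousAt (k (d+1)) (cn 0 (0 : Fin m → ℝ)) := by simpa using (hkq (d+1)).continuousAt
      have h3 : ContinuousAt (fun y : ℝ => cn y (0 : Fin m → ℝ)) 0 := by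
        unfold ContinuousAt; simpa using hline
      exact h2.comp_of_eq h3 rfl
    · filter_upwards [hline.eventually h1] with y hy
      rw [Finset.sum_eq_zero (fun i hi => by
        have := Finset.mem_range.1 hi
        simp [hkz i (by omega)])] at hy
      simpa [hg, hψ, mon_at_zero α hα] using hy
  have hp1 : QAt M (fun z => p z * mon α z ^ (d+1)) 0 := hp.mul hM ((QAt.mon hM α 0).pow hM _)
  have hp10 : ¬ (fun z => p z * mon α z ^ (d+1)) =ᶠ[𝓝 0] 0 := by
    intro h0
    rcases QAt.domain hM hp ((QAt.mon hM α 0).pow hM (d+1)) h0 with h1 | h1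
    · exact hp0 h1
    · exact not_germ_zero hUp.1 ((hUp.mon_ne hM α).mono fun x hx => pow_ne_zero _ hx) h1
  obtain ⟨V, χ, β, hV, hβ⟩ := ih _ (hU.lift hM hL) _ g hp1 hp10 hgq hj
  refine ⟨V, _, β, hV.comp hM hL, hβ.congr ?_⟩
  filter_upwards [hV.tendsto.eventually hgh] with x hx
  rw [hx]
  simp only [hψ, tl_cn]
  ring

lemma case2 (hM : Wt M) {D : ℕ} {U : Ultrafilter (Fin (m+1) → ℝ)} (hU : Reduced M U)
    {p : (Fin m → ℝ) → ℝ} {h u : (Fin (m+1) → ℝ) → ℝ} {β : Fin m → ℕ} (hp : MonoExp M p β)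
    (hu : QAt M u 0) (hu0 : u 0 ≠ 0) (s : Finset ℕ) (hs : ∀ i ∈ s, i < D)
    (α : Fin m → ℕ) (e : ℕ → (Fin m → ℝ) → ℝ) (he : ∀ i ∈ s, QAt M (e i) 0)
    (hh : h =ᶠ[𝓝 0] fun x => ∑ i ∈ s, mon α (tl x) ^ (D - i) * e i (tl x) * x 0 ^ i + x 0 ^ D * u x)
    (hc : Tendsto (fun x : Fin (m+1) → ℝ => mon α (tl x) / x 0) U (𝓝 0)) :
    ∃ (V : Ultrafilter (Fin (m+1) → ℝ)) (ψ : (Fin (m+1) → ℝ) → (Fin (m+1) → ℝ)) (α : Fin (m+1) → ℕ),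
    Lift M V U ψ ∧ MonoExp M (fun x => p (tl (ψ x)) * h (ψ x)) α := by
  obtain ⟨δ0, hδ0⟩ : ∃ δ, δ = (Pi.single 0 1 : Fin (m+1) → ℕ) := ⟨_, rfl⟩
  obtain ⟨γ0, hγ0⟩ : ∃ γ, γ = (∑ k, α k • (Pi.single k.succ 1 : Fin (m+1) → ℕ)) := ⟨_, rfl⟩
  obtain ⟨V, ψ, A, hV, hcmp⟩ := toric hM _ U hU δ0 γ0 le_rfl
  have hVr := hU.lift hM hV.toLift
  have hy : MonoExp M (fun x => ψ x 0) (pull A δ0) := by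
    rw [hδ0]; exact (MonoExp.coord hM 0).comp hM hV.mono hV.z
  have ht : MonoExp M (fun x => mon α (tl (ψ x))) (pull A γ0) := by
    rw [hγ0]
    exact (MonoExp.comp hM (MonoExp.of_mon hM (α := α)) (monoMap_tl hM) tl_zero).comp hM hV.mono hV.z
  obtain ⟨β', hβ'⟩ : ∃ β', MonoExp M (fun x => p (tl (ψ x))) β' := by
    obtain ⟨β1, h1⟩ := hp.tl hM
    exact ⟨_, h1.comp hM hV.mono hV.z⟩
  generalize pull A δ0 = δ at hy hcmp
  generalize pull A γ0 = γ at ht hcmp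
  have hyne := hy.ne hM hVr
  have htne := ht.ne hM hVr
  obtain ⟨v, hv, hv0, hyv⟩ := hy
  obtain ⟨w, hw, hw0, htw⟩ := ht
  have hc' : Tendsto (fun x => mon α (tl (ψ x)) / ψ x 0) V (𝓝 0) := by
    rw [← hV.map] at hc
    exact hc
  have hnot : ¬ γ ≤ δ := by
    intro hle
    have h1 : Tendsto (fun x => mon (δ - γ) x * v x / w x) V (𝓝 (mon (δ - γ) 0 * v 0 / w 0)) :=
      ((((QAt.mon hM (δ - γ) 0).continuousAt.mul hv.continuousAt).div hw.continuousAt hw0).tendsto).mono_left hVr.1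
    have h2 := hc'.mul h1
    rw [zero_mul] at h2
    have h3 : Tendsto (fun _ : Fin (m+1) → ℝ => (1:ℝ)) V (𝓝 0) := by
      refine h2.congr' ?_
      filter_upwards [hyne, htne, hVr.1 hyv, hVr.1 htw] with x h4 h5 h6 h7
      have h8 : mon δ x = mon γ x * mon (δ - γ) x := by rw [← mon_add, add_tsub_cancel_of_le hle]
      rw [h6] at h4 ⊢
      rw [h7] at h5 ⊢
      rw [h8] at h4 ⊢
      have a1 := left_ne_zero_of_mul h5
      have a2 := right_ne_zero_of_mul h5
      have a3 := right_ne_zero_of_mul h4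
      have a4 := right_ne_zero_of_mul (left_ne_zero_of_mul h4)
      field_simp
    have := tendsto_nhds_unique h3 tendsto_const_nhds
    exact zero_ne_one this
  have hle : δ ≤ γ := hcmp.resolve_right hnot
  have hne : γ - δ ≠ 0 := fun h0 => hnot (tsub_eq_zero_iff_le.1 h0)
  have hbr : MonoExp M (fun x => v x ^ D * u (ψ x) +
      ∑ i ∈ s, mon (γ - δ) x ^ (D - i) * (w x ^ (D - i) * v x ^ i * e i (tl (ψ x)))) 0 := by
    refine MonoExp.of_unit (QAt.add hM ((hv.pow hM D).mul hM (hu.comp0 hM hV.q hV.z))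
      (QAt.finset_sum hM s fun i hi => ?_)) ?_
    · exact ((QAt.mon hM _ 0).pow hM _).mul hM (((hw.pow hM _).mul hM (hv.pow hM _)).mul hM
        ((he i hi).comp0 hM ((QAt.tl hM 0).comp0 hM hV.q hV.z) (by rw [hV.z]; rfl)))
    · rw [Finset.sum_eq_zero, add_zero, hV.z]
      · exact mul_ne_zero (pow_ne_zero _ hv0) hu0
      · intro i hi
        have := hs i hi
        rw [mon_at_zero _ hne, zero_pow (by omega), zero_mul]
  refine ⟨V, ψ, _, hV.toLift, (hβ'.mul hM (((MonoExp.of_mon hM (α := δ)).pow hM D).mul hM hbr)).congr ?_⟩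
  filter_upwards [hV.toLift.tendsto.eventually hh, hyv, htw] with x h1 h2 h3
  rw [h1]
  congr 1
  have h8 : mon γ x = mon δ x * mon (γ - δ) x := by rw [← mon_add, add_tsub_cancel_of_le hle]
  rw [h2, h3, h8, mul_add, add_comm, Finset.mul_sum]
  congr 1
  · rw [mul_pow]; ring
  · refine Finset.sum_congr rfl fun i hi => ?_
    have := hs i hi
    have h9 : mon δ x ^ D = mon δ x ^ (D-i) * mon δ x ^ i := by
      rw [← pow_add]; congr 1; omega
    rw [h9, mul_pow, mul_pow, mul_pow]; ring

lemma RD_zero (hM : Wt M) (ml : ML M m) : RD M m 0 := by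
  intro U hU p h hp hp0 hh ⟨j, hj, hjn⟩
  obtain rfl : j = 0 := by omega
  exact Rmon hM ml hU hp hp0 0 hh hjn (Eventually.of_forall fun x => by simp)

lemma RD_succ (hM : Wt M) (ml : ML M m) (d : ℕ) (ih : RD M m d) : RD M m (d+1) := by
  classical
  intro U hU p h hp hp0 hh ⟨j, hj, hjn⟩
  by_cases hex : ∃ j ≤ d, (dv (e0 m))^[j] h 0 ≠ 0
  · exact ih U hU p h hp hp0 hh hex
  push Not at hex
  have hjd : j = d + 1 := by
    by_contra hne
    exact hjn (hex j (by omega))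
  subst hjd
  obtain ⟨θ, hθ, hθ0, hθz⟩ := implicit hM (hh.dv_iter hM (e0 m) d) (hex d le_rfl)
    (by rwa [Function.iterate_succ_apply'] at hjn)
  have hθt : QAt M (fun x : Fin (m+1) → ℝ => θ (tl x)) 0 := hθ.comp0 hM (QAt.tl hM 0) tl_zero
  have hL1 : Lift M (U.map fun x => cn (x 0 - θ (tl x)) (tl x)) U (sh θ) := by
    refine Lift.of_section _ (QAt.sh hM hθ) (sh_at_zero hθ0) ?_ ?_
    · have h1 : QAt M (fun x : Fin (m+1) → ℝ => cn (x 0 - θ (tl x)) (tl x)) 0 :=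
        QAt.cn hM ((QAt.coord hM 0 0).sub hM hθt) (QAt.tl hM 0)
      have h2 := h1.continuousAt.tendsto
      simp only [tl_zero, hθ0, Pi.zero_apply, sub_zero, cn_zero_zero] at h2
      exact h2.mono_left hU.1
    · exact Eventually.of_forall fun x => by simp [sh]
  set U1 := U.map fun x => cn (x 0 - θ (tl x)) (tl x) with hU1
  have hU1r : Reduced M U1 := hU.lift hM hL1
  set h1 : (Fin (m+1) → ℝ) → ℝ := fun x => h (sh θ x) with hh1
  have hh1q : QAt M h1 0 := hh.comp0 hM hL1.q hL1.z
  obtain ⟨k, hk0, hkq, hk⟩ := hadamard_seq hM hh1q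
  have hkd : ∀ i, ∀ᶠ z in 𝓝 (0 : Fin m → ℝ), (dv (e0 m))^[i] h (cn (θ z) z) = i ! * k i (cn 0 z) := by
    intro i
    have a1 := hadamard_deriv hM hkq hk i 0
    rw [hk0] at a1
    filter_upwards [a1, tendsto_inc.eventually (dv_sh hM hθ hθ0 hh i)] with z b1 b2
    rw [b2, zero_add] at b1
    rw [← b1]
    simp [sh]
  have hkz : ∀ i ≤ d, k i 0 = 0 := by
    intro i hi
    have a1 := (hkd i).self_of_nhds
    rw [hθ0, cn_zero_zero, hex i hi] at a1
    have h2 : (i ! : ℝ) ≠ 0 := by positivity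
    simpa [h2] using a1.symm
  have hkD : k (d+1) 0 ≠ 0 := by
    intro h0
    have a1 := (hkd (d+1)).self_of_nhds
    rw [hθ0, cn_zero_zero, h0, mul_zero] at a1
    exact hjn a1
  have hklast : (fun z => k d (cn 0 z)) =ᶠ[𝓝 0] 0 := by
    filter_upwards [hkd d, hθz] with z a1 a2
    rw [a2] at a1
    have h2 : (d ! : ℝ) ≠ 0 := by positivity
    simpa [h2] using a1.symm
  have hsum := hadamard_sum hk0 hk (d+1)
  set c : ℕ → (Fin m → ℝ) → ℝ := fun i z => k i (cn 0 z) with hcdef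
  have hcq : ∀ i, QAt M (c i) 0 := fun i =>
    (hkq i).comp0 hM (QAt.cn hM (QAt.const hM 0 0) (QAt.id hM 0)) cn_zero_zero
  set s : Finset ℕ := (Finset.range (d+1)).filter fun i => ¬ c i =ᶠ[𝓝 0] 0 with hsdef
  have hs : ∀ i ∈ s, i + 1 < d + 1 := by
    intro i hi
    rw [hsdef, Finset.mem_filter, Finset.mem_range] at hi
    rcases eq_or_ne i d with rfl | hne
    · exact absurd hklast hi.2
    · omega
  have hsum' : h1 =ᶠ[𝓝 0] fun x => ∑ i ∈ s, c i (tl x) * x 0 ^ i + x 0 ^ (d+1) * k (d+1) x := by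
    have hz : ∀ᶠ x in 𝓝 (0 : Fin (m+1) → ℝ), ∀ i ∈ Finset.range (d+1), i ∉ s → c i (tl x) = 0 := by
      rw [Filter.eventually_all_finset]
      intro i hi
      by_cases his : i ∈ s
      · exact Eventually.of_forall fun x hx => absurd his hx
      · have : c i =ᶠ[𝓝 0] 0 := by
          by_contra hcon
          exact his (by rw [hsdef, Finset.mem_filter]; exact ⟨hi, hcon⟩)
        exact (tendsto_tl.eventually this).mono fun x hx _ => hx
    filter_upwards [hsum, hz] with x a1 a2
    rw [a1]
    congr 1
    symm
    refine Finset.sum_subset (Finset.filter_subset _ _) fun i hi his => ?_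
    rw [a2 i hi his, zero_mul]
  -- it is enough to handle h1 on U1
  suffices hsuff : ∃ (V : Ultrafilter (Fin (m+1) → ℝ)) (ψ : (Fin (m+1) → ℝ) → (Fin (m+1) → ℝ)) (α : Fin (m+1) → ℕ),
    Lift M V U1 ψ ∧ MonoExp M (fun x => p (tl (ψ x)) * h1 (ψ x)) α by
    obtain ⟨V, ψ, α, hV, hm⟩ := hsuff
    exact ⟨V, _, α, hV.comp hM hL1, hm⟩
  rcases s.eq_empty_or_nonempty with hse | hsne
  · refine Rmon hM ml hU1r hp hp0 (d+1) (hkq (d+1)) hkD (hsum'.mono fun x hx => ?_)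
    rw [hx, hse]; simp
  obtain ⟨V', ψ, hV', ⟨β, hβ⟩, α, e, he, i0, hi0, hei⟩ := base hM ml (hU1r.proj hM) hp hp0 (d+1) s hsne
    (fun i hi => by have := hs i hi; omega) c hcq
    (fun i hi => by rw [hsdef, Finset.mem_filter] at hi; exact hi.2)
  obtain ⟨W, hW, hWV⟩ := hV'.ext hM hU1r.1
  have hWr := hU1r.lift hM hW
  have hα : α ≠ 0 := by
    rintro rfl
    have a1 := (he i0 hi0).2.self_of_nhds
    have := hs i0 hi0
    simp only [mon_zero, one_pow, one_mul, hV'.z] at a1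
    rw [← a1] at hei
    apply hei
    simp only [hcdef, cn_zero_zero]
    exact hkz i0 (by omega)
  have hrep : (fun x => h1 (QDCP.ext ψ x)) =ᶠ[𝓝 0] fun x => ∑ i ∈ s, mon α (tl x) ^ (d + 1 - i) * e i (tl x) * x 0 ^ i
      + x 0 ^ (d+1) * k (d+1) (QDCP.ext ψ x) := by
    have hall : ∀ᶠ x in 𝓝 (0 : Fin (m+1) → ℝ), ∀ i ∈ s, c i (ψ (tl x)) = mon α (tl x) ^ (d+1-i) * e i (tl x) := by
      rw [Filter.eventually_all_finset]
      intro i hi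
      exact tendsto_tl.eventually (he i hi).2
    filter_upwards [hW.tendsto.eventually hsum', hall] with x a1 a2
    rw [a1]
    congr 1
    refine Finset.sum_congr rfl fun i hi => ?_
    rw [← a2 i hi]
    simp [QDCP.ext]
  have hp1 : QAt M (fun z => p (ψ z)) 0 := hp.comp0 hM hV'.q hV'.z
  have hp10 : ¬ (fun z => p (ψ z)) =ᶠ[𝓝 0] 0 :=
    not_germ_zero hV'.n (hβ.ne hM ((hU1r.proj hM).lift hM hV'))
  have huq : QAt M (fun x => k (d+1) (QDCP.ext ψ x)) 0 := (hkq (d+1)).comp0 hM hW.q hW.z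
  have hu0 : k (d+1) (QDCP.ext ψ 0) ≠ 0 := by rw [hW.z]; exact hkD
  suffices hsuff : ∃ (V : Ultrafilter (Fin (m+1) → ℝ)) (χ : (Fin (m+1) → ℝ) → (Fin (m+1) → ℝ)) (α : Fin (m+1) → ℕ),
    Lift M V W χ ∧ MonoExp M (fun x => p (ψ (tl (χ x))) * h1 (QDCP.ext ψ (χ x))) α by
    obtain ⟨V, χ, α, hV, hm⟩ := hsuff
    exact ⟨V, _, α, hV.comp hM hW, hm⟩
  rcases dichotomy W (fun x => x 0) (fun x => mon α (tl x)) with ⟨c, hc⟩ | ⟨-, hc⟩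
  · exact case1 hM ih hWr hp1 hp10 huq hu0 s hs α hα e (fun i hi => (he i hi).1) i0 hi0 hei hrep c hc
  · exact case2 hM hWr hβ huq hu0 s (fun i hi => by have := hs i hi; omega) α e (fun i hi => (he i hi).1) hrep hc

lemma RD_all (hM : Wt M) (ml : ML M m) (d : ℕ) : RD M m d := by
  induction d with
  | zero => exact RD_zero hM ml
  | succ d ih => exact RD_succ hM ml d ih
end ml2
end QDCP

namespace QDCP
open Filter Topology Set
open scoped ContDiff Nat

section ml3
variable {M : ℕ → ℝ} {m : ℕ}

lemma dv_equiv {E : Type*} [NormedAddCommGroup E] [NormedSpace ℝ E] (L : E ≃L[ℝ] E) (v : E) (f : E → ℝ) (k : ℕ) :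
    (dv v)^[k] (fun x => f (L x)) = fun x => (dv (L v))^[k] f (L x) := by
  induction k with
  | zero => rfl
  | succ k ih =>
    rw [Function.iterate_succ_apply', ih, Function.iterate_succ_apply']
    ext x
    change fderiv ℝ ((dv (L v))^[k] f ∘ L) x v = fderiv ℝ ((dv (L v))^[k] f) (L x) (L v)
    rw [L.comp_right_fderiv]; rfl

theorem ML_all (hM : Wt M) : ∀ m, ML M m := by
  intro m
  induction m with
  | zero =>
    intro U hU f hf hf0
    have h0 : f 0 ≠ 0 := by
      intro h
      exact hf0 (Eventually.of_forall fun x => by rw [Subsingleton.elim x 0, h]; rfl)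
    exact ⟨U, _, 0, Lift.refl hM hU.1, MonoExp.of_unit hf h0⟩
  | succ m ml =>
    intro U hU f hf hf0
    have he0 : e0 m ≠ 0 := fun h => by
      have := congrFun h 0
      simp [e0] at this
    obtain ⟨v, k, hv, hk⟩ : ∃ v k, v ≠ 0 ∧ (dv v)^[k] f 0 ≠ 0 := by
      obtain ⟨v, k, hk⟩ := hf.exists_dir hM hf0
      have h1 := (dv_iter_eq v (hf.eventually.mono fun x hx => hx.contDiffAt) k).self_of_nhds
      rcases eq_or_ne k 0 with rfl | hk0
      · refine ⟨e0 m, 0, he0, ?_⟩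
        intro h2
        exact hk (h1.symm.trans h2)
      · refine ⟨v, k, ?_, by rw [h1]; exact hk⟩
        rintro rfl
        have : Nonempty (Fin k) := ⟨⟨0, by omega⟩⟩
        exact hk ((iteratedFDeriv ℝ k f 0).map_zero)
    obtain ⟨L, hL⟩ := SeparatingDual.exists_continuousLinearEquiv_apply_eq (R := ℝ) he0 hv
    have hLift : Lift M (U.map L.symm) U L := by
      refine Lift.of_section _ (QAt.clm hM (L : (Fin (m+1) → ℝ) →L[ℝ] (Fin (m+1) → ℝ)) 0) (map_zero L) ?_ ?_
      · have := L.symm.continuous.tendsto 0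
        rw [map_zero] at this
        exact this.mono_left hU.1
      · exact Eventually.of_forall fun x => L.apply_symm_apply x
    have hq : QAt M (fun x => f (L x)) 0 := hf.comp0 hM hLift.q hLift.z
    obtain ⟨V, ψ, α, hV, hm⟩ := RD_all hM ml k _ (hU.lift hM hLift) (fun _ => 1) (fun x => f (L x))
      (QAt.const hM 1 0) (fun h => one_ne_zero h.self_of_nhds) hq ⟨k, le_rfl, by
        rw [dv_equiv, hL]; simpa using hk⟩
    refine ⟨V, _, α, hV.comp hM hLift, ?_⟩
    simpa using hm

lemma exists_reduced (hM : Wt M) {n : ℕ} (U : Ultrafilter (Fin n → ℝ)) (hU : (U : Filter (Fin n → ℝ)) ≤ 𝓝 0) :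
    ∃ (m : ℕ) (V : Ultrafilter (Fin m → ℝ)) (ψ : (Fin m → ℝ) → (Fin n → ℝ)), Lift M V U ψ ∧ Reduced M V := by
  classical
  have hex : ∃ (m : ℕ) (V : Ultrafilter (Fin m → ℝ)) (ψ : (Fin m → ℝ) → (Fin n → ℝ)), Lift M V U ψ :=
    ⟨n, U, _, Lift.refl hM hU⟩
  obtain ⟨V, ψ, h⟩ := Nat.find_spec hex
  refine ⟨_, V, ψ, h, h.n, fun m' hm' W χ hW => ?_⟩
  exact Nat.find_min hex hm' ⟨W, _, hW.comp hM h⟩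

/-- the key geometric consequence -/
theorem key (hM : Wt M) {n : ℕ} {ι : Type*} (f : ι → (Fin n → ℝ) → ℝ) (g : (Fin n → ℝ) → ℝ)
    (hf : ∀ i, QAt M (f i) 0) (hg : QAt M g 0)
    (hfg : ∀ k : ℕ, ∃ (s : Finset ι) (q : ι → (Fin n → ℝ) → ℝ),
      (fun x => g x - ∑ i ∈ s, q i x * f i x) =O[𝓝 0] fun x => ‖x‖ ^ k)
    (U : Ultrafilter (Fin n → ℝ)) (hU : (U : Filter (Fin n → ℝ)) ≤ 𝓝 0)
    (hz : ∀ i, ∀ᶠ x in U, f i x = 0) : ∀ᶠ x in U, g x = 0 := by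
  obtain ⟨m, V, ψ, hV, hVr⟩ := exists_reduced hM U hU
  have hfz : ∀ i, (fun x => f i (ψ x)) =ᶠ[𝓝 0] 0 := by
    intro i
    by_contra hcon
    have h1 := (ML_all hM m).ne hM hVr ((hf i).comp0 hM hV.q hV.z) hcon
    have h2 := hV.ev.2 (hz i)
    obtain ⟨x, h3, h4⟩ := (h1.and h2).exists
    exact h3 h4
  have hψO : ψ =O[𝓝 0] fun x => x := by
    have := hV.q.differentiableAt.isBigO_sub
    simpa [hV.z] using this
  have hgz : (fun x => g (ψ x)) =ᶠ[𝓝 0] 0 := by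
    refine QAt.zero_of_flat hM (hg.comp0 hM hV.q hV.z) fun k => ?_
    obtain ⟨s, q, hO⟩ := hfg k
    have h1 := hO.comp_tendsto hV.tendsto
    have h2 : ((fun x => ‖x‖ ^ k) ∘ ψ) =O[𝓝 0] fun x => ‖x - 0‖ ^ k := by
      simp only [sub_zero]
      exact hψO.norm_norm.pow k
    refine (h1.trans h2).congr' ?_ EventuallyEq.rfl
    have h3 : ∀ᶠ x in 𝓝 (0 : Fin m → ℝ), ∀ i ∈ s, f i (ψ x) = 0 := by
      rw [Filter.eventually_all_finset]; exact fun i _ => hfz i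
    filter_upwards [h3] with x hx
    simp only [Function.comp]
    rw [Finset.sum_eq_zero fun i hi => by rw [hx i hi, mul_zero], sub_zero]
  exact hV.ev.1 (hV.n hgz)
end ml3
end QDCP

namespace QDCP
open Filter Topology Set
open scoped ContDiff Nat
open QDC

section conv

lemma exists_wt {M : ℕ → ℝ} (h : IsDCSeq M) : ∃ (M' : ℕ → ℝ) (c ρ : ℝ), Wt M' ∧ 0 < c ∧ 0 < ρ ∧ ∀ k, M k = c * ρ ^ k * M' k := by
  obtain ⟨hpos, hlc, ⟨C, hC⟩, hdiv⟩ := h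
  have h0 := hpos 0
  have h1 := hpos 1
  set ρ := M 1 / M 0 with hρ
  have hρ0 : 0 < ρ := by positivity
  have hr : ∀ k, M (k+1) / (M 0 * ρ ^ (k+1)) / (M k / (M 0 * ρ ^ k)) = M (k+1) / M k / ρ := by
    intro k
    have := hpos k
    have := hpos (k+1)
    field_simp
    ring
  refine ⟨fun k => M k / (M 0 * ρ ^ k), M 0, ρ, ⟨?_, ?_, ?_, ?_, ?_, ?_⟩, h0, hρ0, ?_⟩
  · simp [h0.ne']
  · simp only [hρ]; field_simp
  · intro k; have := hpos k; positivity
  · intro k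
    rw [hr, hr]
    have := hlc k
    gcongr
  · have hC1 : (1:ℝ) ≤ max C 1 := le_max_right _ _
    have hC2 : (1:ℝ) ≤ max ρ⁻¹ 1 := le_max_right _ _
    refine ⟨max C 1 * max ρ⁻¹ 1, one_le_mul_of_one_le_of_one_le hC1 hC2, fun k => ?_⟩
    have hMk := hpos k
    have hMk' : 0 < M k / (M 0 * ρ ^ k) := by positivity
    rw [← div_le_iff₀ hMk', hr]
    rcases Nat.eq_zero_or_pos k with rfl | hk
    · simp only [zero_add, pow_zero, ← hρ]
      rw [div_self hρ0.ne']
    · have hq : 0 < M (k+1) / M k := div_pos (hpos _) hMk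
      have hkk : (0:ℝ) < k := by exact_mod_cast hk
      have h2 := hC k hk
      have h3 : M (k+1) / M k ≤ (max C 1) ^ k := by
        have h4 : ((M (k+1) / M k) ^ ((1:ℝ)/k)) ^ k = M (k+1) / M k := by
          rw [← Real.rpow_natCast, ← Real.rpow_mul hq.le, one_div, inv_mul_cancel₀ hkk.ne', Real.rpow_one]
        rw [← h4]
        exact pow_le_pow_left₀ (Real.rpow_nonneg hq.le _) (h2.trans (le_max_left _ _)) k
      rw [div_eq_mul_inv, mul_pow]
      have h5 : ρ⁻¹ ≤ (max ρ⁻¹ 1) ^ k := (le_max_left _ _).trans (le_self_pow₀ hC2 (by omega))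
      have h6 : 0 ≤ ρ⁻¹ := by positivity
      gcongr
  · intro hs
    apply hdiv
    have := hs.mul_left ρ⁻¹
    refine this.congr fun k => ?_
    have := hpos k
    have := hpos (k+1)
    field_simp
    ring
  · intro k
    field_simp

variable {n : ℕ}

noncomputable def pdl (l : List (Fin n)) (f : (Fin n → ℝ) → ℝ) : (Fin n → ℝ) → ℝ := l.foldr pd f

variable {V : Set (Fin n → ℝ)} {f : (Fin n → ℝ) → ℝ}

lemma pd_smooth (i : Fin n) (hf : ∀ x ∈ V, ContDiffAt ℝ ∞ f x) : ∀ x ∈ V, ContDiffAt ℝ ∞ (pd i f) x := by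
  intro x hx
  exact ((hf x hx).fderiv_right (m := ∞) (by simp)).clm_apply contDiffAt_const

lemma pdl_smooth (hf : ∀ x ∈ V, ContDiffAt ℝ ∞ f x) (l : List (Fin n)) :
    ∀ x ∈ V, ContDiffAt ℝ ∞ (pdl l f) x := by
  induction l with
  | nil => exact hf
  | cons i l ih => exact pd_smooth i ih

lemma pd_congr (hV : IsOpen V) (i : Fin n) {g : (Fin n → ℝ) → ℝ} (h : ∀ x ∈ V, f x = g x) : ∀ x ∈ V, pd i f x = pd i g x := by
  intro x hx
  have : f =ᶠ[𝓝 x] g := by filter_upwards [hV.mem_nhds hx] with y hy using h y hy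
  unfold pd
  rw [this.fderiv_eq]

lemma pd_comm (hf : ∀ x ∈ V, ContDiffAt ℝ ∞ f x) (i j : Fin n) : ∀ x ∈ V, pd i (pd j f) x = pd j (pd i f) x := by
  intro x hx
  have hd : DifferentiableAt ℝ (fderiv ℝ f) x :=
    ((hf x hx).fderiv_right (m := ∞) (by simp)).differentiableAt (by simp)
  have key : ∀ i j : Fin n, pd i (pd j f) x = fderiv ℝ (fderiv ℝ f) x (Pi.single i 1) (Pi.single j 1) := by
    intro i j
    unfold pd
    rw [fderiv_clm_apply hd (differentiableAt_const _)]
    simp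
  rw [key, key]
  exact ((hf x hx).isSymmSndFDerivAt (by simp only [minSmoothness_of_isRCLikeNormedField]; exact WithTop.coe_le_coe.2 (le_top : (2:ℕ∞) ≤ ⊤))) _ _

lemma pdl_perm (hV : IsOpen V) (hf : ∀ x ∈ V, ContDiffAt ℝ ∞ f x) {l l' : List (Fin n)} (h : l.Perm l') :
    ∀ x ∈ V, pdl l f x = pdl l' f x := by
  induction h with
  | nil => intro x _; rfl
  | cons i _ ih => exact pd_congr hV i ih
  | swap i j l => exact pd_comm (pdl_smooth hf l) _ _
  | trans _ _ h1 h2 => intro x hx; rw [h1 x hx, h2 x hx]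

lemma pdl_append (l l' : List (Fin n)) : pdl (l ++ l') f = pdl l (pdl l' f) := by
  simp [pdl, List.foldr_append]

lemma pdl_replicate (k : ℕ) (i : Fin n) : pdl (List.replicate k i) f = (pd i)^[k] f := by
  induction k with
  | zero => rfl
  | succ k ih => rw [List.replicate_succ, Function.iterate_succ_apply', ← ih]; rfl

lemma mpd_aux (α : Fin n → ℕ) (l : List (Fin n)) :
    l.foldr (fun i g => (pd i)^[α i] g) f = pdl (l.flatMap fun i => List.replicate (α i) i) f := by
  induction l with
  | nil => rfl
  | cons i l ih => rw [List.foldr_cons, ih, List.flatMap_cons, pdl_append, pdl_replicate]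

lemma mpd_eq (hV : IsOpen V) (hf : ∀ x ∈ V, ContDiffAt ℝ ∞ f x) (l : List (Fin n)) :
    ∀ x ∈ V, mpd (fun i => l.count i) f x = pdl l f x := by
  intro x hx
  unfold mpd
  rw [mpd_aux]
  refine pdl_perm hV hf ?_ x hx
  rw [List.perm_iff_count]
  intro i
  rw [List.count_flatMap]
  have h1 : (List.map (List.count i ∘ fun j => List.replicate (List.count j l) j) (Finset.univ : Finset (Fin n)).toList).sum
    = ∑ j : Fin n, (List.count i (List.replicate (List.count j l) j)) := by
    rw [← Finset.sum_map_toList]; rfl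
  rw [h1, Finset.sum_eq_single i]
  · simp
  · intro j _ hj
    rw [List.count_replicate]; simp [hj]
  · simp

lemma iter_eq (hV : IsOpen V) (hf : ∀ x ∈ V, ContDiffAt ℝ ∞ f x) (k : ℕ) : ∀ (s : Fin k → Fin n), ∀ x ∈ V,
    iteratedFDeriv ℝ k f x (fun j => Pi.single (s j) 1) = pdl (List.ofFn s) f x := by
  induction k with
  | zero => intro s x hx; simp [pdl]
  | succ k ih =>
    intro s x hx
    rw [iteratedFDeriv_succ_apply_left, List.ofFn_succ]
    have h1 : ∀ y ∈ V, iteratedFDeriv ℝ k f y (fun j => Pi.single (s j.succ) 1) = pdl (List.ofFn fun j => s j.succ) f y :=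
      ih fun j => s j.succ
    have hd : DifferentiableAt ℝ (iteratedFDeriv ℝ k f) x :=
      (hf x hx).differentiableAt_iteratedFDeriv (by exact_mod_cast ENat.natCast_lt_top k)
    have h2 := pd_congr hV (s 0) h1 x hx
    change _ = pd (s 0) (pdl (List.ofFn fun j => s j.succ) f) x
    rw [← h2]
    unfold pd
    have h3 : HasFDerivAt (fun y => iteratedFDeriv ℝ k f y (fun j => Pi.single (s j.succ) 1))
      ((ContinuousMultilinearMap.apply ℝ (fun _ : Fin k => Fin n → ℝ) ℝ (fun j => Pi.single (s j.succ) 1)).comp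
        (fderiv ℝ (iteratedFDeriv ℝ k f) x)) x :=
      (ContinuousMultilinearMap.apply ℝ (fun _ : Fin k => Fin n → ℝ) ℝ
        (fun j => Pi.single (s j.succ) 1)).hasFDerivAt.comp x hd.hasFDerivAt
    rw [h3.fderiv]
    rfl

lemma opNorm_le_basis {k : ℕ} (T : ContinuousMultilinearMap ℝ (fun _ : Fin k => Fin n → ℝ) ℝ) (C : ℝ) (hC0 : 0 ≤ C)
    (hC : ∀ s : Fin k → Fin n, |T (fun j => Pi.single (s j) 1)| ≤ C) : ‖T‖ ≤ (n:ℝ) ^ k * C := by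
  refine ContinuousMultilinearMap.opNorm_le_bound (by positivity) fun v => ?_
  have h1 : T v = ∑ s : Fin k → Fin n, (∏ j, v j (s j)) * T (fun j => Pi.single (s j) 1) := by
    have h2 : v = fun j => ∑ i, (v j i) • (Pi.single i 1 : Fin n → ℝ) := by
      ext j i
      simp [Finset.sum_apply, Pi.single_apply]
    conv_lhs => rw [h2]
    rw [ContinuousMultilinearMap.map_sum]
    refine Finset.sum_congr rfl fun s _ => ?_
    have := T.map_smul_univ (fun j => v j (s j)) (fun j => (Pi.single (s j) 1 : Fin n → ℝ))
    rw [this, smul_eq_mul]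
  rw [h1, Real.norm_eq_abs]
  calc |∑ s : Fin k → Fin n, (∏ j, v j (s j)) * T (fun j => Pi.single (s j) 1)|
      ≤ ∑ s : Fin k → Fin n, |(∏ j, v j (s j)) * T (fun j => Pi.single (s j) 1)| := Finset.abs_sum_le_sum_abs _ _
    _ ≤ ∑ s : Fin k → Fin n, (∏ j, ‖v j‖) * C := by
      refine Finset.sum_le_sum fun s _ => ?_
      rw [abs_mul, Finset.abs_prod]
      have h3 : ∏ j, |v j (s j)| ≤ ∏ j, ‖v j‖ :=
        Finset.prod_le_prod (fun _ _ => abs_nonneg _) fun j _ => norm_le_pi_norm (v j) (s j)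
      exact mul_le_mul h3 (hC s) (abs_nonneg _) (Finset.prod_nonneg fun _ _ => norm_nonneg _)
    _ = (n:ℝ) ^ k * C * ∏ j, ‖v j‖ := by
      simp; ring

lemma MemDC.qat {M M' : ℕ → ℝ} {c ρ : ℝ} (hc : 0 < c) (hρ : 0 < ρ) (hMp : ∀ k, 0 < M k) (hMM : ∀ k, M k = c * ρ ^ k * M' k)
    (hV : IsOpen V) {a : Fin n → ℝ} (ha : a ∈ V) (h : MemDC M V f) : QAt M' f a := by
  obtain ⟨hs, hb⟩ := h
  have hf : ∀ x ∈ V, ContDiffAt ℝ ∞ f x := fun x hx => hs.contDiffAt (hV.mem_nhds hx)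
  obtain ⟨r, hr, hrV⟩ := Metric.nhds_basis_closedBall.mem_iff.1 (hV.mem_nhds ha)
  obtain ⟨A, B, hA, hB, hAB⟩ := hb _ hrV (isCompact_closedBall a r)
  refine ⟨A * c, (n + 1) * B * ρ, by positivity, by positivity, ?_⟩
  filter_upwards [Metric.closedBall_mem_nhds a hr] with x hx
  refine ⟨hf x (hrV hx), fun k => ?_⟩
  have hMk := hMp k
  have h1 := opNorm_le_basis (iteratedFDeriv ℝ k f x) (A * B ^ k * k ! * M k) (by positivity) (fun s => by
    rw [iter_eq hV hf k s x (hrV hx), ← mpd_eq hV hf _ x (hrV hx)]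
    have h2 := hAB x hx fun i => (List.ofFn s).count i
    have h3 : mdeg (fun i => (List.ofFn s).count i) = k := by
      have := Multiset.sum_count_eq_card (s := Finset.univ) (m := (List.ofFn s : Multiset (Fin n))) (fun a _ => Finset.mem_univ a)
      simpa [mdeg] using this
    have h4 : (mfact fun i => (List.ofFn s).count i) ≤ k ! := by
      refine (Nat.le_of_dvd (Nat.factorial_pos _)
        (Nat.prod_factorial_dvd_factorial_sum Finset.univ fun i => (List.ofFn s).count i)).trans (le_of_eq ?_)
      exact congrArg Nat.factorial h3
    rw [h3] at h2
    refine h2.trans ?_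
    have h5 : ((mfact fun i => (List.ofFn s).count i : ℕ) : ℝ) ≤ (k ! : ℝ) := by exact_mod_cast h4
    gcongr)
  refine h1.trans ?_
  have h6 : (n:ℝ) ^ k ≤ (n+1:ℝ) ^ k := by gcongr; linarith
  calc (n:ℝ) ^ k * (A * B ^ k * k ! * M k) ≤ (n+1:ℝ) ^ k * (A * B ^ k * k ! * M k) := by gcongr
    _ = _ := by rw [hMM k, mul_pow, mul_pow]; ring

lemma QAt.translate {M : ℕ → ℝ} (hM : Wt M) {a : Fin n → ℝ} (h : QAt M f a) : QAt M (fun x => f (x + a)) 0 := by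
  have h1 : QAt M (fun x : Fin n → ℝ => x + a) 0 := (QAt.id hM 0).add hM (QAt.const hM a 0)
  have h2 : QAt M f (0 + a) := by rwa [zero_add]
  exact QAt.comp hM (g := fun x : Fin n → ℝ => x + a) h2 h1
end conv
end QDCP

namespace QDCP
open Filter Topology Set
open scoped ContDiff Nat
open QDC

section formal
variable {n : ℕ}

open MvPolynomial in
lemma poly_isBigO (p : MvPolynomial (Fin n) ℝ) (k : ℕ) (h : ∀ d : Fin n →₀ ℕ, d.degree < k → coeff d p = 0) :
    (fun x : Fin n → ℝ => eval x p) =O[𝓝 0] fun x => ‖x‖ ^ k := by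
  have h1 : (fun x : Fin n → ℝ => eval x p) = fun x => ∑ d ∈ p.support, coeff d p * ∏ i ∈ d.support, x i ^ d i := by
    ext x; exact eval_eq x p
  rw [h1]
  refine Asymptotics.IsBigO.fun_sum fun d hd => Asymptotics.IsBigO.const_mul_left ?_ _
  have hdk : k ≤ d.degree := by
    by_contra hcon
    exact (mem_support_iff.1 hd) (h d (by omega))
  refine Asymptotics.IsBigO.of_bound 1 ?_
  filter_upwards [Metric.ball_mem_nhds (0 : Fin n → ℝ) one_pos] with x hx
  rw [one_mul, norm_pow, norm_norm, norm_prod]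
  have hx1 : ‖x‖ ≤ 1 := by simpa using (mem_ball_zero_iff.1 hx).le
  calc ∏ i ∈ d.support, ‖x i ^ d i‖ ≤ ∏ i ∈ d.support, ‖x‖ ^ d i := by
        refine Finset.prod_le_prod (fun _ _ => norm_nonneg _) fun i _ => ?_
        rw [norm_pow]
        exact pow_le_pow_left₀ (norm_nonneg _) (norm_le_pi_norm x i) _
    _ = ‖x‖ ^ d.degree := by rw [Finset.prod_pow_eq_pow_sum]; rfl
    _ ≤ ‖x‖ ^ k := pow_le_pow_of_le_one (norm_nonneg _) hx1 hdk

/-- `F` is an asymptotic expansion of `f` at the origin -/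
def Asy (f : (Fin n → ℝ) → ℝ) (F : MvPowerSeries (Fin n) ℝ) : Prop :=
  ∀ k : ℕ, ∃ p : MvPolynomial (Fin n) ℝ,
    (∀ d : Fin n →₀ ℕ, d.degree < k → MvPolynomial.coeff d p = MvPowerSeries.coeff d F) ∧
    (fun x => f x - MvPolynomial.eval x p) =O[𝓝 0] fun x => ‖x‖ ^ k

lemma multilinear_poly {k : ℕ} (T : ContinuousMultilinearMap ℝ (fun _ : Fin k => Fin n → ℝ) ℝ) :
    ∃ p : MvPolynomial (Fin n) ℝ, p.IsHomogeneous k ∧ ∀ x : Fin n → ℝ, MvPolynomial.eval x p = T (fun _ => x) := by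
  refine ⟨∑ s : Fin k → Fin n, MvPolynomial.C (T (fun j => Pi.single (s j) 1)) * ∏ j, MvPolynomial.X (s j), ?_, ?_⟩
  · refine MvPolynomial.IsHomogeneous.sum _ _ _ fun s _ => ?_
    have h1 := MvPolynomial.IsHomogeneous.prod (R := ℝ) (Finset.univ : Finset (Fin k))
      (fun j => MvPolynomial.X (s j)) (fun _ => 1) (fun j _ => MvPolynomial.isHomogeneous_X ℝ (s j))
    have h2 := (MvPolynomial.isHomogeneous_C (Fin n) (T (fun j => Pi.single (s j) 1))).mul h1
    simpa using h2
  · intro x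
    have h2 : (fun _ : Fin k => x) = fun _ => ∑ i, (x i) • (Pi.single i 1 : Fin n → ℝ) := by
      ext j i
      simp [Finset.sum_apply, Pi.single_apply]
    rw [h2, ContinuousMultilinearMap.map_sum, map_sum]
    refine Finset.sum_congr rfl fun s _ => ?_
    have := T.map_smul_univ (fun j => x (s j)) (fun j => (Pi.single (s j) 1 : Fin n → ℝ))
    rw [this, smul_eq_mul]
    simp [mul_comm]

lemma taylor_isBigO {M : ℕ → ℝ} {f : (Fin n → ℝ) → ℝ} (hf : QAt M f 0) (k : ℕ) :
    (fun x => f x - ∑ j ∈ Finset.range k, iteratedFDeriv ℝ j f 0 (fun _ => x) / j !) =O[𝓝 0] fun x => ‖x‖ ^ k := by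
  obtain ⟨A, B, r, hA, hB, hr, h⟩ := hf.exists_ball
  refine Asymptotics.IsBigO.of_bound ((A * B ^ k * k ! * M k) / k !) ?_
  filter_upwards [Metric.ball_mem_nhds (0 : Fin n → ℝ) hr] with x hx
  have hseg : ∀ t ∈ Icc (0:ℝ) 1, (0 : Fin n → ℝ) + t • x ∈ Metric.ball (0 : Fin n → ℝ) r := by
    intro t ht
    have hx' : ‖x‖ < r := mem_ball_zero_iff.1 hx
    rw [mem_ball_zero_iff, zero_add, norm_smul, Real.norm_eq_abs, abs_of_nonneg ht.1]
    have := norm_nonneg x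
    nlinarith [ht.2]
  have h1 := chain_taylor (T := 1) k (fun j t => iteratedFDeriv ℝ j f ((0 : Fin n → ℝ) + t • x) (fun _ => x))
    (fun j t ht => hasDerivAt_line (h _ (hseg t ht)).1 j) (A * B ^ k * k ! * M k * ‖x‖ ^ k) (fun t ht => by
      have h2 := (iteratedFDeriv ℝ k f ((0 : Fin n → ℝ) + t • x)).le_opNorm (fun _ => x)
      rw [Real.norm_eq_abs] at h2
      refine h2.trans ?_
      simp only [Finset.prod_const, Finset.card_univ, Fintype.card_fin]
      exact mul_le_mul_of_nonneg_right ((h _ (hseg t ht)).2 k) (by positivity)) 1 (by simp)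
  simp only [one_smul, zero_add, zero_smul, one_pow, iteratedFDeriv_zero_apply] at h1
  rw [Real.norm_eq_abs, norm_pow, norm_norm]
  simp only [div_eq_mul_inv, one_mul] at h1 ⊢
  refine h1.trans (le_of_eq ?_)
  ring

lemma exists_asy {M : ℕ → ℝ} {f : (Fin n → ℝ) → ℝ} (hf : QAt M f 0) : ∃ F, Asy f F := by
  have h1 : ∀ j : ℕ, ∃ p : MvPolynomial (Fin n) ℝ, p.IsHomogeneous j ∧
      ∀ x : Fin n → ℝ, MvPolynomial.eval x p = iteratedFDeriv ℝ j f 0 (fun _ => x) / j ! := by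
    intro j
    obtain ⟨p, hp, hpe⟩ := multilinear_poly (iteratedFDeriv ℝ j f 0)
    refine ⟨MvPolynomial.C ((j ! : ℝ)⁻¹) * p, ?_, fun x => ?_⟩
    · simpa using (MvPolynomial.isHomogeneous_C (Fin n) ((j ! : ℝ)⁻¹)).mul hp
    · rw [map_mul, MvPolynomial.eval_C, hpe, div_eq_inv_mul]
  choose P hPh hPe using h1
  refine ⟨fun d => MvPolynomial.coeff d (P d.degree), fun k => ⟨∑ j ∈ Finset.range k, P j, ?_, ?_⟩⟩
  · intro d hd
    rw [MvPolynomial.coeff_sum, Finset.sum_eq_single d.degree]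
    · rfl
    · intro j _ hj
      exact (hPh j).coeff_eq_zero (Ne.symm hj)
    · intro h; exact absurd (Finset.mem_range.2 hd) h
  · refine (taylor_isBigO hf k).congr_left fun x => ?_
    rw [map_sum]
    simp only [hPe]

open MvPolynomial in
lemma asy_comb {ι : Type*} [Fintype ι] {f : ι → (Fin n → ℝ) → ℝ} {F : ι → MvPowerSeries (Fin n) ℝ} (hf : ∀ i, Asy (f i) (F i))
    {g : (Fin n → ℝ) → ℝ} {G : MvPowerSeries (Fin n) ℝ} (hg : Asy g G) (Q : ι → MvPowerSeries (Fin n) ℝ)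
    (hG : ∑ i, Q i * F i = G) (k : ℕ) : ∃ q : ι → (Fin n → ℝ) → ℝ,
      (fun x => g x - ∑ i, q i x * f i x) =O[𝓝 0] fun x => ‖x‖ ^ k := by
  classical
  obtain ⟨p0, hp0, hO0⟩ := hg k
  choose p hp hO using fun i => hf i k
  set q : ι → MvPolynomial (Fin n) ℝ := fun i => MvPowerSeries.truncTotal k (Q i) with hq
  refine ⟨fun i x => eval x (q i), ?_⟩
  have h1 : (fun x => eval x (p0 - ∑ i, q i * p i)) =O[𝓝 0] fun x : Fin n → ℝ => ‖x‖ ^ k := by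
    apply poly_isBigO
    intro d hd
    rw [coeff_sub, hp0 d hd, ← hG, coeff_sum, map_sum, sub_eq_zero]
    refine Finset.sum_congr rfl fun i _ => ?_
    rw [MvPowerSeries.coeff_mul, MvPolynomial.coeff_mul]
    refine Finset.sum_congr rfl fun e he => ?_
    have h2 : e.1.degree + e.2.degree = d.degree := by
      rw [← Finset.HasAntidiagonal.mem_antidiagonal.1 he, map_add]
    rw [hp i _ (by omega), hq, MvPowerSeries.coeff_truncTotal _ (by omega)]
  have h2 : (fun x => ∑ i, eval x (q i) * (f i x - eval x (p i))) =O[𝓝 0] fun x : Fin n → ℝ => ‖x‖ ^ k := by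
    refine Asymptotics.IsBigO.fun_sum fun i _ => ?_
    have h3 : (fun x : Fin n → ℝ => eval x (q i)) =O[𝓝 0] fun _ => (1:ℝ) :=
      (((MvPolynomial.continuous_eval (q i)).tendsto 0).isBigO_one ℝ)
    simpa using h3.mul (hO i)
  refine ((hO0.add h1).sub h2).congr_left fun x => ?_
  simp only [map_sub, map_sum, map_mul, mul_sub, Finset.sum_sub_distrib]
  ring

theorem acc {M : ℕ → ℝ} (hM : Wt M) (f : ℕ → (Fin n → ℝ) → ℝ) (hf : ∀ j, QAt M (f j) 0) :
    ∃ J : ℕ, ∀ j ≥ J, ∀ U : Ultrafilter (Fin n → ℝ), (U : Filter (Fin n → ℝ)) ≤ 𝓝 0 →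
      (∀ i ≤ J, ∀ᶠ x in U, f i x = 0) → ∀ᶠ x in U, f j x = 0 := by
  choose F hF using fun j => exists_asy (hf j)
  let I : ℕ →o Ideal (MvPowerSeries (Fin n) ℝ) :=
    ⟨fun j => Ideal.span (Set.range fun i : Fin (j+1) => F i), by
      intro j j' hjj
      refine Ideal.span_mono ?_
      rintro _ ⟨i, rfl⟩
      exact ⟨⟨i, by omega⟩, rfl⟩⟩
  have hN : IsNoetherian (MvPowerSeries (Fin n) ℝ) (MvPowerSeries (Fin n) ℝ) :=
    MvPowerSeries.isNoetherianRing ℝ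
  obtain ⟨J, hJ⟩ := monotone_stabilizes_iff_noetherian.2 hN I
  refine ⟨J, fun j hj U hU hz => ?_⟩
  have h1 : F j ∈ I J := by
    rw [hJ j hj]
    exact Ideal.subset_span ⟨⟨j, by omega⟩, rfl⟩
  obtain ⟨Q, hQ⟩ := Ideal.mem_span_range_iff_exists_fun.1 h1
  refine key hM (fun i : Fin (J+1) => f i) (f j) (fun i => hf i) (hf j) (fun k => ?_) U hU
    (fun i => hz i (by omega))
  obtain ⟨q, hq⟩ := asy_comb (fun i : Fin (J+1) => hF i) (hF j) Q hQ k
  exact ⟨Finset.univ, q, hq⟩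

lemma local_eq {M M' : ℕ → ℝ} (hM' : Wt M') {c ρ : ℝ} (hc : 0 < c) (hρ : 0 < ρ) (hMp : ∀ k, 0 < M k)
    (hMM : ∀ k, M k = c * ρ ^ k * M' k) {U X : Set (Fin n → ℝ)} {a : Fin n → ℝ} (hU : IsOpen U) (haU : a ∈ U)
    (hX : IsQMClosed M U X) : ∃ f : (Fin n → ℝ) → ℝ, QAt M' f a ∧ ∀ᶠ x in 𝓝 a, x ∈ X ↔ f x = 0 := by
  obtain ⟨hXU, hcl, hloc⟩ := hX
  by_cases ha : a ∈ X
  · obtain ⟨V, hV, haV, hVU, k, g, hg, hXV⟩ := hloc a ha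
    refine ⟨fun x => ∑ i, g i x ^ 2, QAt.finset_sum hM' _ fun i _ =>
      (MemDC.qat hc hρ hMp hMM hV haV (hg i)).pow hM' 2, ?_⟩
    filter_upwards [hV.mem_nhds haV] with x hx
    have h1 : x ∈ X ↔ x ∈ X ∩ V := ⟨fun h => ⟨h, hx⟩, fun h => h.1⟩
    rw [h1, hXV, Finset.sum_eq_zero_iff_of_nonneg fun i _ => sq_nonneg _]
    simp [hx]
  · refine ⟨fun _ => 1, QAt.const hM' 1 a, ?_⟩
    have h1 : a ∉ closure X := fun h => ha (hcl ⟨h, haU⟩)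
    filter_upwards [isClosed_closure.isOpen_compl.mem_nhds h1] with x hx
    simp only [one_ne_zero, iff_false]
    exact fun h => hx (subset_closure h)

theorem main (M : ℕ → ℝ) (hM : IsDCSeq M) (a : Fin n → ℝ)
    (U X : ℕ → Set (Fin n → ℝ))
    (hUopen : ∀ j, IsOpen (U j)) (haU : ∀ j, a ∈ U j)
    (hX : ∀ j, IsQMClosed M (U j) (X j))
    (hdec : ∀ j, ∃ W : Set (Fin n → ℝ), IsOpen W ∧ a ∈ W ∧ X (j + 1) ∩ W ⊆ X j ∩ W) :
    ∃ k, ∀ j ≥ k, ∃ W : Set (Fin n → ℝ), IsOpen W ∧ a ∈ W ∧ X j ∩ W = X k ∩ W := by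
  obtain ⟨M', c, ρ, hM', hc, hρ, hMM⟩ := exists_wt hM
  choose f hf hfX using fun j => local_eq hM' hc hρ hM.1 hMM (hUopen j) (haU j) (hX j)
  have hdec' : ∀ i j, i ≤ j → ∀ᶠ x in 𝓝 a, x ∈ X j → x ∈ X i := by
    intro i j hij
    induction j, hij using Nat.le_induction with
    | base => exact Eventually.of_forall fun x h => h
    | succ j _ ih =>
      obtain ⟨W, hW, haW, hWX⟩ := hdec j
      filter_upwards [ih, hW.mem_nhds haW] with x h1 h2 h3
      exact h1 (hWX ⟨h3, h2⟩).1
  obtain ⟨J, hJ⟩ := acc hM' (fun j x => f j (x + a)) fun j => (hf j).translate hM'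
  have ht : Tendsto (fun x : Fin n → ℝ => x + a) (𝓝 0) (𝓝 a) := by
    have : Continuous fun x : Fin n → ℝ => x + a := by fun_prop
    simpa using this.tendsto 0
  have ht' : Tendsto (fun x : Fin n → ℝ => x - a) (𝓝 a) (𝓝 0) := by
    have : Continuous fun x : Fin n → ℝ => x - a := by fun_prop
    simpa using this.tendsto a
  refine ⟨J, fun j hj => ?_⟩
  have hmain : ∀ᶠ x in 𝓝 (0 : Fin n → ℝ), x + a ∈ X J → x + a ∈ X j := by
    by_contra hcon
    have hfr : ∃ᶠ x in 𝓝 (0 : Fin n → ℝ), ¬ (x + a ∈ X J → x + a ∈ X j) := not_eventually.1 hcon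
    have : NeBot (𝓝 (0 : Fin n → ℝ) ⊓ 𝓟 {x | ¬ (x + a ∈ X J → x + a ∈ X j)}) :=
      frequently_mem_iff_neBot.1 hfr
    obtain ⟨V, hV⟩ := Ultrafilter.exists_le (𝓝 (0 : Fin n → ℝ) ⊓ 𝓟 {x | ¬ (x + a ∈ X J → x + a ∈ X j)})
    have hV0 : (V : Filter (Fin n → ℝ)) ≤ 𝓝 0 := hV.trans inf_le_left
    have hVs : ∀ᶠ x in V, ¬ (x + a ∈ X J → x + a ∈ X j) := (le_principal_iff.1 (hV.trans inf_le_right))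
    have h1 := hJ j hj V hV0 (fun i hi => by
      filter_upwards [hV0 (ht.eventually (hdec' i J hi)), hV0 (ht.eventually (hfX i)), hVs] with x b1 b2 b3
      push Not at b3
      exact b2.1 (b1 b3.1))
    obtain ⟨x, b1, b2, b3⟩ := (h1.and (((ht.eventually (hfX j)).filter_mono hV0).and hVs)).exists
    push Not at b3
    exact b3.2 (b2.2 b1)
  have h2 : ∀ᶠ x in 𝓝 a, x ∈ X j ↔ x ∈ X J := by
    filter_upwards [hdec' J j hj, ht'.eventually hmain] with x b1 b2
    simp only [sub_add_cancel] at b2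
    exact ⟨b1, b2⟩
  obtain ⟨W, hWs, hW, haW⟩ := eventually_nhds_iff.1 h2
  refine ⟨W, hW, haW, ?_⟩
  ext x
  exact ⟨fun h => ⟨(hWs x h.2).1 h.1, h.2⟩, fun h => ⟨(hWs x h.2).2 h.1, h.2⟩⟩
end formal
end QDCP


namespace QDC

/-- **Topological Noetherianity** for quasianalytic Denjoy–Carleman classes:
any decreasing sequence of germs at a point of closed `Q_M`-sets stabilizes. -/
theorem topological_noetherianity
    {n : ℕ} (M : ℕ → ℝ) (hM : IsDCSeq M) (a : Fin n → ℝ)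
    (U X : ℕ → Set (Fin n → ℝ))
    (hUopen : ∀ j, IsOpen (U j)) (haU : ∀ j, a ∈ U j)
    (hX : ∀ j, IsQMClosed M (U j) (X j))
    (hdec : ∀ j, ∃ W : Set (Fin n → ℝ), IsOpen W ∧ a ∈ W ∧ X (j + 1) ∩ W ⊆ X j ∩ W) :
    ∃ k, ∀ j ≥ k, ∃ W : Set (Fin n → ℝ), IsOpen W ∧ a ∈ W ∧ X j ∩ W = X k ∩ W := by
  exact QDCP.main M hM a U X hUopen haU hX hdec

end QDC
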